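/- Let (T²,g) be a Riemannian torus. If there exists a contractible closed geodesic on T², then for every nontrivial translation element τ there exist an integer k ≥ 2 and a non-primitive axis of τ^k, i.e. an axis α of τ^k with α(ℝ) ≠ τ α(ℝ). -/

import Mathlib

open Filter Topology Set
open scoped ENNReal

noncomputable section

/-- The Euclidean norm of a point of `ℝ × ℝ` (the universal covering of `T²`). -/
def norm2 (p : ℝ × ℝ) : ℝ := Real.sqrt (p.1 ^ 2 + p.2 ^ 2)

/-- The translation vector of the covering transformation `τ_{(m,n)}` of `T² = ℝ²/ℤ²`. -/
def lat (k : ℤ × ℤ) : ℝ × ℝ := ((k.1 : ℝ), (k.2 : ℝ))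

/-- The transl of a curve in `ℝ²` by the covering transformation `τ_k`. -/
def transl (k : ℤ × ℤ) (c : ℝ → ℝ × ℝ) : ℝ → ℝ × ℝ := fun t => c t + lat k

/-- The asymptotic direction `δ(τ_k)` of the axes of the translation element `τ_k`. -/
def latDir (k : ℤ × ℤ) : ℝ × ℝ := (norm2 (lat k))⁻¹ • lat k

/-- A smooth Riemannian metric on the torus `T² = ℝ²/ℤ²`, described through its lift to the
universal covering `ℝ²`: a smooth family of positive definite symmetric bilinear forms on the
tangent spaces of `ℝ²`, invariant under the deck transformation group `ℤ²`. -/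
structure TorusMetric where
  g : (ℝ × ℝ) → (ℝ × ℝ) → (ℝ × ℝ) → ℝ
  smooth : ContDiff ℝ (⊤ : ℕ∞) fun p : (ℝ × ℝ) × (ℝ × ℝ) × (ℝ × ℝ) => g p.1 p.2.1 p.2.2
  symm : ∀ x v w, g x v w = g x w v
  linear : ∀ x w, IsLinearMap ℝ fun v => g x v w
  posdef : ∀ x v, v ≠ 0 → 0 < g x v v
  periodic : ∀ (k : ℤ × ℤ) (x v w : ℝ × ℝ), g (x + lat k) v w = g x v w

namespace TorusMetric

/-- The Riemannian length of the curve `c` between the parameters `a` and `b`. -/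
def length (M : TorusMetric) (c : ℝ → ℝ × ℝ) (a b : ℝ) : ℝ :=
  ∫ t in a..b, Real.sqrt (M.g (c t) (deriv c t) (deriv c t))

/-- The Riemannian distance on the universal covering `ℝ²` (hence also on `T²`). -/
def dist (M : TorusMetric) (x y : ℝ × ℝ) : ℝ :=
  sInf {L | ∃ c : ℝ → ℝ × ℝ, ContDiff ℝ 1 c ∧ c 0 = x ∧ c 1 = y ∧ L = M.length c 0 1}

/-- A (complete, unit speed) geodesic of the lifted metric on the universal covering `ℝ²`:
a smooth curve with constant unit speed which is locally length minimizing. -/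
def IsGeodesic (M : TorusMetric) (c : ℝ → ℝ × ℝ) : Prop :=
  ContDiff ℝ (⊤ : ℕ∞) c ∧ (∀ t, M.g (c t) (deriv c t) (deriv c t) = 1) ∧
    ∀ t : ℝ, ∃ ε > 0, ∀ s₁ s₂, t - ε ≤ s₁ → s₁ ≤ s₂ → s₂ ≤ t + ε →
      M.dist (c s₁) (c s₂) = M.length c s₁ s₂

end TorusMetric

/-- The distance between two points of the unit tangent bundle `ST²` of the torus; points of
`ST²` are represented by points of the tangent bundle `ℝ² × ℝ²` of the universal covering
(the deck transformations act trivially on the vector component). -/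
def phaseDist (p q : (ℝ × ℝ) × (ℝ × ℝ)) : ℝ :=
  sInf {r : ℝ | ∃ k : ℤ × ℤ, r = norm2 (p.1 - (q.1 + lat k)) + norm2 (p.2 - q.2)}

/-- A `(φ,ε)`-separated set with respect to time `T` for the geodesic flow `φ` of `M` on
`ST²`: a finite family of geodesics (each geodesic `c` representing the phase point
`(c 0, ċ 0) ∈ ST²`, of which `t ↦ (c t, ċ t)` is the flow orbit) such that any two distinct
members satisfy `max_{0 ≤ t ≤ T} d(φᵗ v, φᵗ w) > ε`. -/
def IsSeparated (M : TorusMetric) (ε T : ℝ) (F : Finset (ℝ → ℝ × ℝ)) : Prop :=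
  (∀ c ∈ F, M.IsGeodesic c) ∧
    ∀ c₁ ∈ F, ∀ c₂ ∈ F, c₁ ≠ c₂ →
      ∃ t ∈ Set.Icc (0 : ℝ) T, ε < phaseDist (c₁ t, deriv c₁ t) (c₂ t, deriv c₂ t)

/-- `r_T(φ, ε)`: the maximal cardinality of `(φ,ε)`-separated sets with respect to `T`. -/
def sepCount (M : TorusMetric) (ε T : ℝ) : ℝ≥0∞ :=
  ⨆ (F : Finset (ℝ → ℝ × ℝ)) (_ : IsSeparated M ε T F), (F.card : ℝ≥0∞)

/-- Extended real logarithm of an extended nonnegative real. -/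
def elog (x : ℝ≥0∞) : EReal :=
  if x = 0 then ⊥ else if x = ⊤ then ⊤ else ((Real.log x.toReal : ℝ) : EReal)

/-- Bowen's topological entropy `h_top(g)` of the geodesic flow of `g` on `ST²`:
`lim_{ε → 0} limsup_{T → ∞} (1/T) log r_T(φ,ε)`; since `r_T(φ,ε)` is monotone in `ε`,
the limit `ε → 0` is realized as the supremum over `ε > 0`. -/
def topEnt (M : TorusMetric) : EReal :=
  ⨆ (ε : ℝ) (_ : 0 < ε),
    Filter.limsup (fun T : ℝ => ((T⁻¹ : ℝ) : EReal) * elog (sepCount M ε T)) Filter.atTop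

/-- The forward ray `c⁺` of `c` is escaping: `‖c(t)‖ → ∞` as `t → ∞`. -/
def EscapesForward (c : ℝ → ℝ × ℝ) : Prop :=
  Filter.Tendsto (fun t => norm2 (c t)) Filter.atTop Filter.atTop

/-- The backward ray `c⁻` of `c` is escaping: `‖c(-t)‖ → ∞` as `t → ∞`. -/
def EscapesBackward (c : ℝ → ℝ × ℝ) : Prop :=
  Filter.Tendsto (fun t => norm2 (c (-t))) Filter.atTop Filter.atTop

/-- `z ∈ S¹` is the asymptotic direction `δ(c⁺) = lim_{t → ∞} c(t)/‖c(t)‖` of the forward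
ray of `c`. -/
def HasDirection (c : ℝ → ℝ × ℝ) (z : ℝ × ℝ) : Prop :=
  norm2 z = 1 ∧ Filter.Tendsto (fun t => (norm2 (c t))⁻¹ • c t) Filter.atTop (nhds z)

/-- The canonical projection `π : S¹ → P¹(ℝ) ≅ ℝ ∪ {∞}`, sending `(x, y)` to `y/x` if
`x ≠ 0` and to `∞` otherwise; `ℝ ∪ {∞}` is the one-point compactification of `ℝ`. -/
def projPt (z : ℝ × ℝ) : OnePoint ℝ :=
  if z.1 = 0 then OnePoint.infty else ((z.2 / z.1 : ℝ) : OnePoint ℝ)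

/-- `crossDet v w ≠ 0` expresses transversality of two directions in `ℝ²`. -/
def crossDet (v w : ℝ × ℝ) : ℝ := v.1 * w.2 - v.2 * w.1

/-- The set of points at which the curve `c₁` (restricted to parameters in `D₁`) and the
curve `c₂` (restricted to parameters in `D₂`) intersect transversally. -/
def transInter (c₁ c₂ : ℝ → ℝ × ℝ) (D₁ D₂ : Set ℝ) : Set (ℝ × ℝ) :=
  {x | ∃ s ∈ D₁, ∃ t ∈ D₂, c₁ s = x ∧ c₂ t = x ∧ crossDet (deriv c₁ s) (deriv c₂ t) ≠ 0}

/-- The geodesic `c` is an axis of the (nontrivial) translation element `τ_k`: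
`τ_k c(t) = c(t + ℓ)` for some `ℓ` and all `t`. -/
def IsAxisOf (M : TorusMetric) (c : ℝ → ℝ × ℝ) (k : ℤ × ℤ) : Prop :=
  M.IsGeodesic c ∧ k ≠ 0 ∧ ∃ ℓ : ℝ, ∀ t, c (t + ℓ) = c t + lat k

/-- The geodesic `c` is an axis of some nontrivial translation element. -/
def IsAxis (M : TorusMetric) (c : ℝ → ℝ × ℝ) : Prop := ∃ k : ℤ × ℤ, IsAxisOf M c k

/-- The curve `c` is minimal: each of its segments minimizes the Riemannian length between
its endpoints. -/
def IsMinimal (M : TorusMetric) (c : ℝ → ℝ × ℝ) : Prop :=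
  ∀ s t : ℝ, s ≤ t → M.dist (c s) (c t) = M.length c s t

/-- Equivalence of translation elements: `τ₁^a = τ₂^b` for some nonzero integers `a, b`. -/
def TransEquiv (k₁ k₂ : ℤ × ℤ) : Prop := ∃ a b : ℤ, a ≠ 0 ∧ b ≠ 0 ∧ a • k₁ = b • k₂

/-- A translation element is primitive if it is not a nontrivial power of another
translation element. -/
def IsPrimitive (k : ℤ × ℤ) : Prop := k ≠ 0 ∧ ∀ (j : ℤ × ℤ) (n : ℤ), k = n • j → IsUnit n

/-- The metric `g` on `T²` is flat, i.e. its Gaussian curvature vanishes identically;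
equivalently (by the theorems of Myers–Steenrod and Cartan–Hadamard), the universal covering
`ℝ²` with the induced Riemannian distance is isometric to the Euclidean plane. -/
def IsFlat (M : TorusMetric) : Prop :=
  ∃ F : (ℝ × ℝ) ≃ (ℝ × ℝ), ∀ x y, M.dist x y = norm2 (F x - F y)

/-! ### Planar topology -/

lemma angle_window {θ : ℝ → ℝ} (hc : ContinuousOn θ (Icc 0 1))
    (hs : ∀ t ∈ Icc (0 : ℝ) 1, Real.sin (θ t) < 0) (h0 : Real.cos (θ 0) < 0)
    (h1 : 0 < Real.cos (θ 1)) : θ 0 < θ 1 := by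
  by_contra! hle
  have hne : ∀ k : ℤ, k * Real.pi ∉ Icc (θ 1) (θ 0) := by
    intro k hk
    obtain ⟨t, ht, hkt⟩ := intermediate_value_Icc' zero_le_one hc hk
    have := hs t ht
    rw [hkt, Real.sin_int_mul_pi] at this
    exact lt_irrefl _ this
  have hpi := Real.pi_pos
  set k := ⌊θ 0 / Real.pi⌋ with hk
  have h2 : k * Real.pi ≤ θ 0 := by
    have := Int.floor_le (θ 0 / Real.pi)
    rwa [le_div_iff₀ hpi] at this
  have h3 : θ 0 < (k + 1) * Real.pi := by
    have := Int.lt_floor_add_one (θ 0 / Real.pi)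
    rwa [div_lt_iff₀ hpi] at this
  have h4 : k * Real.pi < θ 1 := by
    by_contra! h
    exact hne k ⟨h, h2⟩
  have e0 : θ 0 = (θ 0 - k * Real.pi) + k * Real.pi := by ring
  have e1 : θ 1 = (θ 1 - k * Real.pi) + k * Real.pi := by ring
  have hs0 := hs 0 (by simp)
  rw [e0, Real.sin_add_int_mul_pi] at hs0
  rw [e0, Real.cos_add_int_mul_pi] at h0
  rw [e1, Real.cos_add_int_mul_pi] at h1
  set x := θ 0 - k * Real.pi
  set y := θ 1 - k * Real.pi
  have hx : 0 ≤ Real.sin x := Real.sin_nonneg_of_nonneg_of_le_pi (by simp [x, h2]) (by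
    simp only [x]; linarith)
  have hyx : y ≤ x := by simp only [x, y]; linarith
  have hcos : Real.cos x ≤ Real.cos y :=
    Real.cos_le_cos_of_nonneg_of_le_pi (by simp only [y]; linarith)
      (by simp only [x]; linarith) hyx
  rcases Int.even_or_odd k with h | h
  · rw [h.neg_one_zpow] at hs0
    linarith
  · rw [h.neg_one_zpow] at h0 h1
    linarith

/-- The two-dimensional Poincaré–Miranda theorem on the unit square. -/
lemma poincare_miranda {D : ℝ × ℝ → ℝ × ℝ} (hD : ContinuousOn D (Icc 0 1 ×ˢ Icc 0 1))
    (hl : ∀ u ∈ Icc (0 : ℝ) 1, (D (0, u)).1 < 0) (hr : ∀ u ∈ Icc (0 : ℝ) 1, 0 < (D (1, u)).1)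
    (hb : ∀ s ∈ Icc (0 : ℝ) 1, (D (s, 0)).2 < 0) (ht : ∀ s ∈ Icc (0 : ℝ) 1, 0 < (D (s, 1)).2) :
    ∃ s ∈ Icc (0 : ℝ) 1, ∃ u ∈ Icc (0 : ℝ) 1, D (s, u) = 0 := by
  by_contra! hne
  let cl : ℝ → ℝ := fun t => max 0 (min 1 t)
  have hcl : Continuous cl := by fun_prop
  have hclm : ∀ t, cl t ∈ Icc (0 : ℝ) 1 := fun t => ⟨le_max_left _ _, by simp [cl]⟩
  have hcli : ∀ t ∈ Icc (0 : ℝ) 1, cl t = t := fun t ht => by simp [cl, ht.1, ht.2]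
  let q : ℂ → ℝ × ℝ := fun z => (cl z.re, cl z.im)
  have hq : Continuous q := by
    have := Complex.continuous_re
    have := Complex.continuous_im
    fun_prop
  have hqm : ∀ z, q z ∈ (Icc 0 1 ×ˢ Icc 0 1 : Set (ℝ × ℝ)) := fun z => ⟨hclm _, hclm _⟩
  have hDq : Continuous fun z => D (q z) := by
    rw [← continuousOn_univ]
    exact hD.comp hq.continuousOn fun z _ => hqm z
  let g : ℂ → ℂ := fun z => ⟨(D (q z)).1, (D (q z)).2⟩
  have hg : Continuous g := by
    have : g = fun z => (((D (q z)).1 : ℝ) : ℂ) + (((D (q z)).2 : ℝ) : ℂ) * Complex.I := by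
      funext z; apply Complex.ext <;> simp [g]
    rw [this]
    exact ((Complex.continuous_ofReal.comp (continuous_fst.comp hDq))).add
      ((Complex.continuous_ofReal.comp (continuous_snd.comp hDq)).mul continuous_const)
  have hg0 : (0 : ℂ) ∉ g '' univ := by
    rintro ⟨z, -, hz⟩
    apply hne _ (hclm z.re) _ (hclm z.im)
    have h1 := congrArg Complex.re hz
    have h2 := congrArg Complex.im hz
    exact Prod.ext h1 h2
  have hsc : IsSimplyConnected (univ : Set ℂ) := by
    rw [IsSimplyConnected]
    have : ContractibleSpace (univ : Set ℂ) := (convex_univ).contractibleSpace univ_nonempty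
    infer_instance
  obtain ⟨f, hf, hfg⟩ := Complex.exists_continuousOn_eqOn_exp_comp hsc isOpen_univ
    hg.continuousOn hg0
  rw [continuousOn_univ] at hf
  have hre : ∀ z, (D (q z)).1 = Real.exp (f z).re * Real.cos (f z).im := fun z => by
    have := congrArg Complex.re (hfg (mem_univ z))
    simpa [Complex.exp_re, g] using this.symm
  have him : ∀ z, (D (q z)).2 = Real.exp (f z).re * Real.sin (f z).im := fun z => by
    have := congrArg Complex.im (hfg (mem_univ z))
    simpa [Complex.exp_im, g] using this.symm
  let θ : ℝ → ℝ → ℝ := fun s u => (f ⟨s, u⟩).im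
  have hmk : Continuous fun p : ℝ × ℝ => (⟨p.1, p.2⟩ : ℂ) := by
    have : (fun p : ℝ × ℝ => (⟨p.1, p.2⟩ : ℂ)) = fun p => (p.1 : ℂ) + p.2 * Complex.I := by
      funext z; apply Complex.ext <;> simp
    rw [this]; fun_prop
  have hθ : Continuous fun p : ℝ × ℝ => θ p.1 p.2 :=
    Complex.continuous_im.comp (hf.comp hmk)
  have hD1 : ∀ s ∈ Icc (0 : ℝ) 1, ∀ u ∈ Icc (0 : ℝ) 1, ∃ e > 0,
      (D (s, u)).1 = e * Real.cos (θ s u) ∧ (D (s, u)).2 = e * Real.sin (θ s u) := by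
    intro s hs u hu
    refine ⟨_, Real.exp_pos (f ⟨s, u⟩).re, ?_, ?_⟩
    · have := hre ⟨s, u⟩
      simpa [q, hcli s hs, hcli u hu] using this
    · have := him ⟨s, u⟩
      simpa [q, hcli s hs, hcli u hu] using this
  have i0 : (0 : ℝ) ∈ Icc (0 : ℝ) 1 := by simp
  have i1 : (1 : ℝ) ∈ Icc (0 : ℝ) 1 := by simp
  have cl' : ∀ u ∈ Icc (0 : ℝ) 1, Real.cos (θ 0 u) < 0 := fun u hu => by
    obtain ⟨e, he, h1, h2⟩ := hD1 0 i0 u hu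
    have := hl u hu
    rw [h1] at this
    nlinarith
  have cr : ∀ u ∈ Icc (0 : ℝ) 1, 0 < Real.cos (θ 1 u) := fun u hu => by
    obtain ⟨e, he, h1, h2⟩ := hD1 1 i1 u hu
    have := hr u hu
    rw [h1] at this
    nlinarith
  have cb : ∀ u ∈ Icc (0 : ℝ) 1, Real.sin (θ u 0) < 0 := fun u hu => by
    obtain ⟨e, he, h1, h2⟩ := hD1 u hu 0 i0
    have := hb u hu
    rw [h2] at this
    nlinarith
  have ct : ∀ u ∈ Icc (0 : ℝ) 1, 0 < Real.sin (θ u 1) := fun u hu => by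
    obtain ⟨e, he, h1, h2⟩ := hD1 u hu 1 i1
    have := ht u hu
    rw [h2] at this
    nlinarith
  have sub3 : ∀ t ∈ Icc (0 : ℝ) 1, 1 - t ∈ Icc (0 : ℝ) 1 := fun t ht =>
    ⟨by linarith [ht.2], by linarith [ht.1]⟩
  have k1 : θ 0 0 < θ 1 0 := angle_window (θ := fun s => θ s 0)
    (by fun_prop) cb (cl' 0 i0) (cr 0 i0)
  have k2 : θ 1 0 - Real.pi / 2 < θ 1 1 - Real.pi / 2 :=
    angle_window (θ := fun s => θ 1 s - Real.pi / 2) (by fun_prop)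
      (fun t ht => by simpa [Real.sin_sub_pi_div_two] using cr t ht)
      (by simpa [Real.cos_sub_pi_div_two] using cb 1 i1)
      (by simpa [Real.cos_sub_pi_div_two] using ct 1 i1)
  have k3 : θ (1 - 0) 1 - Real.pi < θ (1 - 1) 1 - Real.pi :=
    angle_window (θ := fun s => θ (1 - s) 1 - Real.pi) (by fun_prop)
      (fun t ht => by simpa [Real.sin_sub_pi] using ct _ (sub3 t ht))
      (by simpa [Real.cos_sub_pi] using cr 1 i1)
      (by simpa [Real.cos_sub_pi] using cl' 1 i1)
  have k4 : θ 0 (1 - 0) + Real.pi / 2 < θ 0 (1 - 1) + Real.pi / 2 :=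
    angle_window (θ := fun s => θ 0 (1 - s) + Real.pi / 2) (by fun_prop)
      (fun t ht => by simpa [Real.sin_add_pi_div_two] using cl' _ (sub3 t ht))
      (by simpa [Real.cos_add_pi_div_two] using ct 0 i0)
      (by simpa [Real.cos_add_pi_div_two] using cb 0 i0)
  simp only [sub_zero, sub_self] at k3 k4
  linarith

lemma joinedIn_cross {A B : Set (ℝ × ℝ)} {p q p' q' : ℝ × ℝ} (hA : JoinedIn A p q)
    (hB : JoinedIn B p' q') (h1 : ∀ a ∈ A, p'.1 < a.1) (h2 : ∀ a ∈ A, a.1 < q'.1)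
    (h3 : ∀ b ∈ B, p.2 < b.2) (h4 : ∀ b ∈ B, b.2 < q.2) : (A ∩ B).Nonempty := by
  obtain ⟨Γ, hΓ⟩ := hA
  obtain ⟨δ, hδ⟩ := hB
  have hΓ' : ∀ u, Γ.extend u ∈ A := fun u => by
    have : Γ.extend u ∈ range Γ := by rw [← Γ.extend_range]; exact mem_range_self u
    obtain ⟨v, hv⟩ := this
    exact hv ▸ hΓ v
  have hδ' : ∀ u, δ.extend u ∈ B := fun u => by
    have : δ.extend u ∈ range δ := by rw [← δ.extend_range]; exact mem_range_self u
    obtain ⟨v, hv⟩ := this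
    exact hv ▸ hδ v
  have c1 := Γ.continuous_extend
  have c2 := δ.continuous_extend
  obtain ⟨s, -, u, -, h⟩ := poincare_miranda
    (D := fun x => ((δ.extend x.1).1 - (Γ.extend x.2).1, (Γ.extend x.2).2 - (δ.extend x.1).2))
    (by fun_prop) (fun u _ => by simpa using h1 _ (hΓ' u)) (fun u _ => by simpa using h2 _ (hΓ' u))
    (fun u _ => by simpa using h3 _ (hδ' u)) (fun u _ => by simpa using h4 _ (hδ' u))
  refine ⟨Γ.extend u, hΓ' u, ?_⟩
  have : Γ.extend u = δ.extend s := by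
    have e1 := congrArg Prod.fst h
    have e2 := congrArg Prod.snd h
    simp only [Prod.fst_zero, Prod.snd_zero] at e1 e2
    exact Prod.ext (by linarith) (by linarith)
  rw [this]
  exact hδ' s

/-! ### The norms of a torus metric and lengths of curves -/

namespace TorusMetric

variable (M : TorusMetric)

/-- The norm of a tangent vector. -/
def nd (x v : ℝ × ℝ) : ℝ := Real.sqrt (M.g x v v)

lemma g_add_left (x u v w : ℝ × ℝ) : M.g x (u + v) w = M.g x u w + M.g x v w :=
  (M.linear x w).map_add u v

lemma g_smul_left (x : ℝ × ℝ) (a : ℝ) (v w : ℝ × ℝ) : M.g x (a • v) w = a * M.g x v w :=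
  (M.linear x w).map_smul a v

lemma g_add_right (x u v w : ℝ × ℝ) : M.g x w (u + v) = M.g x w u + M.g x w v := by
  rw [M.symm, g_add_left, M.symm, M.symm x v]

lemma g_smul_right (x : ℝ × ℝ) (a : ℝ) (v w : ℝ × ℝ) : M.g x w (a • v) = a * M.g x w v := by
  rw [M.symm, g_smul_left, M.symm]

lemma g_zero (x w : ℝ × ℝ) : M.g x 0 w = 0 := by
  simpa using M.g_smul_left x 0 0 w

lemma g_nonneg (x v : ℝ × ℝ) : 0 ≤ M.g x v v := by
  rcases eq_or_ne v 0 with rfl | h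
  · rw [g_zero]
  · exact (M.posdef x v h).le

lemma nd_nonneg (x v : ℝ × ℝ) : 0 ≤ M.nd x v := Real.sqrt_nonneg _

lemma nd_sq (x v : ℝ × ℝ) : M.nd x v ^ 2 = M.g x v v := Real.sq_sqrt (M.g_nonneg x v)

lemma nd_smul (x : ℝ × ℝ) (a : ℝ) (v : ℝ × ℝ) : M.nd x (a • v) = |a| * M.nd x v := by
  rw [nd, g_smul_left, g_smul_right, ← mul_assoc, Real.sqrt_mul (mul_self_nonneg a),
    Real.sqrt_mul_self_eq_abs, nd]

lemma nd_zero (x : ℝ × ℝ) : M.nd x 0 = 0 := by simp [nd, g_zero]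

lemma nd_neg (x v : ℝ × ℝ) : M.nd x (-v) = M.nd x v := by
  simpa using M.nd_smul x (-1) v

lemma nd_lat (k : ℤ × ℤ) (x v : ℝ × ℝ) : M.nd (x + lat k) v = M.nd x v := by
  rw [nd, M.periodic, nd]

lemma continuous_g : Continuous fun p : (ℝ × ℝ) × (ℝ × ℝ) × (ℝ × ℝ) => M.g p.1 p.2.1 p.2.2 :=
  M.smooth.continuous

lemma continuous_nd : Continuous fun p : (ℝ × ℝ) × (ℝ × ℝ) => M.nd p.1 p.2 :=
  Real.continuous_sqrt.comp
    (M.continuous_g.comp (continuous_fst.prodMk (continuous_snd.prodMk continuous_snd)))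

lemma g_le_nd (x u v : ℝ × ℝ) : M.g x u v ≤ M.nd x u * M.nd x v := by
  have key : ∀ t : ℝ, 0 ≤ M.g x v v * (t * t) + 2 * M.g x u v * t + M.g x u u := fun t => by
    have := M.g_nonneg x (u + t • v)
    simp only [g_add_left, g_add_right, g_smul_left, g_smul_right, M.symm x v u] at this
    nlinarith
  have h := discrim_le_zero key
  rw [discrim] at h
  rw [nd, nd, ← Real.sqrt_mul (M.g_nonneg x u)]
  apply Real.le_sqrt_of_sq_le
  nlinarith

lemma exists_lat_add (x : ℝ × ℝ) : ∃ k : ℤ × ℤ, ∃ y ∈ (Icc 0 1 ×ˢ Icc 0 1 : Set (ℝ × ℝ)),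
    x = y + lat k := by
  refine ⟨(⌊x.1⌋, ⌊x.2⌋), (Int.fract x.1, Int.fract x.2), ⟨⟨Int.fract_nonneg _,
    (Int.fract_lt_one _).le⟩, ⟨Int.fract_nonneg _, (Int.fract_lt_one _).le⟩⟩, ?_⟩
  simp [lat]

lemma exists_nd_bounds : ∃ m C : ℝ, 0 < m ∧ 0 < C ∧
    ∀ x v, m * ‖v‖ ≤ M.nd x v ∧ M.nd x v ≤ C * ‖v‖ := by
  have hK : IsCompact ((Icc 0 1 ×ˢ Icc 0 1 : Set (ℝ × ℝ)) ×ˢ Metric.sphere (0 : ℝ × ℝ) 1) :=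
    (isCompact_Icc.prod isCompact_Icc).prod (isCompact_sphere _ _)
  have hne : ((Icc 0 1 ×ˢ Icc 0 1 : Set (ℝ × ℝ)) ×ˢ Metric.sphere (0 : ℝ × ℝ) 1).Nonempty :=
    ⟨((0, 0), (1, 0)), by simp⟩
  obtain ⟨p, hp, hpm⟩ := hK.exists_isMinOn hne M.continuous_nd.continuousOn
  obtain ⟨q, hq, hqm⟩ := hK.exists_isMaxOn hne M.continuous_nd.continuousOn
  have hm : 0 < M.nd p.1 p.2 := Real.sqrt_pos.2 (M.posdef _ _ fun h => by
    have := hp.2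
    rw [h] at this
    simp at this)
  refine ⟨M.nd p.1 p.2, M.nd q.1 q.2, hm, hm.trans_le (hpm hq), fun x v => ?_⟩
  rcases eq_or_ne v 0 with rfl | hv
  · simp [nd_zero]
  obtain ⟨k, y, hy, rfl⟩ := exists_lat_add x
  rw [nd_lat]
  have hv' : 0 < ‖v‖ := norm_pos_iff.2 hv
  have hmem : (y, ‖v‖⁻¹ • v) ∈
      ((Icc 0 1 ×ˢ Icc 0 1 : Set (ℝ × ℝ)) ×ˢ Metric.sphere (0 : ℝ × ℝ) 1) :=
    ⟨hy, by simp [norm_smul, hv'.ne']⟩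
  have e : M.nd y v = M.nd y (‖v‖⁻¹ • v) * ‖v‖ := by
    rw [nd_smul, abs_of_pos (inv_pos.2 hv')]
    field_simp
  rw [e]
  exact ⟨mul_le_mul_of_nonneg_right (hpm hmem) hv'.le,
    mul_le_mul_of_nonneg_right (hqm hmem) hv'.le⟩

/-- The lower comparison constant with the coordinate norm. -/
def cm : ℝ := M.exists_nd_bounds.choose

/-- The upper comparison constant with the coordinate norm. -/
def cC : ℝ := M.exists_nd_bounds.choose_spec.choose

lemma cm_pos : 0 < M.cm := M.exists_nd_bounds.choose_spec.choose_spec.1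

lemma cC_pos : 0 < M.cC := M.exists_nd_bounds.choose_spec.choose_spec.2.1

lemma cm_le (x v : ℝ × ℝ) : M.cm * ‖v‖ ≤ M.nd x v :=
  (M.exists_nd_bounds.choose_spec.choose_spec.2.2 x v).1

lemma le_cC (x v : ℝ × ℝ) : M.nd x v ≤ M.cC * ‖v‖ :=
  (M.exists_nd_bounds.choose_spec.choose_spec.2.2 x v).2

lemma length_eq (c : ℝ → ℝ × ℝ) (a b : ℝ) :
    M.length c a b = ∫ t in a..b, M.nd (c t) (deriv c t) := rfl

lemma continuous_speed {c : ℝ → ℝ × ℝ} (hc : ContDiff ℝ 1 c) :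
    Continuous fun t => M.nd (c t) (deriv c t) :=
  M.continuous_nd.comp (hc.continuous.prodMk (hc.continuous_deriv le_rfl))

lemma length_nonneg (c : ℝ → ℝ × ℝ) {a b : ℝ} (h : a ≤ b) : 0 ≤ M.length c a b :=
  intervalIntegral.integral_nonneg h fun _ _ => M.nd_nonneg _ _

lemma length_add {c : ℝ → ℝ × ℝ} (hc : ContDiff ℝ 1 c) (a b e : ℝ) :
    M.length c a b + M.length c b e = M.length c a e :=
  intervalIntegral.integral_add_adjacent_intervals
    ((M.continuous_speed hc).intervalIntegrable _ _)
    ((M.continuous_speed hc).intervalIntegrable _ _)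

lemma length_congr {c e : ℝ → ℝ × ℝ} {a b : ℝ} (hab : a ≤ b) (h : EqOn c e (Icc a b)) :
    M.length c a b = M.length e a b := by
  rw [length_eq, length_eq, intervalIntegral.integral_of_le hab,
    intervalIntegral.integral_of_le hab, MeasureTheory.integral_Ioc_eq_integral_Ioo,
    MeasureTheory.integral_Ioc_eq_integral_Ioo]
  refine MeasureTheory.setIntegral_congr_fun measurableSet_Ioo fun t ht => ?_
  have : c =ᶠ[𝓝 t] e := by
    filter_upwards [Icc_mem_nhds ht.1 ht.2] with s hs using h hs
  simp only [this.deriv_eq, this.eq_of_nhds]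

lemma length_comp {c : ℝ → ℝ × ℝ} (hc : ContDiff ℝ 1 c) {φ : ℝ → ℝ} (hφ : ContDiff ℝ 1 φ)
    (hm : ∀ t, 0 ≤ deriv φ t) (a b : ℝ) :
    M.length (c ∘ φ) a b = M.length c (φ a) (φ b) := by
  have hd : ∀ t, HasDerivAt φ (deriv φ t) t := fun t =>
    (hφ.differentiable one_ne_zero t).hasDerivAt
  have e : ∀ t, deriv (c ∘ φ) t = deriv φ t • deriv c (φ t) := fun t =>
    deriv.scomp t (hc.differentiable one_ne_zero _) (hφ.differentiable one_ne_zero t)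
  have := intervalIntegral.integral_comp_mul_deriv (a := a) (b := b) (f := φ)
    (f' := deriv φ) (g := fun t => M.nd (c t) (deriv c t)) (fun t _ => hd t)
    (hφ.continuous_deriv le_rfl).continuousOn (M.continuous_speed hc)
  rw [length_eq, length_eq, ← this]
  refine intervalIntegral.integral_congr fun t _ => ?_
  simp only [e, nd_smul, abs_of_nonneg (hm t), Function.comp]
  ring

lemma bddBelow_lengths (x y : ℝ × ℝ) : BddBelow {L | ∃ c : ℝ → ℝ × ℝ, ContDiff ℝ 1 c ∧
    c 0 = x ∧ c 1 = y ∧ L = M.length c 0 1} :=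
  ⟨0, by rintro _ ⟨c, -, -, -, rfl⟩; exact M.length_nonneg c zero_le_one⟩

lemma nonempty_lengths (x y : ℝ × ℝ) : {L | ∃ c : ℝ → ℝ × ℝ, ContDiff ℝ 1 c ∧
    c 0 = x ∧ c 1 = y ∧ L = M.length c 0 1}.Nonempty :=
  ⟨_, fun t => x + t • (y - x), by fun_prop, by simp, by simp, rfl⟩

lemma dist_le_length {c : ℝ → ℝ × ℝ} (hc : ContDiff ℝ 1 c) {a b : ℝ} (h : a ≤ b) :
    M.dist (c a) (c b) ≤ M.length c a b := by
  have hφ : ContDiff ℝ 1 fun t : ℝ => a + t * (b - a) := by fun_prop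
  have hd : ∀ t, deriv (fun t : ℝ => a + t * (b - a)) t = b - a := fun t => by
    simp
  have := M.length_comp hc hφ (fun t => by rw [hd]; linarith) 0 1
  simp only [zero_mul, add_zero, one_mul, add_sub_cancel] at this
  rw [← this]
  exact csInf_le (M.bddBelow_lengths _ _) ⟨_, hc.comp hφ, by simp, by simp, rfl⟩

lemma dist_nonneg (x y : ℝ × ℝ) : 0 ≤ M.dist x y :=
  le_csInf (M.nonempty_lengths x y) (by
    rintro _ ⟨c, -, -, -, rfl⟩; exact M.length_nonneg c zero_le_one)

lemma exists_curve_lt {x y : ℝ × ℝ} {r : ℝ} (h : M.dist x y < r) : ∃ c : ℝ → ℝ × ℝ,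
    ContDiff ℝ 1 c ∧ c 0 = x ∧ c 1 = y ∧ M.length c 0 1 < r := by
  obtain ⟨_, ⟨c, h1, h2, h3, rfl⟩, h4⟩ := exists_lt_of_csInf_lt (M.nonempty_lengths x y) h
  exact ⟨c, h1, h2, h3, h4⟩

lemma dist_lat (k : ℤ × ℤ) (x y : ℝ × ℝ) : M.dist (x + lat k) (y + lat k) ≤ M.dist x y := by
  refine le_of_forall_gt fun r hr => ?_
  obtain ⟨c, h1, h2, h3, h4⟩ := M.exists_curve_lt hr
  refine lt_of_le_of_lt (csInf_le (M.bddBelow_lengths _ _)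
    ⟨fun t => c t + lat k, by fun_prop, by simp [h2], by simp [h3], rfl⟩) ?_
  refine lt_of_eq_of_lt ?_ h4
  rw [length_eq, length_eq]
  simp only [deriv_add_const, nd_lat]

lemma norm_sub_le_length {c : ℝ → ℝ × ℝ} (hc : ContDiff ℝ 1 c) {a b : ℝ} (h : a ≤ b) :
    M.cm * ‖c b - c a‖ ≤ M.length c a b := by
  rw [← intervalIntegral.integral_deriv_eq_sub (f := c)
    (fun t _ => hc.differentiable one_ne_zero t)
    ((hc.continuous_deriv le_rfl).intervalIntegrable _ _)]
  calc _ ≤ M.cm * ∫ t in a..b, ‖deriv c t‖ := mul_le_mul_of_nonneg_left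
        (intervalIntegral.norm_integral_le_integral_norm h) M.cm_pos.le
    _ = ∫ t in a..b, M.cm * ‖deriv c t‖ := by rw [intervalIntegral.integral_const_mul]
    _ ≤ _ := intervalIntegral.integral_mono_on h
        ((by have := (hc.continuous_deriv le_rfl); fun_prop :
          Continuous fun t => M.cm * ‖deriv c t‖).intervalIntegrable _ _)
        ((M.continuous_speed hc).intervalIntegrable _ _) fun t _ => M.cm_le _ _

lemma norm_sub_le_dist (x y : ℝ × ℝ) : M.cm * ‖x - y‖ ≤ M.dist x y := by
  refine le_csInf (M.nonempty_lengths x y) ?_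
  rintro _ ⟨c, h1, rfl, rfl, rfl⟩
  rw [norm_sub_rev]
  exact M.norm_sub_le_length h1 zero_le_one

lemma dist_le_integral_line (x y : ℝ × ℝ) :
    M.dist x y ≤ ∫ t in (0 : ℝ)..1, M.nd (x + t • (y - x)) (y - x) := by
  refine csInf_le (M.bddBelow_lengths _ _)
    ⟨fun t => x + t • (y - x), by fun_prop, by simp, by simp, ?_⟩
  rw [length_eq]
  refine intervalIntegral.integral_congr fun t _ => ?_
  have : HasDerivAt (fun t : ℝ => x + t • (y - x)) ((1 : ℝ) • (y - x)) t :=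
    ((hasDerivAt_id t).smul_const _).const_add _
  simp only [this.deriv, one_smul]

lemma dist_le_norm_sub (x y : ℝ × ℝ) : M.dist x y ≤ M.cC * ‖x - y‖ := by
  refine (M.dist_le_integral_line x y).trans ?_
  have hc : Continuous fun t : ℝ => M.nd (x + t • (y - x)) (y - x) :=
    M.continuous_nd.comp (by fun_prop :
      Continuous fun t : ℝ => (x + t • (y - x), y - x))
  calc _ ≤ ∫ t in (0 : ℝ)..1, M.cC * ‖x - y‖ :=
        intervalIntegral.integral_mono_on zero_le_one (hc.intervalIntegrable _ _)
          (continuous_const.intervalIntegrable _ _) fun t _ => by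
            rw [norm_sub_rev]; exact M.le_cC _ _
    _ = _ := by simp

lemma dist_comm_le (x y : ℝ × ℝ) : M.dist x y ≤ M.dist y x := by
  refine le_csInf (M.nonempty_lengths y x) ?_
  rintro _ ⟨c, h1, rfl, rfl, rfl⟩
  have hd : ∀ t, deriv (fun t => c (1 - t)) t = - deriv c (1 - t) := fun t =>
    deriv_comp_const_sub (f := c) 1 t
  refine (csInf_le (M.bddBelow_lengths _ _)
    ⟨fun t => c (1 - t), by fun_prop, by simp, by simp, rfl⟩).trans_eq ?_
  rw [length_eq, length_eq]
  simp only [hd, nd_neg]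
  rw [intervalIntegral.integral_comp_sub_left (fun t => M.nd (c t) (deriv c t))]
  simp

lemma dist_comm' (x y : ℝ × ℝ) : M.dist x y = M.dist y x :=
  le_antisymm (M.dist_comm_le _ _) (M.dist_comm_le _ _)

lemma dist_triangle' (x y z : ℝ × ℝ) : M.dist x z ≤ M.dist x y + M.dist y z := by
  refine le_of_forall_pos_lt_add fun ε hε => ?_
  obtain ⟨c, hc, c0, c1, hcl⟩ := M.exists_curve_lt (lt_add_of_pos_right (M.dist x y) (half_pos hε))
  obtain ⟨e, he, e0, e1, hel⟩ := M.exists_curve_lt (lt_add_of_pos_right (M.dist y z) (half_pos hε))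
  have hψ : ContDiff ℝ 1 Real.smoothTransition := Real.smoothTransition.contDiff
  have hψm : Monotone Real.smoothTransition := Real.smoothTransition.monotone
  let φ₁ : ℝ → ℝ := fun t => Real.smoothTransition (2 * t)
  let φ₂ : ℝ → ℝ := fun t => Real.smoothTransition (2 * t - 1)
  have s1 : ContDiff ℝ 1 φ₁ := by fun_prop
  have s2 : ContDiff ℝ 1 φ₂ := by fun_prop
  have m1 : Monotone φ₁ := fun a b h => hψm (by linarith)
  have m2 : Monotone φ₂ := fun a b h => hψm (by linarith)
  let w : ℝ → ℝ × ℝ := fun t => c (φ₁ t) + e (φ₂ t) - y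
  have hw : ContDiff ℝ 1 w := by
    have := hc.comp s1
    have := he.comp s2
    fun_prop
  have hw1 : EqOn w (c ∘ φ₁) (Icc 0 (1 / 2)) := fun t ht => by
    have : φ₂ t = 0 := Real.smoothTransition.zero_of_nonpos (by linarith [ht.2])
    simp [w, this, e0]
  have hw2 : EqOn w (e ∘ φ₂) (Icc (1 / 2) 1) := fun t ht => by
    have : φ₁ t = 1 := Real.smoothTransition.one_of_one_le (by linarith [ht.1])
    simp [w, this, c1]
  have z0 : w 0 = x := by
    rw [hw1 (by simp)]; simp [φ₁, c0]
  have z1 : w 1 = z := by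
    rw [hw2 (by norm_num)]
    have : φ₂ 1 = 1 := Real.smoothTransition.one_of_one_le (by norm_num)
    simp [this, e1]
  have := M.dist_le_length hw zero_le_one
  rw [z0, z1, ← M.length_add hw 0 (1 / 2) 1, M.length_congr (by norm_num) hw1,
    M.length_congr (by norm_num) hw2, M.length_comp hc s1 (fun t => m1.deriv_nonneg),
    M.length_comp he s2 (fun t => m2.deriv_nonneg)] at this
  have a0 : φ₁ 0 = 0 := Real.smoothTransition.zero_of_nonpos (by norm_num)
  have a1 : φ₁ (1 / 2) = 1 := Real.smoothTransition.one_of_one_le (by norm_num)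
  have a2 : φ₂ (1 / 2) = 0 := Real.smoothTransition.zero_of_nonpos (by norm_num)
  have a3 : φ₂ 1 = 1 := Real.smoothTransition.one_of_one_le (by norm_num)
  rw [a0, a1, a2, a3] at this
  linarith

lemma dist_self' (x : ℝ × ℝ) : M.dist x x = 0 :=
  le_antisymm (by simpa using M.dist_le_norm_sub x x) (M.dist_nonneg x x)

lemma continuous_dist' : Continuous fun p : (ℝ × ℝ) × (ℝ × ℝ) => M.dist p.1 p.2 := by
  have : LipschitzWith (2 * M.cC).toNNReal fun p : (ℝ × ℝ) × (ℝ × ℝ) => M.dist p.1 p.2 := by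
    refine LipschitzWith.of_le_add_mul _ fun p q => ?_
    rw [Real.coe_toNNReal _ (by linarith [M.cC_pos])]
    have h1 := M.dist_triangle' p.1 q.1 p.2
    have h2 := M.dist_triangle' q.1 q.2 p.2
    have h3 := M.dist_le_norm_sub p.1 q.1
    have h4 := M.dist_le_norm_sub q.2 p.2
    have h5 : ‖p.1 - q.1‖ ≤ Dist.dist p q := by rw [dist_eq_norm]; exact norm_fst_le (p - q)
    have h6 : ‖q.2 - p.2‖ ≤ Dist.dist p q := by
      rw [dist_eq_norm, norm_sub_rev]; exact norm_snd_le (p - q)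
    nlinarith [M.cC_pos]
  exact this.continuous

end TorusMetric

/-! ### Minimal segments and local comparison -/

namespace TorusMetric

variable (M : TorusMetric)

lemma isCompact_dist_le (x : ℝ × ℝ) (r : ℝ) : IsCompact {z | M.dist x z ≤ r} := by
  refine Metric.isCompact_of_isClosed_isBounded
    (isClosed_le (M.continuous_dist'.comp (by fun_prop : Continuous fun z => (x, z)))
      continuous_const) ?_
  refine (Metric.isBounded_closedBall (x := x) (r := r / M.cm)).subset fun z hz => ?_
  rw [mem_closedBall_iff_norm, le_div_iff₀ M.cm_pos, norm_sub_rev, mul_comm]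
  exact (M.norm_sub_le_dist x z).trans hz

lemma exists_between (x y : ℝ × ℝ) {s : ℝ} (h0 : 0 ≤ s) (h1 : s ≤ M.dist x y) :
    ∃ z, M.dist x z = s ∧ M.dist z y = M.dist x y - s := by
  have key : ∀ ε > 0, ∃ z, M.dist x z = s ∧ M.dist z y < M.dist x y - s + ε := by
    intro ε hε
    obtain ⟨c, hc, rfl, rfl, hl⟩ := M.exists_curve_lt (lt_add_of_pos_right (M.dist x y) hε)
    have hcont : Continuous fun t => M.dist (c 0) (c t) :=
      M.continuous_dist'.comp (by have := hc.continuous; fun_prop : Continuous fun t => (c 0, c t))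
    obtain ⟨t, ht, hts⟩ := intermediate_value_Icc (zero_le_one (α := ℝ)) hcont.continuousOn
      (show s ∈ Icc _ _ from ⟨by simpa [dist_self'] using h0, h1⟩)
    refine ⟨c t, hts, ?_⟩
    have e1 := M.dist_le_length hc ht.1
    have e2 := M.dist_le_length hc ht.2
    have e3 := M.length_add hc 0 t 1
    simp only at hts
    linarith
  have hK : IsCompact {z | M.dist x z = s} :=
    (M.isCompact_dist_le x s).of_isClosed_subset
      (isClosed_eq (M.continuous_dist'.comp (by fun_prop : Continuous fun z => (x, z)))
        continuous_const) fun z hz => le_of_eq hz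
  obtain ⟨z₀, hz₀, -⟩ := key 1 one_pos
  obtain ⟨z, hz, hmin⟩ := hK.exists_isMinOn ⟨z₀, hz₀⟩ (f := fun z => M.dist z y)
    (M.continuous_dist'.comp (by fun_prop : Continuous fun z => (z, y))).continuousOn
  refine ⟨z, hz, le_antisymm (le_of_forall_pos_lt_add fun ε hε => ?_) ?_⟩
  · obtain ⟨w, hw, hw'⟩ := key ε hε
    exact (hmin hw).trans_lt hw'
  · have := M.dist_triangle' x z y
    have h : M.dist x z = s := hz
    linarith

lemma exists_chain (x y : ℝ × ℝ) (n : ℕ) : ∃ z : ℕ → ℝ × ℝ, z 0 = x ∧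
    (∀ i ≤ n + 1, M.dist (z i) y = M.dist x y - i * (M.dist x y / (n + 1))) ∧
    ∀ i j, i ≤ j → j ≤ n + 1 → M.dist (z i) (z j) = (j - i) * (M.dist x y / (n + 1)) := by
  set D := M.dist x y
  have hD : 0 ≤ D := M.dist_nonneg x y
  have hn : (0 : ℝ) < n + 1 := by positivity
  let nxt : ℝ × ℝ → ℝ × ℝ := fun z =>
    if h : D / (n + 1) ≤ M.dist z y then
      (M.exists_between z y (by positivity : 0 ≤ D / (n + 1)) h).choose else z
  have hnxt : ∀ z, D / (n + 1) ≤ M.dist z y → M.dist z (nxt z) = D / (n + 1) ∧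
      M.dist (nxt z) y = M.dist z y - D / (n + 1) := fun z h => by
    simp only [nxt, dif_pos h]
    exact (M.exists_between z y (by positivity : 0 ≤ D / (n + 1)) h).choose_spec
  let z : ℕ → ℝ × ℝ := fun i => nxt^[i] x
  have hz : ∀ i, z (i + 1) = nxt (z i) := fun i => Function.iterate_succ_apply' nxt i x
  have hle : ∀ i : ℕ, i ≤ n → D / (n + 1) ≤ D - i * (D / (n + 1)) := fun i hi => by
    have : (i : ℝ) ≤ n := by exact_mod_cast hi
    have e : D = (n + 1) * (D / (n + 1)) := by field_simp
    have : 0 ≤ D / (n + 1) := by positivity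
    nlinarith
  have hy : ∀ i ≤ n + 1, M.dist (z i) y = D - i * (D / (n + 1)) := by
    intro i
    induction i with
    | zero => intro; simp [z, D]
    | succ i ih =>
      intro hi
      have h1 := ih (by omega)
      rw [hz, (hnxt _ (by rw [h1]; exact hle i (by omega))).2, h1]
      push_cast; ring
  refine ⟨z, rfl, hy, fun i j hij hj => le_antisymm ?_ ?_⟩
  · induction j, hij using Nat.le_induction with
    | base => simp [dist_self']
    | succ j hij ih =>
      have h1 := ih (by omega)
      have h2 := (hnxt (z j) (by rw [hy j (by omega)]; exact hle j (by omega))).1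
      rw [← hz] at h2
      have := M.dist_triangle' (z i) (z j) (z (j + 1))
      push_cast
      linarith
  · have := M.dist_triangle' (z i) (z j) y
    rw [hy i (by omega), hy j hj] at this
    linarith

lemma tendsto_dist {ι : Type*} {l : Filter ι} {u v : ι → ℝ × ℝ} {p q : ℝ × ℝ}
    (hu : Tendsto u l (𝓝 p)) (hv : Tendsto v l (𝓝 q)) :
    Tendsto (fun n => M.dist (u n) (v n)) l (𝓝 (M.dist p q)) :=
  Tendsto.comp (f := fun n => (u n, v n)) (M.continuous_dist'.tendsto (p, q)) (hu.prodMk_nhds hv)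

lemma exists_segment (x y : ℝ × ℝ) : ∃ γ : ℝ → ℝ × ℝ, γ 0 = x ∧ γ (M.dist x y) = y ∧
    ∀ s ∈ Icc 0 (M.dist x y), ∀ t ∈ Icc 0 (M.dist x y), M.dist (γ s) (γ t) = |s - t| := by
  set D := M.dist x y with hDdef
  have hD : 0 ≤ D := M.dist_nonneg x y
  rcases hD.eq_or_lt with h0 | hpos
  · have hxy : x = y := by
      have := M.norm_sub_le_dist x y
      rw [← hDdef, ← h0] at this
      have h3 : ‖x - y‖ = 0 := le_antisymm (by nlinarith [M.cm_pos]) (norm_nonneg _)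
      exact sub_eq_zero.1 (norm_eq_zero.1 h3)
    refine ⟨fun _ => x, rfl, hxy, fun s hs t ht => ?_⟩
    rw [← h0] at hs ht
    simp only [Icc_self, mem_singleton_iff] at hs ht
    simp [hs, ht, dist_self']
  choose z z0 zy zz using fun n => M.exists_chain x y n
  let ι : ℕ → ℝ → ℕ := fun n t => ⌊t / (D / (n + 1))⌋₊
  have hstep : ∀ n : ℕ, 0 < D / (n + 1) := fun n => by positivity
  have hι1 : ∀ n, ∀ t ∈ Icc 0 D, ι n t ≤ n + 1 := fun n t ht => by
    apply Nat.floor_le_of_le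
    rw [div_le_iff₀ (hstep n)]
    push_cast
    have : ((n : ℝ) + 1) * (D / (n + 1)) = D := by field_simp
    linarith [ht.2]
  have hι2 : ∀ n, ∀ t ∈ Icc 0 D, |ι n t * (D / (n + 1)) - t| ≤ D / (n + 1) := fun n t ht => by
    have h1 := Nat.floor_le (div_nonneg ht.1 (hstep n).le)
    have h2 := Nat.lt_floor_add_one (t / (D / (n + 1)))
    rw [le_div_iff₀ (hstep n)] at h1
    rw [div_lt_iff₀ (hstep n)] at h2
    rw [abs_le]
    constructor <;> simp only [ι] <;> nlinarith
  let γn : ℕ → ℝ → ℝ × ℝ := fun n t => z n (ι n t)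
  have hγn : ∀ n, ∀ t ∈ Icc 0 D, γn n t ∈ {w | M.dist x w ≤ D} := fun n t ht => by
    have := zz n 0 (ι n t) (Nat.zero_le _) (hι1 n t ht)
    rw [z0] at this
    simp only [mem_ofPred_eq, γn, this]
    have h2 : (ι n t : ℝ) ≤ n + 1 := by exact_mod_cast hι1 n t ht
    have : ((n : ℝ) + 1) * (D / (n + 1)) = D := by field_simp
    have := hstep n
    simp only [Nat.cast_zero, sub_zero]
    nlinarith
  have hlim : ∀ t ∈ Icc 0 D, ∃ w, Tendsto (fun n => γn n t) (hyperfilter ℕ : Filter ℕ) (𝓝 w) := by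
    intro t ht
    have hU : {w | M.dist x w ≤ D} ∈ (hyperfilter ℕ).map fun n => γn n t :=
      Ultrafilter.mem_map.2 (Filter.Eventually.of_forall fun n => hγn n t ht)
    obtain ⟨w, -, hw⟩ := (M.isCompact_dist_le x D).ultrafilter_le_nhds' _ hU
    exact ⟨w, hw⟩
  choose! γ hγ using hlim
  have hto : Tendsto (fun n : ℕ => D / (n + 1)) (hyperfilter ℕ : Filter ℕ) (𝓝 0) := by
    have h := (tendsto_one_div_add_atTop_nhds_zero_nat (𝕜 := ℝ)).const_mul D
    rw [mul_zero] at h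
    exact (h.congr fun n => by ring).mono_left Nat.hyperfilter_le_atTop
  have hιt : ∀ t ∈ Icc 0 D, Tendsto (fun n => ι n t * (D / (n + 1)))
      (hyperfilter ℕ : Filter ℕ) (𝓝 t) := fun t ht => by
    rw [tendsto_iff_norm_sub_tendsto_zero]
    have h1 : ∀ n : ℕ, ‖ι n t * (D / (n + 1)) - t‖ ≤ D / (n + 1) := fun n => by
      rw [Real.norm_eq_abs]; exact hι2 n t ht
    exact squeeze_zero (fun _ => norm_nonneg _) h1 hto
  have hmain : ∀ s ∈ Icc 0 D, ∀ t ∈ Icc 0 D, s ≤ t → M.dist (γ s) (γ t) = t - s := by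
    intro s hs t ht hst
    have h1 : Tendsto (fun n => M.dist (γn n s) (γn n t)) (hyperfilter ℕ : Filter ℕ)
        (𝓝 (M.dist (γ s) (γ t))) := M.tendsto_dist (hγ s hs) (hγ t ht)
    have h2 := (hιt t ht).sub (hιt s hs)
    suffices h3 : ∀ n, ι n t * (D / (n + 1)) - ι n s * (D / (n + 1)) = M.dist (γn n s) (γn n t) from
      tendsto_nhds_unique h1 (h2.congr h3)
    intro n
    have hle : ι n s ≤ ι n t := Nat.floor_mono (div_le_div_of_nonneg_right hst (hstep n).le)
    simp only [γn]
    rw [zz n _ _ hle (hι1 n t ht)]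
    ring
  have m0 : (0 : ℝ) ∈ Icc 0 D := ⟨le_rfl, hD⟩
  have mD : D ∈ Icc 0 D := ⟨hD, le_rfl⟩
  refine ⟨γ, ?_, ?_, fun s hs t ht => ?_⟩
  · have h1 : ∀ n, x = γn n 0 := fun n => by simp [γn, ι, z0]
    exact tendsto_nhds_unique (hγ 0 m0) (tendsto_const_nhds.congr h1)
  · have h1 : Tendsto (fun n => M.dist (γn n D) y) (hyperfilter ℕ : Filter ℕ)
        (𝓝 (M.dist (γ D) y)) := M.tendsto_dist (hγ D mD) tendsto_const_nhds
    have h2 : M.dist (γ D) y = 0 := by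
      have h3 : Tendsto (fun n => D - ι n D * (D / (n + 1))) (hyperfilter ℕ : Filter ℕ)
        (𝓝 (D - D)) := tendsto_const_nhds.sub (hιt D mD)
      rw [sub_self] at h3
      exact tendsto_nhds_unique h1
        (h3.congr fun n => by simp only [γn]; rw [zy n _ (hι1 n D mD)])
    have := M.norm_sub_le_dist (γ D) y
    rw [h2] at this
    have h3 : ‖γ D - y‖ = 0 := le_antisymm (by nlinarith [M.cm_pos]) (norm_nonneg _)
    exact sub_eq_zero.1 (norm_eq_zero.1 h3)
  · rcases le_total s t with h | h
    · rw [hmain s hs t ht h, abs_sub_comm, abs_of_nonneg (by linarith)]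
    · rw [M.dist_comm', hmain t ht s hs h, abs_of_nonneg (by linarith)]

/-! ### Infinitesimal behaviour of the distance -/

lemma nd_local (p : ℝ × ℝ) {ε : ℝ} (hε : 0 < ε) : ∃ δ > 0, ∀ x ∈ Metric.ball p δ, ∀ v,
    |M.nd x v - M.nd p v| ≤ ε * ‖v‖ := by
  have hK : IsCompact (Metric.sphere (0 : ℝ × ℝ) 1) := isCompact_sphere _ _
  have h : ∀ v ∈ Metric.sphere (0 : ℝ × ℝ) 1, ∀ᶠ q : (ℝ × ℝ) × (ℝ × ℝ) in 𝓝 (p, v),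
      |M.nd q.1 q.2 - M.nd p q.2| < ε := by
    intro v _
    have hc : Continuous fun q : (ℝ × ℝ) × (ℝ × ℝ) => |M.nd q.1 q.2 - M.nd p q.2| := by
      have h1 := M.continuous_nd
      have h2 := M.continuous_nd.comp (by fun_prop :
        Continuous fun q : (ℝ × ℝ) × (ℝ × ℝ) => (p, q.2))
      exact (h1.sub h2).abs
    exact hc.continuousAt.eventually_lt continuousAt_const (by simpa using hε)
  have h2 := hK.eventually_forall_of_forall_eventually
    (P := fun x v => |M.nd x v - M.nd p v| < ε) h
  obtain ⟨δ, hδ, hb⟩ := Metric.eventually_nhds_iff_ball.1 h2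
  refine ⟨δ, hδ, fun x hx v => ?_⟩
  rcases eq_or_ne v 0 with rfl | hv
  · simp [nd_zero]
  have hv' : 0 < ‖v‖ := norm_pos_iff.2 hv
  have := hb x hx (‖v‖⁻¹ • v) (by simp [norm_smul, hv'.ne'])
  simp only [nd_smul, abs_of_pos (inv_pos.2 hv')] at this
  rw [← mul_sub, abs_mul, abs_of_pos (inv_pos.2 hv'), inv_mul_lt_iff₀ hv'] at this
  linarith

lemma dist_local (p : ℝ × ℝ) {ε : ℝ} (hε : 0 < ε) : ∃ δ > 0, ∀ q ∈ Metric.ball p δ,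
    |M.dist p q - M.nd p (q - p)| ≤ ε * ‖q - p‖ := by
  have hm := M.cm_pos
  have hC := M.cC_pos
  set ε' := min ε (ε * M.cm / M.cC) with hε'
  have hε'0 : 0 < ε' := lt_min hε (by positivity)
  obtain ⟨r, hr, hb⟩ := M.nd_local p hε'0
  refine ⟨min r (r * M.cm / M.cC), lt_min hr (by positivity), fun q hq => ?_⟩
  have hq1 : ‖q - p‖ < r := (mem_ball_iff_norm.1 hq).trans_le (min_le_left _ _)
  have hq2 : ‖q - p‖ * M.cC < r * M.cm := by
    rw [← lt_div_iff₀ hC]; exact (mem_ball_iff_norm.1 hq).trans_le (min_le_right _ _)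
  have hn := norm_nonneg (q - p)
  rw [abs_le]
  constructor
  · suffices M.nd p (q - p) - ε * ‖q - p‖ ≤ M.dist p q by linarith
    refine le_of_forall_gt fun L hL => ?_
    have hdC : M.dist p q ≤ M.cC * ‖q - p‖ := by
      rw [norm_sub_rev]; exact M.dist_le_norm_sub p q
    have hgt : M.dist p q < min L (r * M.cm) := lt_min hL (by linarith)
    obtain ⟨c, hc, rfl, rfl, hl⟩ := M.exists_curve_lt hgt
    have hin : ∀ t ∈ Icc (0 : ℝ) 1, c t ∈ Metric.ball (c 0) r := fun t ht => by
      rw [mem_ball_iff_norm]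
      have h1 := M.norm_sub_le_length hc ht.1
      have h2 := M.length_nonneg c ht.2
      have h3 := M.length_add hc 0 t 1
      have h4 := hl.trans_le (min_le_right _ _)
      nlinarith
    have hlL := hl.trans_le (min_le_left _ _)
    set u := c 1 - c 0
    rcases (M.nd_nonneg (c 0) u).eq_or_lt with h0 | hpos
    · have : 0 ≤ ε * ‖u‖ := by positivity
      have := M.length_nonneg c zero_le_one
      rw [← h0]; linarith
    have hcd : Continuous (deriv c) := hc.continuous_deriv le_rfl
    have hlin : IsLinearMap ℝ fun v => M.g (c 0) v u := M.linear (c 0) u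
    let φ : (ℝ × ℝ) →L[ℝ] ℝ := LinearMap.toContinuousLinearMap hlin.mk'
    have hφ : ∀ v, φ v = M.g (c 0) v u := fun v => rfl
    have hint : ∫ t in (0 : ℝ)..1, φ (deriv c t) = M.nd (c 0) u ^ 2 := by
      rw [ContinuousLinearMap.intervalIntegral_comp_comm φ (hcd.intervalIntegrable _ _),
        intervalIntegral.integral_deriv_eq_sub (fun t _ => hc.differentiable one_ne_zero t)
          (hcd.intervalIntegrable _ _), hφ, nd_sq]
    have hpt : ∀ t ∈ Icc (0 : ℝ) 1, φ (deriv c t) ≤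
        (1 + ε' / M.cm) * M.nd (c t) (deriv c t) * M.nd (c 0) u := fun t ht => by
      rw [hφ]
      refine (M.g_le_nd _ _ _).trans (mul_le_mul_of_nonneg_right ?_ hpos.le)
      have h1 := (abs_le.1 (hb (c t) (hin t ht) (deriv c t))).1
      have h2 := M.cm_le (c t) (deriv c t)
      have h3 : ‖deriv c t‖ ≤ M.nd (c t) (deriv c t) / M.cm := by
        rw [le_div_iff₀ hm]; linarith
      have h4 : ε' * ‖deriv c t‖ ≤ ε' * (M.nd (c t) (deriv c t) / M.cm) :=
        mul_le_mul_of_nonneg_left h3 hε'0.le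
      have h5 : ε' * (M.nd (c t) (deriv c t) / M.cm) = ε' / M.cm * M.nd (c t) (deriv c t) := by
        ring
      linarith
    have hle : M.nd (c 0) u ^ 2 ≤ (1 + ε' / M.cm) * M.length c 0 1 * M.nd (c 0) u := by
      rw [← hint, length_eq, ← intervalIntegral.integral_const_mul,
        ← intervalIntegral.integral_mul_const]
      have hs := M.continuous_speed hc
      exact intervalIntegral.integral_mono_on zero_le_one
        ((φ.continuous.comp hcd).intervalIntegrable _ _)
        ((continuous_const.mul hs |>.mul continuous_const).intervalIntegrable _ _) hpt
    have hle2 : M.nd (c 0) u ≤ (1 + ε' / M.cm) * M.length c 0 1 := by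
      rw [sq] at hle; exact le_of_mul_le_mul_right hle hpos
    -- the error is controlled by the norm of the increment
    have h6 := M.le_cC (c 0) u
    have h7 : ε' ≤ ε * M.cm / M.cC := min_le_right _ _
    rw [le_div_iff₀ hC] at h7
    set Λ := M.length c 0 1
    have hL0 : 0 ≤ Λ := M.length_nonneg c zero_le_one
    have h8 : ε' / M.cm * M.nd (c 0) u ≤ ε * ‖u‖ := by
      rw [div_mul_eq_mul_div, div_le_iff₀ hm]
      nlinarith [mul_le_mul_of_nonneg_left h6 hε'0.le]
    have h9 : 0 ≤ ε' / M.cm := by positivity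
    rcases le_total Λ (M.nd (c 0) u) with h | h
    · have := mul_le_mul_of_nonneg_left h h9
      nlinarith
    · nlinarith [mul_nonneg hε.le hn]
  · suffices M.dist p q ≤ M.nd p (q - p) + ε * ‖q - p‖ by linarith
    refine (M.dist_le_integral_line p q).trans ?_
    have hcn : Continuous fun t : ℝ => M.nd (p + t • (q - p)) (q - p) :=
      M.continuous_nd.comp (by fun_prop :
        Continuous fun t : ℝ => (p + t • (q - p), q - p))
    calc _ ≤ ∫ t in (0 : ℝ)..1, (M.nd p (q - p) + ε * ‖q - p‖) :=
          intervalIntegral.integral_mono_on zero_le_one (hcn.intervalIntegrable _ _)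
            (continuous_const.intervalIntegrable _ _) fun t ht => by
              have hin : p + t • (q - p) ∈ Metric.ball p r := by
                rw [mem_ball_iff_norm]
                simp only [add_sub_cancel_left, norm_smul, Real.norm_eq_abs, abs_of_nonneg ht.1]
                nlinarith [ht.2]
              have h1 := (abs_le.1 (hb _ hin (q - p))).2
              have h2 := mul_le_mul_of_nonneg_right (min_le_left ε (ε * M.cm / M.cC)) hn
              linarith
      _ = _ := by simp

/-- The metric derivative of a differentiable curve is its Riemannian speed. -/
lemma tendsto_dist_div {η : ℝ → ℝ × ℝ} {v : ℝ × ℝ} {t : ℝ} (h : HasDerivAt η v t) :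
    Tendsto (fun s => M.dist (η t) (η s) / |s - t|) (𝓝[≠] t) (𝓝 (M.nd (η t) v)) := by
  have hs : Tendsto (fun s => slope η t s) (𝓝[≠] t) (𝓝 v) := h.tendsto_slope
  have h1 : Tendsto (fun s => M.nd (η t) (slope η t s)) (𝓝[≠] t) (𝓝 (M.nd (η t) v)) :=
    (M.continuous_nd.tendsto (η t, v)).comp (tendsto_const_nhds.prodMk_nhds hs)
  have hbd : ∀ᶠ s in 𝓝[≠] t, ‖slope η t s‖ < ‖v‖ + 1 :=
    hs.norm.eventually_lt_const (lt_add_one _)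
  have h0 : Tendsto (fun s => M.dist (η t) (η s) / |s - t| - M.nd (η t) (slope η t s)) (𝓝[≠] t)
      (𝓝 0) := by
    rw [Metric.tendsto_nhds]
    intro ε hε
    have hv1 : 0 < ‖v‖ + 1 := by positivity
    obtain ⟨δ, hδ, hd⟩ := M.dist_local (η t) (div_pos hε hv1)
    have hc : ∀ᶠ s in 𝓝[≠] t, η s ∈ Metric.ball (η t) δ :=
      h.continuousAt.continuousWithinAt.eventually (Metric.ball_mem_nhds _ hδ)
    filter_upwards [hbd, hc, self_mem_nhdsWithin] with s h3 h4 h5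
    have h5' : s - t ≠ 0 := sub_ne_zero.2 h5
    have hst : 0 < |s - t| := abs_pos.2 h5'
    have e : η s - η t = (s - t) • slope η t s := by
      rw [slope_def_module, smul_smul, mul_inv_cancel₀ h5', one_smul]
    have := hd _ h4
    rw [e, nd_smul, norm_smul, Real.norm_eq_abs] at this
    rw [Real.dist_eq, sub_zero]
    have e2 : M.dist (η t) (η s) / |s - t| - M.nd (η t) (slope η t s) =
        (M.dist (η t) (η s) - |s - t| * M.nd (η t) (slope η t s)) / |s - t| := by
      field_simp
    rw [e2, abs_div, abs_abs, div_lt_iff₀ hst]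
    refine this.trans_lt ?_
    have : ε / (‖v‖ + 1) * ‖slope η t s‖ < ε := by
      rw [div_mul_eq_mul_div, div_lt_iff₀ hv1]
      exact mul_lt_mul_of_pos_left h3 hε
    nlinarith
  simpa using h0.add h1

end TorusMetric

/-! ### Tools from the one-dimensional calculus of variations -/

section Calculus

open MeasureTheory

lemma locallyIntegrable_of_bound {f : ℝ → ℝ} (hf : Measurable f) {C : ℝ} (hC : ∀ t, |f t| ≤ C) :
    LocallyIntegrable f volume := by
  refine (locallyIntegrable_const C).mono hf.aestronglyMeasurable
    (Eventually.of_forall fun t => ?_)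
  rw [Real.norm_eq_abs, Real.norm_eq_abs]
  exact (hC t).trans (le_abs_self C)

lemma intervalIntegrable_of_bound {f : ℝ → ℝ} (hf : Measurable f) {C : ℝ}
    (hC : ∀ t, |f t| ≤ C) (a b : ℝ) : IntervalIntegrable f volume a b :=
  intervalIntegrable_iff.mpr <| (LocallyIntegrable.integrableOn_isCompact
    (locallyIntegrable_of_bound hf hC) isCompact_uIcc).mono_set uIoc_subset_uIcc

lemma lipschitzWith_integral {f : ℝ → ℝ} (hf : Measurable f) {C : ℝ} (hC : ∀ t, |f t| ≤ C)
    (a : ℝ) : LipschitzWith C.toNNReal fun t => ∫ s in a..t, f s := by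
  have hC0 : 0 ≤ C := (abs_nonneg _).trans (hC 0)
  refine LipschitzWith.of_dist_le_mul fun x y => ?_
  rw [Real.coe_toNNReal _ hC0, Real.dist_eq, Real.dist_eq,
    intervalIntegral.integral_interval_sub_left (intervalIntegrable_of_bound hf hC _ _)
      (intervalIntegrable_of_bound hf hC _ _)]
  exact intervalIntegral.norm_integral_le_of_norm_le_const (f := f) fun t _ => hC t

lemma du_bois_reymond {A P : ℝ → ℝ} (hA : Measurable A) (hP : Measurable P) {C : ℝ}
    (hAC : ∀ t, |A t| ≤ C) (hPC : ∀ t, |P t| ≤ C) {a b : ℝ} (hab : a < b)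
    (h : ∀ (φ : ℝ → ℝ) (K : NNReal), LipschitzWith K φ → φ a = 0 → φ b = 0 →
      ∫ t in a..b, (A t * φ t + P t * deriv φ t) = 0) :
    ∃ c, ∀ᵐ t, t ∈ Ioo a b → P t = c + ∫ s in a..t, A s := by
  set B : ℝ → ℝ := fun t => ∫ s in a..t, A s with hB
  have hBl := lipschitzWith_integral hA hAC a
  have hBc : Continuous B := hBl.continuous
  have hBd : ∀ᵐ t, deriv B t = A t := by
    filter_upwards [LocallyIntegrable.ae_hasDerivAt_integral
      (locallyIntegrable_of_bound hA hAC)] with t ht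
    exact (ht a).deriv
  set μ : ℝ := (b - a)⁻¹ * ∫ t in a..b, (P t - B t) with hμ
  set u : ℝ → ℝ := indicator (Icc a b) fun t => P t - B t - μ with hu
  have hum : Measurable u := ((hP.sub hBc.measurable).sub_const μ).indicator measurableSet_Icc
  obtain ⟨CB, hCB⟩ := isCompact_Icc.exists_bound_of_continuousOn (s := Icc a b) hBc.continuousOn
  have huC : ∀ t, |u t| ≤ C + CB + |μ| := fun t => by
    simp only [hu, indicator]
    split_ifs with ht
    · have h1 := hPC t
      have h2 := hCB t ht
      rw [Real.norm_eq_abs] at h2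
      calc _ ≤ |P t - B t| + |μ| := abs_sub _ _
        _ ≤ _ := by linarith [abs_sub (P t) (B t)]
    · have h1 := (abs_nonneg _).trans (hPC a)
      have h2 := (norm_nonneg _).trans (hCB a ⟨le_rfl, hab.le⟩)
      rw [abs_zero]; positivity
  have hPi := intervalIntegrable_of_bound hP hPC a b
  have hBi : IntervalIntegrable B volume a b := hBc.intervalIntegrable _ _
  have huab : ∀ t ∈ Icc a b, u t = P t - B t - μ := fun t ht => by simp [hu, ht]
  have hu0 : ∫ t in a..b, u t = 0 := by
    rw [intervalIntegral.integral_congr (g := fun t => P t - B t - μ)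
      (fun t ht => huab t (by rwa [uIcc_of_le hab.le] at ht)),
      intervalIntegral.integral_sub (hPi.sub hBi) (by simp), intervalIntegral.integral_const, hμ]
    have : b - a ≠ 0 := by linarith
    simp only [smul_eq_mul]
    field_simp
    ring
  set φ : ℝ → ℝ := fun t => ∫ s in a..t, u s with hφ
  have hφl := lipschitzWith_integral hum huC a
  have hφc : Continuous φ := hφl.continuous
  have hφd : ∀ᵐ t, deriv φ t = u t := by
    filter_upwards [LocallyIntegrable.ae_hasDerivAt_integral
      (locallyIntegrable_of_bound hum huC)] with t ht
    exact (ht a).deriv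
  have hφa : φ a = 0 := by simp [hφ]
  have hφb : φ b = 0 := hu0
  have h1 := h φ _ hφl hφa hφb
  have h2 := AbsolutelyContinuousOnInterval.integral_deriv_mul_eq_sub
    (hBl.lipschitzOnWith (s := uIcc a b)).absolutelyContinuousOnInterval
    (hφl.lipschitzOnWith (s := uIcc a b)).absolutelyContinuousOnInterval
  rw [show (∫ t in a..b, deriv B t * φ t + B t * deriv φ t) =
      ∫ t in a..b, (A t * φ t + B t * u t) from
    intervalIntegral.integral_congr_ae (by
      filter_upwards [hBd, hφd] with t e1 e2 _
      rw [← e1, ← e2])] at h2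
  rw [show (∫ t in a..b, (A t * φ t + P t * deriv φ t)) =
      ∫ t in a..b, (A t * φ t + P t * u t) from
    intervalIntegral.integral_congr_ae (by
      filter_upwards [hφd] with t e2 _
      rw [← e2])] at h1
  simp only [hu0, intervalIntegral.integral_same, mul_zero, sub_zero] at h2
  have hui := intervalIntegrable_of_bound hum huC a b
  have hPu : IntervalIntegrable (fun t => P t * u t) volume a b :=
    intervalIntegrable_of_bound (hP.mul hum) (C := C * (C + CB + |μ|)) (fun t =>
      (abs_mul (P t) (u t)).trans_le <|
        mul_le_mul (hPC t) (huC t) (abs_nonneg _) ((abs_nonneg _).trans (hPC t))) a b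
  have hAφ : IntervalIntegrable (fun t => A t * φ t) volume a b :=
    (intervalIntegrable_of_bound hA hAC a b).mul_continuousOn hφc.continuousOn
  have hBu : IntervalIntegrable (fun t => B t * u t) volume a b :=
    hui.continuousOn_mul hBc.continuousOn
  rw [intervalIntegral.integral_add hAφ hPu] at h1
  rw [intervalIntegral.integral_add hAφ hBu] at h2
  have h3 : ∫ t in a..b, u t * u t = 0 := by
    rw [intervalIntegral.integral_congr (g := fun t => P t * u t - B t * u t - μ * u t)
      (fun t ht => by
        have := huab t (by rwa [uIcc_of_le hab.le] at ht)
        show u t * u t = P t * u t - B t * u t - μ * u t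
        nth_rewrite 1 [this]; ring),
      intervalIntegral.integral_sub (hPu.sub hBu) (hui.const_mul μ),
      intervalIntegral.integral_sub hPu hBu, intervalIntegral.integral_const_mul, hu0]
    linarith
  have huu : IntervalIntegrable (fun t => u t * u t) volume a b :=
    intervalIntegrable_of_bound (hum.mul hum) (C := (C + CB + |μ|) * (C + CB + |μ|)) (fun t =>
      (abs_mul (u t) (u t)).trans_le <|
        mul_le_mul (huC t) (huC t) (abs_nonneg _) ((abs_nonneg _).trans (huC t))) a b
  have h4 := (intervalIntegral.integral_eq_zero_iff_of_nonneg_ae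
    (Eventually.of_forall fun t => mul_self_nonneg (u t)) huu).1 h3
  refine ⟨μ, ?_⟩
  have h5 : ∀ᵐ t, t ∈ Ioc a b ∪ Ioc b a → u t * u t = 0 :=
    (ae_restrict_iff' (measurableSet_Ioc.union measurableSet_Ioc)).1 h4
  filter_upwards [h5] with t ht htI
  have := ht (Or.inl ⟨htI.1, htI.2.le⟩)
  have h6 := huab t ⟨htI.1.le, htI.2.le⟩
  rw [mul_self_eq_zero.1 this] at h6
  linarith

end Calculus

section Variation

open MeasureTheory

lemma first_variation {L : (ℝ × ℝ) × (ℝ × ℝ) → ℝ} (hL : ContDiff ℝ 1 L) {γ : ℝ → ℝ × ℝ}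
    {K : NNReal} (hγ : LipschitzWith K γ) {φ : ℝ → ℝ} {K' : NNReal} (hφ : LipschitzWith K' φ)
    (w : ℝ × ℝ) {a b : ℝ}
    (hmin : ∀ ε : ℝ, ∫ t in a..b, L (γ t, deriv γ t) ≤
      ∫ t in a..b, L (γ t + (ε * φ t) • w, deriv γ t + (ε * deriv φ t) • w)) :
    ∫ t in a..b, (fderiv ℝ L (γ t, deriv γ t) (w, 0) * φ t +
      fderiv ℝ L (γ t, deriv γ t) (0, w) * deriv φ t) = 0 := by
  let q : ℝ → (ℝ × ℝ) × (ℝ × ℝ) := fun t => (γ t, deriv γ t)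
  let r : ℝ → (ℝ × ℝ) × (ℝ × ℝ) := fun t => (φ t • w, deriv φ t • w)
  have hqm : Measurable q := hγ.continuous.measurable.prodMk (measurable_deriv γ)
  have hrm : Measurable r :=
    (hφ.continuous.measurable.smul_const w).prodMk ((measurable_deriv φ).smul_const w)
  obtain ⟨C1, hC1⟩ := isCompact_uIcc.exists_bound_of_continuousOn (s := uIcc a b)
    hγ.continuous.continuousOn
  obtain ⟨C2, hC2⟩ := isCompact_uIcc.exists_bound_of_continuousOn (s := uIcc a b)
    hφ.continuous.continuousOn
  set R : ℝ := max C1 K + max C2 K' * ‖w‖ with hR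
  have hqb : ∀ t ∈ uIcc a b, ‖q t‖ ≤ max C1 K := fun t ht => by
    rw [Prod.norm_def]
    exact max_le_max (hC1 t ht) (norm_deriv_le_of_lipschitz hγ)
  have hrb : ∀ t ∈ uIcc a b, ‖r t‖ ≤ max C2 K' * ‖w‖ := fun t ht => by
    rw [Prod.norm_def, norm_smul, norm_smul]
    refine max_le (mul_le_mul_of_nonneg_right ((hC2 t ht).trans (le_max_left _ _))
      (norm_nonneg _)) (mul_le_mul_of_nonneg_right
      ((norm_deriv_le_of_lipschitz hφ).trans (le_max_right _ _)) (norm_nonneg _))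
  have hdL : Continuous (fderiv ℝ L) := hL.continuous_fderiv one_ne_zero
  obtain ⟨S, hS⟩ := (isCompact_closedBall (0 : (ℝ × ℝ) × (ℝ × ℝ)) R).exists_bound_of_continuousOn
    hdL.continuousOn
  obtain ⟨S', hS'⟩ := (isCompact_closedBall (0 : (ℝ × ℝ) × (ℝ × ℝ)) R).exists_bound_of_continuousOn
    hL.continuous.continuousOn
  have hball : ∀ t ∈ uIcc a b, ∀ ε ∈ Metric.ball (0 : ℝ) 1,
      q t + ε • r t ∈ Metric.closedBall (0 : (ℝ × ℝ) × (ℝ × ℝ)) R := fun t ht ε hε => by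
    rw [mem_closedBall_zero_iff]
    have h1 : ‖ε‖ ≤ 1 := (mem_ball_zero_iff.1 hε).le
    calc _ ≤ ‖q t‖ + ‖ε‖ * ‖r t‖ := (norm_add_le _ _).trans_eq (by rw [norm_smul])
      _ ≤ max C1 K + 1 * (max C2 K' * ‖w‖) := add_le_add (hqb t ht)
          (mul_le_mul h1 (hrb t ht) (norm_nonneg _) zero_le_one)
      _ = R := by rw [one_mul]
  have hFm : ∀ ε : ℝ, Measurable fun t => L (q t + ε • r t) := fun ε =>
    hL.continuous.measurable.comp (hqm.add (hrm.const_smul ε))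
  have hF'm : Measurable fun t => fderiv ℝ L (q t + (0 : ℝ) • r t) (r t) := by
    have : Continuous fun p : ((ℝ × ℝ) × (ℝ × ℝ)) × ((ℝ × ℝ) × (ℝ × ℝ)) => fderiv ℝ L p.1 p.2 := by
      fun_prop
    have h2 : Measurable fun t => (q t + (0 : ℝ) • r t, r t) :=
      (hqm.add (hrm.const_smul (0 : ℝ))).prodMk hrm
    exact this.measurable.comp h2
  have h0 : (0 : ℝ) ∈ Metric.ball (0 : ℝ) 1 := by simp
  have key := (intervalIntegral.hasDerivAt_integral_of_dominated_loc_of_deriv_le (μ := volume)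
    (a := a) (b := b) (F := fun ε t => L (q t + ε • r t))
    (F' := fun ε t => fderiv ℝ L (q t + ε • r t) (r t)) (x₀ := (0 : ℝ))
    (bound := fun _ => S * (max C2 K' * ‖w‖))
    (Metric.ball_mem_nhds (0 : ℝ) one_pos) (Eventually.of_forall fun ε =>
      (hFm ε).aestronglyMeasurable)
    ((intervalIntegrable_const (c := S')).mono_fun (hFm 0).aestronglyMeasurable (by
      refine (ae_restrict_iff' measurableSet_uIoc).2 (Eventually.of_forall fun t ht => ?_)
      exact (hS' _ (hball t (uIoc_subset_uIcc ht) 0 h0)).trans (le_abs_self S')))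
    hF'm.aestronglyMeasurable (Eventually.of_forall fun t ht ε hε => by
      have ht' := uIoc_subset_uIcc ht
      refine (ContinuousLinearMap.le_opNorm _ _).trans ?_
      exact mul_le_mul (hS _ (hball t ht' ε hε)) (hrb t ht') (norm_nonneg _)
        ((norm_nonneg _).trans (hS _ (hball t ht' ε hε))))
    intervalIntegrable_const (Eventually.of_forall fun t _ ε _ => by
      have h1 : HasDerivAt (fun ε : ℝ => q t + ε • r t) (r t) ε := by
        simpa using ((hasDerivAt_id ε).smul_const (r t)).const_add (q t)
      exact ((hL.differentiable one_ne_zero _).hasFDerivAt).comp_hasDerivAt ε h1)).2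
  have hmin' : IsLocalMin (fun ε : ℝ => ∫ t in a..b, L (q t + ε • r t)) 0 :=
    Eventually.of_forall fun ε => by
      have := hmin ε
      simp only [zero_smul, add_zero]
      simpa only [q, r, Prod.smul_mk, smul_smul, Prod.mk_add_mk] using this
  have hz := hmin'.hasDerivAt_eq_zero key
  rw [← hz]
  refine intervalIntegral.integral_congr fun t _ => ?_
  have e : r t = φ t • (w, (0 : ℝ × ℝ)) + deriv φ t • ((0 : ℝ × ℝ), w) := by
    simp [r]
  simp only [zero_smul, add_zero, e, map_add, map_smul, smul_eq_mul, q]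
  ring

end Variation

namespace TorusMetric

open MeasureTheory

variable (M : TorusMetric)

lemma intervalIntegrable_nd {η : ℝ → ℝ × ℝ} {K : NNReal} (hη : LipschitzWith K η) (a b : ℝ) :
    IntervalIntegrable (fun t => M.nd (η t) (deriv η t)) volume a b := by
  refine intervalIntegrable_of_bound (C := M.cC * K) ?_ (fun t => ?_) a b
  · have h2 : Measurable fun t => (η t, deriv η t) :=
      hη.continuous.measurable.prodMk (measurable_deriv η)
    exact M.continuous_nd.measurable.comp h2
  · rw [abs_of_nonneg (M.nd_nonneg _ _)]
    exact (M.le_cC _ _).trans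
      (mul_le_mul_of_nonneg_left (norm_deriv_le_of_lipschitz hη) M.cC_pos.le)

lemma dist_le_integral_nd {η : ℝ → ℝ × ℝ} {K : NNReal} (hη : LipschitzWith K η) {a b : ℝ}
    (hab : a ≤ b) : M.dist (η a) (η b) ≤ ∫ t in a..b, M.nd (η t) (deriv η t) := by
  have hsub : ∀ s t, |M.dist (η a) (η s) - M.dist (η a) (η t)| ≤ M.dist (η t) (η s) := fun s t => by
    have h1 := M.dist_triangle' (η a) (η t) (η s)
    have h2 := M.dist_triangle' (η a) (η s) (η t)
    rw [M.dist_comm' (η s)] at h2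
    exact abs_le.2 ⟨by linarith, by linarith⟩
  set f : ℝ → ℝ := fun t => M.dist (η a) (η t) with hf
  have hfl : LipschitzWith (M.cC.toNNReal * K) f := LipschitzWith.of_dist_le_mul fun s t => by
    rw [NNReal.coe_mul, Real.coe_toNNReal _ M.cC_pos.le, mul_assoc, Real.dist_eq]
    refine (hsub s t).trans ((M.dist_le_norm_sub _ _).trans
      (mul_le_mul_of_nonneg_left ?_ M.cC_pos.le))
    rw [← dist_eq_norm, _root_.dist_comm]
    exact hη.dist_le_mul s t
  have hac := (hfl.lipschitzOnWith (s := uIcc a b)).absolutelyContinuousOnInterval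
  have h0 : f a = 0 := M.dist_self' _
  have h1 : M.dist (η a) (η b) = ∫ t in a..b, deriv f t := by
    rw [hac.integral_deriv_eq_sub, h0, sub_zero]
  rw [h1]
  refine intervalIntegral.integral_mono_ae hab hac.intervalIntegrable_deriv
    (M.intervalIntegrable_nd hη a b) ?_
  filter_upwards [hfl.ae_differentiableAt_real, hη.ae_differentiableAt_real] with t ht1 ht2
  refine le_of_tendsto_of_tendsto (hasDerivAt_iff_tendsto_slope.1 ht1.hasDerivAt)
    (M.tendsto_dist_div ht2.hasDerivAt) (Eventually.of_forall fun s => ?_)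
  rw [slope_def_field]
  refine (le_abs_self _).trans ?_
  rw [abs_div]
  exact div_le_div_of_nonneg_right (hsub s t) (abs_nonneg _)

lemma nd_eq_one_of_isometry {γ : ℝ → ℝ × ℝ} {v : ℝ × ℝ} {t : ℝ} (h : HasDerivAt γ v t)
    (hiso : ∀ᶠ s in 𝓝[≠] t, M.dist (γ t) (γ s) = |s - t|) : M.nd (γ t) v = 1 := by
  refine tendsto_nhds_unique (M.tendsto_dist_div h) (Tendsto.congr' ?_ tendsto_const_nhds)
  filter_upwards [hiso, self_mem_nhdsWithin] with s hs hne
  rw [hs, div_self (abs_ne_zero.2 (sub_ne_zero.2 hne))]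

/-- The kinetic energy. -/
def lag (z : (ℝ × ℝ) × (ℝ × ℝ)) : ℝ := 1 / 2 * M.g z.1 z.2 z.2

lemma contDiff_lag : ContDiff ℝ (⊤ : ℕ∞) M.lag :=
  contDiff_const.mul (M.smooth.comp (contDiff_fst.prodMk (contDiff_snd.prodMk contDiff_snd)))

lemma fderiv_lag_snd (x v w : ℝ × ℝ) : fderiv ℝ M.lag (x, v) (0, w) = M.g x v w := by
  have h1 : HasDerivAt (fun ε : ℝ => (x, v) + ε • ((0 : ℝ × ℝ), w)) ((0 : ℝ × ℝ), w) 0 := by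
    simpa using ((hasDerivAt_id (0 : ℝ)).smul_const ((0 : ℝ × ℝ), w)).const_add (x, v)
  have h3 : HasFDerivAt M.lag (fderiv ℝ M.lag (x, v)) ((x, v) + (0 : ℝ) • ((0 : ℝ × ℝ), w)) := by
    rw [zero_smul, add_zero]
    exact ((M.contDiff_lag.differentiable (by simp)) _).hasFDerivAt
  have h2 := h3.comp_hasDerivAt (0 : ℝ) h1
  have h4 : (M.lag ∘ fun ε : ℝ => (x, v) + ε • ((0 : ℝ × ℝ), w)) =
      fun ε : ℝ => 1 / 2 * (M.g x v v + (2 * M.g x v w) * ε + M.g x w w * ε ^ 2) := by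
    funext ε
    simp only [lag, Function.comp_apply, Prod.smul_mk, smul_zero, Prod.mk_add_mk, add_zero,
      g_add_left, g_add_right, g_smul_left, g_smul_right, M.symm x w v]
    ring
  rw [h4] at h2
  have h5 : HasDerivAt (fun ε : ℝ => 1 / 2 * (M.g x v v + (2 * M.g x v w) * ε + M.g x w w * ε ^ 2))
      (1 / 2 * (0 + (2 * M.g x v w) * 1 + M.g x w w * (2 * 0 ^ 1 * 1))) 0 := by
    have h6 : HasDerivAt (fun ε : ℝ => M.g x w w * ε ^ 2) (M.g x w w * (2 * 0 ^ 1 * 1)) 0 := by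
      simpa using (hasDerivAt_pow 2 (0 : ℝ)).const_mul (M.g x w w)
    exact (((hasDerivAt_const (0 : ℝ) (M.g x v v)).add ((hasDerivAt_id (0 : ℝ)).const_mul
      (2 * M.g x v w))).add h6).const_mul (1 / 2)
  rw [h2.unique h5]
  ring

/-- The momentum of a tangent vector. -/
def flat (x v : ℝ × ℝ) : ℝ × ℝ := (M.g x v (1, 0), M.g x v (0, 1))

/-- The tangent vector with a given momentum. -/
def sharp (x p : ℝ × ℝ) : ℝ × ℝ :=
  (M.g x (1, 0) (1, 0) * M.g x (0, 1) (0, 1) - M.g x (1, 0) (0, 1) * M.g x (1, 0) (0, 1))⁻¹ •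
    (M.g x (0, 1) (0, 1) * p.1 - M.g x (1, 0) (0, 1) * p.2,
      M.g x (1, 0) (1, 0) * p.2 - M.g x (1, 0) (0, 1) * p.1)

lemma det_pos (x : ℝ × ℝ) : 0 < M.g x (1, 0) (1, 0) * M.g x (0, 1) (0, 1) -
    M.g x (1, 0) (0, 1) * M.g x (1, 0) (0, 1) := by
  have h1 : 0 < M.g x (1, 0) (1, 0) := M.posdef x _ (by simp)
  have h2 : 0 < M.g x (M.g x (1, 0) (1, 0) • (0, 1) + (-M.g x (1, 0) (0, 1)) • (1, 0))
      (M.g x (1, 0) (1, 0) • (0, 1) + (-M.g x (1, 0) (0, 1)) • (1, 0)) := by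
    refine M.posdef x _ fun h => ?_
    have := congrArg Prod.snd h
    simp [h1.ne'] at this
  simp only [g_add_left, g_add_right, g_smul_left, g_smul_right, M.symm x (0, 1) (1, 0)] at h2
  have h3 : 0 < M.g x (1, 0) (1, 0) * (M.g x (1, 0) (1, 0) * M.g x (0, 1) (0, 1) -
      M.g x (1, 0) (0, 1) * M.g x (1, 0) (0, 1)) := by linarith
  exact pos_of_mul_pos_right h3 h1.le

lemma flat_eq (x v : ℝ × ℝ) : M.flat x v =
    (M.g x (1, 0) (1, 0) * v.1 + M.g x (1, 0) (0, 1) * v.2,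
      M.g x (1, 0) (0, 1) * v.1 + M.g x (0, 1) (0, 1) * v.2) := by
  have e : v = v.1 • ((1 : ℝ), (0 : ℝ)) + v.2 • ((0 : ℝ), (1 : ℝ)) := by ext <;> simp
  have h : ∀ w, M.g x v w = v.1 * M.g x (1, 0) w + v.2 * M.g x (0, 1) w := fun w => by
    conv_lhs => rw [e]
    simp only [g_add_left, g_smul_left]
  rw [flat, h, h, M.symm x (0, 1) (1, 0)]
  ext <;> simp <;> ring

lemma sharp_flat (x v : ℝ × ℝ) : M.sharp x (M.flat x v) = v := by
  have h := (M.det_pos x).ne'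
  rw [flat_eq, sharp]
  ext
  · simp only [Prod.smul_fst, smul_eq_mul]
    rw [inv_mul_eq_div, div_eq_iff h]
    ring
  · simp only [Prod.smul_snd, smul_eq_mul]
    rw [inv_mul_eq_div, div_eq_iff h]
    ring

lemma contDiff_sharp : ContDiff ℝ (⊤ : ℕ∞) fun z : (ℝ × ℝ) × (ℝ × ℝ) => M.sharp z.1 z.2 := by
  have hg : ∀ u w : ℝ × ℝ, ContDiff ℝ (⊤ : ℕ∞) fun z : (ℝ × ℝ) × (ℝ × ℝ) => M.g z.1 u w :=
    fun u w => M.smooth.comp (f := fun z : (ℝ × ℝ) × (ℝ × ℝ) => (z.1, u, w)) (by fun_prop)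
  have h1 := hg (1, 0) (1, 0)
  have h2 := hg (1, 0) (0, 1)
  have h3 := hg (0, 1) (0, 1)
  have h4 : ContDiff ℝ (⊤ : ℕ∞) fun z : (ℝ × ℝ) × (ℝ × ℝ) => z.2.1 := by fun_prop
  have h5 : ContDiff ℝ (⊤ : ℕ∞) fun z : (ℝ × ℝ) × (ℝ × ℝ) => z.2.2 := by fun_prop
  exact (((h1.mul h3).sub (h2.mul h2)).inv fun z => (M.det_pos z.1).ne').smul
    (((h3.mul h4).sub (h2.mul h5)).prodMk ((h1.mul h5).sub (h2.mul h4)))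

/-- The force term of the geodesic equation in Hamiltonian form. -/
def force (z : (ℝ × ℝ) × (ℝ × ℝ)) : ℝ × ℝ :=
  (fderiv ℝ M.lag z ((1, 0), 0), fderiv ℝ M.lag z ((0, 1), 0))

/-- The geodesic vector field in Hamiltonian form. -/
def vf (z : (ℝ × ℝ) × (ℝ × ℝ)) : (ℝ × ℝ) × (ℝ × ℝ) :=
  (M.sharp z.1 z.2, M.force (z.1, M.sharp z.1 z.2))

lemma contDiff_force : ContDiff ℝ (⊤ : ℕ∞) M.force := by
  have h : ContDiff ℝ (⊤ : ℕ∞) (fderiv ℝ M.lag) :=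
    M.contDiff_lag.fderiv_right (by simp)
  exact (h.clm_apply contDiff_const).prodMk (h.clm_apply contDiff_const)

lemma contDiff_vf : ContDiff ℝ (⊤ : ℕ∞) M.vf :=
  M.contDiff_sharp.prodMk (M.contDiff_force.comp (contDiff_fst.prodMk M.contDiff_sharp))

end TorusMetric

namespace TorusMetric

open MeasureTheory

variable (M : TorusMetric)

lemma hasDerivAt_of_eq_integral {f A B : ℝ → ℝ} {c a b : ℝ}
    (hf : ∀ t ∈ Ioo a b, f t = c + ∫ s in a..t, A s) (hAB : ∀ᵐ t, t ∈ Ioo a b → A t = B t)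
    (hB : Continuous B) {t : ℝ} (ht : t ∈ Ioo a b) : HasDerivAt f (B t) t := by
  have h1 : HasDerivAt (fun t => c + ∫ s in a..t, B s) (B t) t :=
    (intervalIntegral.integral_hasDerivAt_right (hB.intervalIntegrable _ _)
      (hB.stronglyMeasurableAtFilter _ _) hB.continuousAt).const_add c
  refine h1.congr_of_eventuallyEq ?_
  filter_upwards [isOpen_Ioo.mem_nhds ht] with u hu
  rw [hf u hu]
  congr 1
  refine intervalIntegral.integral_congr_ae ?_
  filter_upwards [hAB] with s hs hs'
  rw [uIoc_of_le hu.1.le] at hs'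
  exact hs ⟨hs'.1, hs'.2.trans_lt hu.2⟩

lemma exists_momentum {η : ℝ → ℝ × ℝ} {K : NNReal} (hη : LipschitzWith K η) {a b : ℝ} (hab : a < b)
    (hd : M.dist (η a) (η b) = b - a)
    (h1 : ∀ᵐ t, t ∈ Ioo a b → M.nd (η t) (deriv η t) = 1) {C : ℝ} (w : ℝ × ℝ)
    (hA : ∀ t, |fderiv ℝ M.lag (η t, deriv η t) (w, 0)| ≤ C)
    (hP : ∀ t, |fderiv ℝ M.lag (η t, deriv η t) (0, w)| ≤ C) :
    ∃ c, ∀ᵐ t, t ∈ Ioo a b → fderiv ℝ M.lag (η t, deriv η t) (0, w) =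
      c + ∫ s in a..t, fderiv ℝ M.lag (η s, deriv η s) (w, 0) := by
  have hz : Measurable fun t => (η t, deriv η t) :=
    hη.continuous.measurable.prodMk (measurable_deriv η)
  have hL1 : ContDiff ℝ 1 M.lag := M.contDiff_lag.of_le (by exact_mod_cast le_top)
  have hcd : Continuous (fderiv ℝ M.lag) := hL1.continuous_fderiv one_ne_zero
  have hm : ∀ u : (ℝ × ℝ) × (ℝ × ℝ), Measurable fun t => fderiv ℝ M.lag (η t, deriv η t) u :=
    fun u =>
    Measurable.comp (g := fun z => fderiv ℝ M.lag z u) (hcd.clm_apply continuous_const).measurable hz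
  refine du_bois_reymond (hm _) (hm _) hA hP hab fun φ K' hφ ha hb => ?_
  refine first_variation hL1 hη hφ w fun ε => ?_
  have hlag : ∀ x v, M.lag (x, v) = 1 / 2 * M.nd x v ^ 2 := fun x v => by rw [nd_sq, lag]
  have e1 : ∫ t in a..b, M.lag (η t, deriv η t) = ∫ _ in a..b, (1 / 2 : ℝ) := by
    rw [intervalIntegral.integral_of_le hab.le, intervalIntegral.integral_of_le hab.le,
      integral_Ioc_eq_integral_Ioo, integral_Ioc_eq_integral_Ioo]
    refine integral_congr_ae ((ae_restrict_iff' measurableSet_Ioo).2 ?_)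
    filter_upwards [h1] with t ht hm
    rw [hlag, ht hm]
    norm_num
  obtain ⟨ξ, hξ⟩ : ∃ ξ : ℝ → ℝ × ℝ, ξ = fun t => η t + (ε * φ t) • w := ⟨_, rfl⟩
  have hξl : LipschitzWith (K + ‖ε‖₊ * K' * ‖w‖₊) ξ := by
    rw [hξ]
    refine hη.add (LipschitzWith.of_dist_le_mul fun s t => ?_)
    rw [dist_eq_norm, ← sub_smul, norm_smul, ← mul_sub, norm_mul, NNReal.coe_mul, NNReal.coe_mul]
    have := hφ.dist_le_mul s t
    rw [dist_eq_norm] at this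
    simp only [coe_nnnorm]
    nlinarith [mul_le_mul_of_nonneg_left this (mul_nonneg (norm_nonneg ε) (norm_nonneg w))]
  have hξd : ∀ᵐ t, deriv ξ t = deriv η t + (ε * deriv φ t) • w := by
    filter_upwards [hη.ae_differentiableAt_real, hφ.ae_differentiableAt_real] with t h2 h3
    rw [hξ]
    exact (h2.hasDerivAt.add ((h3.hasDerivAt.const_mul ε).smul_const w)).deriv
  have e2 : ∫ t in a..b, M.lag (η t + (ε * φ t) • w, deriv η t + (ε * deriv φ t) • w) =
      ∫ t in a..b, 1 / 2 * M.nd (ξ t) (deriv ξ t) ^ 2 := by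
    refine intervalIntegral.integral_congr_ae ?_
    filter_upwards [hξd] with t ht _
    rw [← ht, hlag, hξ]
  have e3 := M.dist_le_integral_nd hξl hab.le
  have e4 : ξ a = η a := by rw [hξ]; simp [ha]
  have e5 : ξ b = η b := by rw [hξ]; simp [hb]
  rw [e4, e5, hd] at e3
  have i1 := M.intervalIntegrable_nd hξl a b
  have i2 : IntervalIntegrable (fun t => 1 / 2 * M.nd (ξ t) (deriv ξ t) ^ 2) volume a b := by
    refine intervalIntegrable_of_bound
      (C := 1 / 2 * (M.cC * (K + ‖ε‖₊ * K' * ‖w‖₊ : NNReal)) ^ 2) ?_ (fun t => ?_) a b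
    · have h2 : Measurable fun t => (ξ t, deriv ξ t) :=
        hξl.continuous.measurable.prodMk (measurable_deriv ξ)
      exact ((Measurable.comp M.continuous_nd.measurable h2).pow_const 2).const_mul _
    · rw [abs_of_nonneg (by positivity)]
      exact mul_le_mul_of_nonneg_left (pow_le_pow_left₀ (M.nd_nonneg _ _) ((M.le_cC _ _).trans
        (mul_le_mul_of_nonneg_left (norm_deriv_le_of_lipschitz hξl) M.cC_pos.le)) 2) (by norm_num)
  have e6 : ∫ t in a..b, (M.nd (ξ t) (deriv ξ t) - 1 / 2) ≤
      ∫ t in a..b, 1 / 2 * M.nd (ξ t) (deriv ξ t) ^ 2 :=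
    intervalIntegral.integral_mono hab.le (i1.sub intervalIntegrable_const) i2 fun t => by
      change M.nd (ξ t) (deriv ξ t) - 1 / 2 ≤ 1 / 2 * M.nd (ξ t) (deriv ξ t) ^ 2
      nlinarith [sq_nonneg (M.nd (ξ t) (deriv ξ t) - 1)]
  rw [intervalIntegral.integral_sub i1 intervalIntegrable_const] at e6
  rw [e1, e2]
  simp only [intervalIntegral.integral_const, smul_eq_mul] at e6 ⊢
  linarith

/-- A distance realising curve solves the geodesic equation. -/
theorem exists_hamilton {γ : ℝ → ℝ × ℝ} {a b : ℝ} (hab : a < b)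
    (hγ : ∀ s ∈ Icc a b, ∀ t ∈ Icc a b, M.dist (γ s) (γ t) = |s - t|) :
    ∃ p : ℝ → ℝ × ℝ, ∀ t ∈ Ioo a b,
      HasDerivAt (fun t => (γ t, p t)) (M.vf (γ t, p t)) t := by
  obtain ⟨u, hu⟩ : ∃ u : ℝ → ℝ, u = fun t => max a (min b t) := ⟨_, rfl⟩
  have huI : ∀ t, u t ∈ Icc a b := fun t => by
    rw [hu]; exact ⟨le_max_left _ _, max_le hab.le (min_le_left _ _)⟩
  have hul : LipschitzWith 1 u := by
    rw [hu]; exact (LipschitzWith.id.const_min b).const_max a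
  have hue : ∀ t ∈ Icc a b, u t = t := fun t ht => by
    rw [hu]; simp [ht.1, ht.2]
  obtain ⟨η, hη⟩ : ∃ η : ℝ → ℝ × ℝ, η = fun t => γ (u t) := ⟨_, rfl⟩
  obtain ⟨K, hK⟩ : ∃ K : NNReal, (K : ℝ) = M.cm⁻¹ := ⟨⟨M.cm⁻¹, (inv_pos.2 M.cm_pos).le⟩, rfl⟩
  have hηl : LipschitzWith K η := LipschitzWith.of_dist_le_mul fun s t => by
    rw [hK, dist_eq_norm, hη, inv_mul_eq_div, le_div_iff₀' M.cm_pos]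
    refine (M.norm_sub_le_dist _ _).trans ?_
    rw [hγ _ (huI s) _ (huI t), ← Real.dist_eq]
    simpa using hul.dist_le_mul s t
  have hηe : ∀ t ∈ Icc a b, η t = γ t := fun t ht => by rw [hη]; simp only [hue t ht]
  have hηev : ∀ t ∈ Ioo a b, γ =ᶠ[𝓝 t] η := fun t ht => by
    filter_upwards [isOpen_Ioo.mem_nhds ht] with s hs
    rw [hηe s (Ioo_subset_Icc_self hs)]
  have hnd : ∀ᵐ t, t ∈ Ioo a b → M.nd (η t) (deriv η t) = 1 := by
    filter_upwards [hηl.ae_differentiableAt_real] with t h1 ht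
    refine M.nd_eq_one_of_isometry h1.hasDerivAt (nhdsWithin_le_nhds ?_)
    filter_upwards [isOpen_Ioo.mem_nhds ht] with s hs
    rw [hηe _ (Ioo_subset_Icc_self hs), hηe _ (Ioo_subset_Icc_self ht),
      hγ _ (Ioo_subset_Icc_self ht) _ (Ioo_subset_Icc_self hs), abs_sub_comm]
  have hd : M.dist (η a) (η b) = b - a := by
    rw [hηe a (left_mem_Icc.2 hab.le), hηe b (right_mem_Icc.2 hab.le),
      hγ _ (left_mem_Icc.2 hab.le) _ (right_mem_Icc.2 hab.le), abs_sub_comm,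
      abs_of_pos (sub_pos.2 hab)]
  have hbd : ∀ t, (η t, deriv η t) ∈
      Metric.closedBall (0 : (ℝ × ℝ) × (ℝ × ℝ)) (‖η a‖ + K * (b - a) + K) := fun t => by
    have hab' : 0 ≤ (K : ℝ) * (b - a) := mul_nonneg K.2 (sub_pos.2 hab).le
    rw [mem_closedBall_zero_iff, Prod.norm_def]
    refine max_le ?_ ?_
    · have h1 : η t = η (u t) := by rw [hη]; simp only [hue _ (huI t)]
      have h2 := hηl.dist_le_mul (u t) a
      rw [dist_eq_norm, Real.dist_eq, abs_of_nonneg (sub_nonneg.2 (huI t).1)] at h2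
      have h3 : (K : ℝ) * (u t - a) ≤ K * (b - a) :=
        mul_le_mul_of_nonneg_left (by linarith [(huI t).2]) K.2
      have h4 := norm_le_norm_add_norm_sub' (η (u t)) (η a)
      have h5 : (0 : ℝ) ≤ K := K.2
      rw [h1]
      change ‖η (u t)‖ ≤ _
      linarith
    · have h5 := norm_deriv_le_of_lipschitz (x₀ := t) hηl
      have h6 := norm_nonneg (η a)
      change ‖deriv η t‖ ≤ _
      linarith
  have hL1 : ContDiff ℝ 1 M.lag := M.contDiff_lag.of_le (by exact_mod_cast le_top)
  obtain ⟨S, hS⟩ := (isCompact_closedBall (0 : (ℝ × ℝ) × (ℝ × ℝ))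
    (‖η a‖ + K * (b - a) + K)).exists_bound_of_continuousOn
    (hL1.continuous_fderiv one_ne_zero).continuousOn
  have hb : ∀ v : (ℝ × ℝ) × (ℝ × ℝ), ‖v‖ ≤ 1 → ∀ t, |fderiv ℝ M.lag (η t, deriv η t) v| ≤ S :=
    fun v hv t => by
    refine ((fderiv ℝ M.lag (η t, deriv η t)).le_opNorm v).trans ?_
    have h1 := hS _ (hbd t)
    nlinarith [norm_nonneg (fderiv ℝ M.lag (η t, deriv η t)), norm_nonneg v]
  have hz : Measurable fun t => (η t, deriv η t) :=
    hηl.continuous.measurable.prodMk (measurable_deriv η)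
  have hm : ∀ v : (ℝ × ℝ) × (ℝ × ℝ), Measurable fun t => fderiv ℝ M.lag (η t, deriv η t) v :=
    fun v =>
    Measurable.comp (g := fun z => fderiv ℝ M.lag z v)
      ((hL1.continuous_fderiv one_ne_zero).clm_apply continuous_const).measurable hz
  have n1 : ‖(((1 : ℝ), (0 : ℝ)), (0 : ℝ × ℝ))‖ ≤ 1 := by simp [Prod.norm_def]
  have n2 : ‖(((0 : ℝ), (1 : ℝ)), (0 : ℝ × ℝ))‖ ≤ 1 := by simp [Prod.norm_def]
  have n3 : ‖((0 : ℝ × ℝ), ((1 : ℝ), (0 : ℝ)))‖ ≤ 1 := by simp [Prod.norm_def]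
  have n4 : ‖((0 : ℝ × ℝ), ((0 : ℝ), (1 : ℝ)))‖ ≤ 1 := by simp [Prod.norm_def]
  obtain ⟨c1, hc1⟩ := M.exists_momentum hηl hab hd hnd (1, 0) (hb _ n1) (hb _ n3)
  obtain ⟨c2, hc2⟩ := M.exists_momentum hηl hab hd hnd (0, 1) (hb _ n2) (hb _ n4)
  obtain ⟨p, hp⟩ : ∃ p : ℝ → ℝ × ℝ, p = fun t =>
    (c1 + ∫ s in a..t, fderiv ℝ M.lag (η s, deriv η s) ((1, 0), 0),
      c2 + ∫ s in a..t, fderiv ℝ M.lag (η s, deriv η s) ((0, 1), 0)) := ⟨_, rfl⟩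
  have hpc : Continuous p := by
    rw [hp]
    exact (continuous_const.add (lipschitzWith_integral (hm _) (hb _ n1) a).continuous).prodMk
      (continuous_const.add (lipschitzWith_integral (hm _) (hb _ n2) a).continuous)
  obtain ⟨V, hV⟩ : ∃ V : ℝ → ℝ × ℝ, V = fun t => M.sharp (η t) (p t) := ⟨_, rfl⟩
  have hVc : Continuous V := by
    rw [hV]
    exact M.contDiff_sharp.continuous.comp (hηl.continuous.prodMk hpc)
  have hVe : ∀ᵐ t, t ∈ Ioo a b → deriv η t = V t := by
    filter_upwards [hc1, hc2] with t h1 h2 ht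
    rw [hV, ← M.sharp_flat (η t) (deriv η t)]
    simp only
    rw [flat, ← M.fderiv_lag_snd, ← M.fderiv_lag_snd, h1 ht, h2 ht, hp]
  have hderiv : ∀ t ∈ Ioo a b, HasDerivAt η (V t) t := fun t ht => by
    have l1 : LipschitzWith K fun t => (η t).1 := by
      have := LipschitzWith.prod_fst.comp hηl
      rwa [one_mul] at this
    have l2 : LipschitzWith K fun t => (η t).2 := by
      have := LipschitzWith.prod_snd.comp hηl
      rwa [one_mul] at this
    have d1 : HasDerivAt (fun t => (η t).1) (V t).1 t := by
      refine hasDerivAt_of_eq_integral (a := a) (b := b) (c := (η a).1)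
        (A := fun s => deriv (fun t => (η t).1) s) (B := fun s => (V s).1) (fun s _ => ?_) ?_
        (continuous_fst.comp hVc) ht
      · have := (l1.lipschitzOnWith (s := uIcc a s)).absolutelyContinuousOnInterval
        rw [this.integral_deriv_eq_sub]
        ring
      · filter_upwards [hVe, hηl.ae_differentiableAt_real] with s h1 h2 hs
        rw [← h1 hs]
        exact (hasFDerivAt_fst.comp_hasDerivAt s h2.hasDerivAt).deriv
    have d2 : HasDerivAt (fun t => (η t).2) (V t).2 t := by
      refine hasDerivAt_of_eq_integral (a := a) (b := b) (c := (η a).2)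
        (A := fun s => deriv (fun t => (η t).2) s) (B := fun s => (V s).2) (fun s _ => ?_) ?_
        (continuous_snd.comp hVc) ht
      · have := (l2.lipschitzOnWith (s := uIcc a s)).absolutelyContinuousOnInterval
        rw [this.integral_deriv_eq_sub]
        ring
      · filter_upwards [hVe, hηl.ae_differentiableAt_real] with s h1 h2 hs
        rw [← h1 hs]
        exact (hasFDerivAt_snd.comp_hasDerivAt s h2.hasDerivAt).deriv
    exact d1.prodMk d2
  have hFc : Continuous fun t => M.force (η t, V t) :=
    M.contDiff_force.continuous.comp (hηl.continuous.prodMk hVc)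
  have hpd : ∀ t ∈ Ioo a b, HasDerivAt p (M.force (η t, V t)) t := fun t ht => by
    have d1 : HasDerivAt (fun t => (p t).1) (M.force (η t, V t)).1 t := by
      refine hasDerivAt_of_eq_integral (a := a) (b := b)
        (A := fun s => fderiv ℝ M.lag (η s, deriv η s) ((1, 0), 0))
        (B := fun s => (M.force (η s, V s)).1) (fun s _ => by rw [hp]) ?_
        (continuous_fst.comp hFc) ht
      filter_upwards [hVe] with s h1 hs
      rw [h1 hs, force]
    have d2 : HasDerivAt (fun t => (p t).2) (M.force (η t, V t)).2 t := by
      refine hasDerivAt_of_eq_integral (a := a) (b := b)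
        (A := fun s => fderiv ℝ M.lag (η s, deriv η s) ((0, 1), 0))
        (B := fun s => (M.force (η s, V s)).2) (fun s _ => by rw [hp]) ?_
        (continuous_snd.comp hFc) ht
      filter_upwards [hVe] with s h1 hs
      rw [h1 hs, force]
    exact d1.prodMk d2
  refine ⟨p, fun t ht => ?_⟩
  have h1 : M.vf (γ t, p t) = (V t, M.force (η t, V t)) := by
    rw [vf, hV, ← hηe t (Ioo_subset_Icc_self ht)]
  rw [h1]
  exact ((hderiv t ht).congr_of_eventuallyEq (hηev t ht)).prodMk (hpd t ht)

end TorusMetric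

/-- A curve is distance realising near the parameter `t`. -/
def LocIsoAt (d : ℝ × ℝ → ℝ × ℝ → ℝ) (c : ℝ → ℝ × ℝ) (t : ℝ) : Prop :=
  ∃ ε > 0, ∀ s ∈ Icc (t - ε) (t + ε), ∀ u ∈ Icc (t - ε) (t + ε), d (c s) (c u) = |s - u|

namespace TorusMetric

variable (M : TorusMetric)

lemma flat_sharp (x p : ℝ × ℝ) : M.flat x (M.sharp x p) = p := by
  have h := (M.det_pos x).ne'
  rw [flat_eq, sharp]
  ext
  · simp only [Prod.smul_mk, smul_eq_mul]
    rw [mul_left_comm, mul_left_comm (M.g x (1, 0) (0, 1)), ← mul_add, inv_mul_eq_div,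
      div_eq_iff h]
    ring
  · simp only [Prod.smul_mk, smul_eq_mul]
    rw [mul_left_comm, mul_left_comm (M.g x (0, 1) (0, 1)), ← mul_add, inv_mul_eq_div,
      div_eq_iff h]
    ring

lemma _root_.LocIsoAt.exists_hamilton {c : ℝ → ℝ × ℝ} {t : ℝ} (h : LocIsoAt M.dist c t) :
    ∃ (p : ℝ → ℝ × ℝ), ∃ ε > 0, ∀ s ∈ Ioo (t - ε) (t + ε),
      HasDerivAt (fun t => (c t, p t)) (M.vf (c s, p s)) s := by
  obtain ⟨ε, hε, h⟩ := h
  obtain ⟨p, hp⟩ := M.exists_hamilton (by linarith) h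
  exact ⟨p, ε, hε, hp⟩

lemma contDiffOn_of_hasDerivAt_vf {z : ℝ → (ℝ × ℝ) × (ℝ × ℝ)} {a b : ℝ}
    (h : ∀ s ∈ Ioo a b, HasDerivAt z (M.vf (z s)) s) : ContDiffOn ℝ (⊤ : ℕ∞) z (Ioo a b) := by
  refine contDiffOn_infty.2 fun n => ?_
  induction n with
  | zero => exact contDiffOn_zero.2 fun s hs => (h s hs).continuousAt.continuousWithinAt
  | succ n ih =>
    rw [Nat.cast_succ, contDiffOn_succ_iff_deriv_of_isOpen isOpen_Ioo]
    refine ⟨fun s hs => (h s hs).differentiableAt.differentiableWithinAt, by simp, ?_⟩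
    refine ContDiffOn.congr (f := fun s => M.vf (z s)) ?_ fun s hs => (h s hs).deriv
    exact (contDiff_infty.1 M.contDiff_vf n).comp_contDiffOn ih

lemma _root_.LocIsoAt.contDiffAt {c : ℝ → ℝ × ℝ} {t : ℝ} (h : LocIsoAt M.dist c t) :
    ContDiffAt ℝ (⊤ : ℕ∞) c t := by
  obtain ⟨p, ε, hε, hp⟩ := h.exists_hamilton
  have h1 := (M.contDiffOn_of_hasDerivAt_vf hp).contDiffAt
    (isOpen_Ioo.mem_nhds (show t ∈ Ioo (t - ε) (t + ε) from ⟨by linarith, by linarith⟩))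
  exact contDiff_fst.contDiffAt.comp t h1

lemma _root_.LocIsoAt.hasDerivAt {c : ℝ → ℝ × ℝ} {t : ℝ} (h : LocIsoAt M.dist c t) :
    HasDerivAt c (deriv c t) t :=
  (h.contDiffAt.differentiableAt (by simp)).hasDerivAt

lemma _root_.LocIsoAt.nd_deriv {c : ℝ → ℝ × ℝ} {t : ℝ} (h : LocIsoAt M.dist c t) :
    M.nd (c t) (deriv c t) = 1 := by
  refine M.nd_eq_one_of_isometry h.hasDerivAt (nhdsWithin_le_nhds ?_)
  obtain ⟨ε, hε, h⟩ := h
  filter_upwards [Icc_mem_nhds (show t - ε < t by linarith) (show t < t + ε by linarith)] with s hs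
  rw [h t ⟨by linarith, by linarith⟩ s hs, abs_sub_comm]

lemma hasDerivAt_fst_comp {z : ℝ → (ℝ × ℝ) × (ℝ × ℝ)} {v : (ℝ × ℝ) × (ℝ × ℝ)} {t : ℝ}
    (h : HasDerivAt z v t) : HasDerivAt (fun s => (z s).1) v.1 t :=
  (hasFDerivAt_fst (𝕜 := ℝ) (E := ℝ × ℝ) (F := ℝ × ℝ) (p := z t)).comp_hasDerivAt t h

lemma eventuallyEq_of_deriv_eq {c₁ c₂ : ℝ → ℝ × ℝ} {t : ℝ} (h1 : LocIsoAt M.dist c₁ t)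
    (h2 : LocIsoAt M.dist c₂ t) (h : c₁ t = c₂ t) (hd : deriv c₁ t = deriv c₂ t) :
    c₁ =ᶠ[𝓝 t] c₂ := by
  obtain ⟨p₁, ε₁, hε₁, hp₁⟩ := h1.exists_hamilton
  obtain ⟨p₂, ε₂, hε₂, hp₂⟩ := h2.exists_hamilton
  have m1 := isOpen_Ioo.mem_nhds (show t ∈ Ioo (t - ε₁) (t + ε₁) from ⟨by linarith, by linarith⟩)
  have m2 := isOpen_Ioo.mem_nhds (show t ∈ Ioo (t - ε₂) (t + ε₂) from ⟨by linarith, by linarith⟩)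
  have d1 := hp₁ t (mem_of_mem_nhds m1)
  have d2 := hp₂ t (mem_of_mem_nhds m2)
  have e1 : deriv c₁ t = M.sharp (c₁ t) (p₁ t) :=
    HasDerivAt.deriv (f := c₁) (hasDerivAt_fst_comp d1)
  have e2 : deriv c₂ t = M.sharp (c₂ t) (p₂ t) :=
    HasDerivAt.deriv (f := c₂) (hasDerivAt_fst_comp d2)
  have hp : p₁ t = p₂ t := by
    rw [← M.flat_sharp (c₁ t) (p₁ t), ← e1, hd, e2, h, M.flat_sharp]
  obtain ⟨K, s, hs, hK⟩ := (M.contDiff_vf.contDiffAt (x := (c₁ t, p₁ t))).of_le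
    (show (1 : WithTop ℕ∞) ≤ _ by exact_mod_cast le_top) |>.exists_lipschitzOnWith
  have key := ODE_solution_unique_of_eventually (v := fun _ => M.vf) (s := fun _ => s) (t₀ := t)
    (f := fun t => (c₁ t, p₁ t)) (g := fun t => (c₂ t, p₂ t)) (K := K)
    (Eventually.of_forall fun _ => hK) ?_ ?_ (by simp only [h, hp])
  · exact key.mono fun s hs => congrArg Prod.fst hs
  · filter_upwards [m1, d1.continuousAt.preimage_mem_nhds hs] with u hu hu' using ⟨hp₁ u hu, hu'⟩
  · rw [h, hp] at hs
    filter_upwards [m2, d2.continuousAt.preimage_mem_nhds hs] with u hu hu' using ⟨hp₂ u hu, hu'⟩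

lemma eqOn_of_eventuallyEq {c₁ c₂ : ℝ → ℝ × ℝ} {a b t : ℝ}
    (h1 : ∀ s ∈ Ioo a b, LocIsoAt M.dist c₁ s) (h2 : ∀ s ∈ Ioo a b, LocIsoAt M.dist c₂ s)
    (ht : t ∈ Ioo a b) (h : c₁ =ᶠ[𝓝 t] c₂) : EqOn c₁ c₂ (Ioo a b) := by
  have key : Ioo a b ⊆ {s | c₁ =ᶠ[𝓝 s] c₂} := by
    refine isPreconnected_Ioo.subset_of_closure_inter_subset isOpen_setOfPred_eventually_nhds
      ⟨t, ht, h⟩ ?_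
    rintro s ⟨hs, hsI⟩
    have hfr : ∃ᶠ u in 𝓝 s, c₁ =ᶠ[𝓝 u] c₂ := mem_closure_iff_frequently.1 hs
    have hcd : ∀ c : ℝ → ℝ × ℝ, LocIsoAt M.dist c s → ContinuousAt (deriv c) s := fun c hc => by
      have h3 : ContDiffAt ℝ 1 c s := hc.contDiffAt.of_le (by exact_mod_cast le_top)
      exact ((h3.fderiv_right (m := 0) (by simp)).continuousAt).clm_apply continuousAt_const
    have hfr' : ∃ᶠ u in 𝓝 s, (c₁ u, deriv c₁ u) = (c₂ u, deriv c₂ u) :=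
      hfr.mono fun u hu => by rw [hu.eq_of_nhds, hu.deriv_eq]
    have heq := tendsto_nhds_unique_of_frequently_eq
      ((h1 s hsI).contDiffAt.continuousAt.prodMk (hcd _ (h1 s hsI)))
      ((h2 s hsI).contDiffAt.continuousAt.prodMk (hcd _ (h2 s hsI))) hfr'
    rw [Prod.mk.injEq] at heq
    exact M.eventuallyEq_of_deriv_eq (h1 s hsI) (h2 s hsI) heq.1 heq.2
  exact fun s hs => (key hs).eq_of_nhds

lemma _root_.LocIsoAt.isGeodesic {c : ℝ → ℝ × ℝ} (h : ∀ t, LocIsoAt M.dist c t) :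
    M.IsGeodesic c := by
  refine ⟨contDiff_iff_contDiffAt.2 fun t => (h t).contDiffAt, fun t => ?_, fun t => ?_⟩
  · rw [← nd_sq, (h t).nd_deriv, one_pow]
  · obtain ⟨ε, hε, h1⟩ := h t
    refine ⟨ε, hε, fun s₁ s₂ h2 h3 h4 => ?_⟩
    rw [h1 s₁ ⟨h2, h3.trans h4⟩ s₂ ⟨h2.trans h3, h4⟩, length_eq]
    simp only [fun s => (h s).nd_deriv, intervalIntegral.integral_const, smul_eq_mul, mul_one]
    rw [abs_sub_comm, abs_of_nonneg (sub_nonneg.2 h3)]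

lemma IsGeodesic.locIsoAt {c : ℝ → ℝ × ℝ} (h : M.IsGeodesic c) (t : ℝ) : LocIsoAt M.dist c t := by
  obtain ⟨-, h1, h2⟩ := h
  obtain ⟨ε, hε, h3⟩ := h2 t
  have key : ∀ s₁ s₂, t - ε ≤ s₁ → s₁ ≤ s₂ → s₂ ≤ t + ε → M.dist (c s₁) (c s₂) = |s₁ - s₂| :=
    fun s₁ s₂ h4 h5 h6 => by
    rw [h3 s₁ s₂ h4 h5 h6, length]
    simp only [h1, Real.sqrt_one, intervalIntegral.integral_const, smul_eq_mul, mul_one]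
    rw [abs_sub_comm, abs_of_nonneg (sub_nonneg.2 h5)]
  refine ⟨ε, hε, fun s hs u hu => ?_⟩
  rcases le_total s u with hsu | hsu
  · exact key s u hs.1 hsu hu.2
  · rw [M.dist_comm', key u s hu.1 hsu hs.2, abs_sub_comm]

end TorusMetric

/-- Two curves crossing transversally keep meeting after a small perturbation of one of them. -/
lemma transversal_cross {c₁ c₂ : ℝ → ℝ × ℝ} {t r : ℝ} {v w : ℝ × ℝ} (hc₁ : Continuous c₁)
    (h : c₁ t = c₂ r) (h1 : HasDerivAt c₁ v t) (h2 : HasDerivAt c₂ w r)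
    (hD : v.1 * w.2 - v.2 * w.1 ≠ 0) : ∃ δ > 0, ∃ ρ > 0, ∀ η : ℝ → ℝ × ℝ,
      ContinuousOn η (Icc (r - ρ) (r + ρ)) → (∀ u ∈ Icc (r - ρ) (r + ρ), ‖η u - c₂ u‖ < δ) →
      ∃ u, ∃ s ∈ Icc (r - ρ) (r + ρ), c₁ u = η s := by
  obtain ⟨D, hDe⟩ : ∃ D, D = v.1 * w.2 - v.2 * w.1 := ⟨_, rfl⟩
  rw [← hDe] at hD
  obtain ⟨f, hf⟩ : ∃ f : (ℝ × ℝ) →L[ℝ] ℝ × ℝ, ∀ x, f x =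
      (D⁻¹ * (x.1 * w.2 - x.2 * w.1), D⁻¹ * (x.1 * v.2 - x.2 * v.1)) :=
    ⟨(D⁻¹ • (w.2 • ContinuousLinearMap.fst ℝ ℝ ℝ - w.1 • ContinuousLinearMap.snd ℝ ℝ ℝ)).prod
      (D⁻¹ • (v.2 • ContinuousLinearMap.fst ℝ ℝ ℝ - v.1 • ContinuousLinearMap.snd ℝ ℝ ℝ)),
      fun x => by simp [mul_comm]⟩
  have hfv : f v = (1, 0) := by
    rw [hf, ← hDe, inv_mul_cancel₀ hD, mul_comm v.1 v.2, sub_self, mul_zero]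
  have hfw : f w = (0, -1) := by
    rw [hf, mul_comm w.1 w.2, sub_self, mul_zero, show w.1 * v.2 - w.2 * v.1 = -D by rw [hDe]; ring,
      mul_neg, inv_mul_cancel₀ hD]
  have hf0 : ∀ x, f x = 0 → x = 0 := fun x hx => by
    rw [hf, Prod.mk_eq_zero] at hx
    have e1 := (mul_eq_zero.1 hx.1).resolve_left (inv_ne_zero hD)
    have e2 := (mul_eq_zero.1 hx.2).resolve_left (inv_ne_zero hD)
    have e3 : D * x.1 = 0 := by rw [hDe]; linear_combination v.1 * e1 - w.1 * e2
    have e4 : D * x.2 = 0 := by rw [hDe]; linear_combination v.2 * e1 - w.2 * e2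
    ext
    · exact (mul_eq_zero.1 e3).resolve_left hD
    · exact (mul_eq_zero.1 e4).resolve_left hD
  obtain ⟨κ, hκ, hfκ⟩ : ∃ κ > 0, ∀ x, ‖f x‖ ≤ κ * ‖x‖ :=
    ⟨‖f‖ + 1, by positivity, fun x => (f.le_opNorm x).trans
      (mul_le_mul_of_nonneg_right (by linarith) (norm_nonneg x))⟩
  have hκ4 : 0 < 1 / (4 * κ) := by positivity
  have o1 := (hasDerivAt_iff_isLittleO.1 h1).def hκ4
  have o2 := (hasDerivAt_iff_isLittleO.1 h2).def hκ4
  obtain ⟨ρ₁, hρ₁, o1⟩ := Metric.nhds_basis_closedBall.eventually_iff.1 o1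
  obtain ⟨ρ₂, hρ₂, o2⟩ := Metric.nhds_basis_closedBall.eventually_iff.1 o2
  obtain ⟨ρ, hρ, hρ1, hρ2⟩ : ∃ ρ > 0, ρ ≤ ρ₁ ∧ ρ ≤ ρ₂ :=
    ⟨min ρ₁ ρ₂, lt_min hρ₁ hρ₂, min_le_left _ _, min_le_right _ _⟩
  refine ⟨ρ / (4 * κ), by positivity, ρ, hρ, fun η hη hclose => ?_⟩
  have q1 : ∀ x : ℝ, |x| ≤ ρ → ‖f (c₁ (t + x)) - f (c₁ t) - (x, 0)‖ ≤ ρ / 4 := fun x hx => by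
    have h3 := @o1 (t + x) (by
      rw [Metric.mem_closedBall, Real.dist_eq, add_sub_cancel_left]; exact hx.trans hρ1)
    rw [add_sub_cancel_left, Real.norm_eq_abs] at h3
    have h4 : f (c₁ (t + x)) - f (c₁ t) - (x, 0) = f (c₁ (t + x) - c₁ t - x • v) := by
      rw [map_sub, map_sub, map_smul, hfv]; simp
    rw [h4]
    refine (hfκ _).trans ((mul_le_mul_of_nonneg_left (h3.trans (mul_le_mul_of_nonneg_left hx
      hκ4.le)) hκ.le).trans_eq ?_)
    field_simp
  have q2 : ∀ x : ℝ, |x| ≤ ρ → ‖f (η (r + x)) - f (c₂ r) - (0, -x)‖ ≤ ρ / 2 := fun x hx => by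
    have h3 := @o2 (r + x) (by
      rw [Metric.mem_closedBall, Real.dist_eq, add_sub_cancel_left]; exact hx.trans hρ2)
    rw [add_sub_cancel_left, Real.norm_eq_abs] at h3
    have h4 : f (η (r + x)) - f (c₂ r) - (0, -x) =
        f (η (r + x) - c₂ (r + x)) + f (c₂ (r + x) - c₂ r - x • w) := by
      rw [map_sub, map_sub, map_sub, map_smul, hfw, Prod.smul_mk, smul_zero, smul_eq_mul,
        mul_neg, mul_one]
      abel
    have h5 := hclose (r + x) ⟨by linarith [(abs_le.1 hx).1], by linarith [(abs_le.1 hx).2]⟩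
    rw [h4]
    refine (norm_add_le _ _).trans ((add_le_add ((hfκ _).trans (mul_le_mul_of_nonneg_left h5.le
      hκ.le)) ((hfκ _).trans (mul_le_mul_of_nonneg_left (h3.trans (mul_le_mul_of_nonneg_left hx
      hκ4.le)) hκ.le))).trans_eq ?_)
    field_simp
    ring
  have est : ∀ (p q z : ℝ × ℝ) (e : ℝ), ‖p - q - z‖ ≤ e →
      (-e ≤ p.1 - q.1 - z.1 ∧ p.1 - q.1 - z.1 ≤ e) ∧ -e ≤ p.2 - q.2 - z.2 ∧ p.2 - q.2 - z.2 ≤ e :=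
    fun p q z e he => ⟨abs_le.1 ((norm_fst_le _).trans he), abs_le.1 ((norm_snd_le _).trans he)⟩
  have key : ∃ s ∈ Icc (0 : ℝ) 1, ∃ u ∈ Icc (0 : ℝ) 1,
      f (c₁ (t + ρ * (2 * s - 1))) - f (η (r + ρ * (2 * u - 1))) = 0 := by
    refine poincare_miranda
      (D := fun z => f (c₁ (t + ρ * (2 * z.1 - 1))) - f (η (r + ρ * (2 * z.2 - 1))))
      ?_ ?_ ?_ ?_ ?_
    · refine ContinuousOn.sub (Continuous.continuousOn (by fun_prop)) ?_
      refine f.continuous.comp_continuousOn (hη.comp (by fun_prop) fun z hz => ?_)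
      have := hz.2
      exact ⟨by nlinarith [this.1], by nlinarith [this.2]⟩
    all_goals
      intro u hu
      have hu' : |ρ * (2 * u - 1)| ≤ ρ := abs_le.2 ⟨by nlinarith [hu.1], by nlinarith [hu.2]⟩
      have a0 : |ρ * (2 * 0 - 1)| ≤ ρ := by rw [abs_mul, abs_of_pos hρ]; norm_num
      have a1 : |ρ * (2 * 1 - 1)| ≤ ρ := by rw [abs_mul, abs_of_pos hρ]; norm_num
    · have b := est _ _ _ _ (q1 _ a0)
      have e := est _ _ _ _ (q2 _ hu')
      rw [h] at b
      change (f (c₁ (t + ρ * (2 * 0 - 1)))).1 - (f (η (r + ρ * (2 * u - 1)))).1 < 0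
      generalize f (c₁ (t + ρ * (2 * 0 - 1))) = P at b ⊢
      generalize f (η (r + ρ * (2 * u - 1))) = Q at e ⊢
      obtain ⟨⟨b1, b2⟩, b3, b4⟩ := b
      obtain ⟨⟨e1, e2⟩, e3, e4⟩ := e
      dsimp only at b1 b2 b3 b4 e1 e2 e3 e4
      linarith
    · have b := est _ _ _ _ (q1 _ a1)
      have e := est _ _ _ _ (q2 _ hu')
      rw [h] at b
      change 0 < (f (c₁ (t + ρ * (2 * 1 - 1)))).1 - (f (η (r + ρ * (2 * u - 1)))).1
      generalize f (c₁ (t + ρ * (2 * 1 - 1))) = P at b ⊢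
      generalize f (η (r + ρ * (2 * u - 1))) = Q at e ⊢
      obtain ⟨⟨b1, b2⟩, b3, b4⟩ := b
      obtain ⟨⟨e1, e2⟩, e3, e4⟩ := e
      dsimp only at b1 b2 b3 b4 e1 e2 e3 e4
      linarith
    · have b := est _ _ _ _ (q1 _ hu')
      have e := est _ _ _ _ (q2 _ a0)
      rw [h] at b
      change (f (c₁ (t + ρ * (2 * u - 1)))).2 - (f (η (r + ρ * (2 * 0 - 1)))).2 < 0
      generalize f (c₁ (t + ρ * (2 * u - 1))) = P at b ⊢
      generalize f (η (r + ρ * (2 * 0 - 1))) = Q at e ⊢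
      obtain ⟨⟨b1, b2⟩, b3, b4⟩ := b
      obtain ⟨⟨e1, e2⟩, e3, e4⟩ := e
      dsimp only at b1 b2 b3 b4 e1 e2 e3 e4
      linarith
    · have b := est _ _ _ _ (q1 _ hu')
      have e := est _ _ _ _ (q2 _ a1)
      rw [h] at b
      change 0 < (f (c₁ (t + ρ * (2 * u - 1)))).2 - (f (η (r + ρ * (2 * 1 - 1)))).2
      generalize f (c₁ (t + ρ * (2 * u - 1))) = P at b ⊢
      generalize f (η (r + ρ * (2 * 1 - 1))) = Q at e ⊢
      obtain ⟨⟨b1, b2⟩, b3, b4⟩ := b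
      obtain ⟨⟨e1, e2⟩, e3, e4⟩ := e
      dsimp only at b1 b2 b3 b4 e1 e2 e3 e4
      linarith
  obtain ⟨s, hs, u, hu, hsu⟩ := key
  refine ⟨t + ρ * (2 * s - 1), r + ρ * (2 * u - 1), ⟨by nlinarith [hu.1], by nlinarith [hu.2]⟩, ?_⟩
  exact sub_eq_zero.1 (hf0 _ (by rw [map_sub]; exact hsu))

/-- The metric properties of the universal covering of a Riemannian torus used below. -/
structure GeoPlane where
  d : ℝ × ℝ → ℝ × ℝ → ℝ
  symm : ∀ x y, d x y = d y x
  tri : ∀ x y z, d x z ≤ d x y + d y z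
  m : ℝ
  C : ℝ
  m_pos : 0 < m
  C_pos : 0 < C
  low : ∀ x y, m * ‖x - y‖ ≤ d x y
  up : ∀ x y, d x y ≤ C * ‖x - y‖
  per : ∀ k x y, d (x + lat k) (y + lat k) = d x y
  seg : ∀ x y, ∃ γ : ℝ → ℝ × ℝ, γ 0 = x ∧ γ (d x y) = y ∧
    ∀ s ∈ Icc 0 (d x y), ∀ t ∈ Icc 0 (d x y), d (γ s) (γ t) = |s - t|
  uniq : ∀ (c₁ c₂ : ℝ → ℝ × ℝ) (a b t : ℝ), (∀ s ∈ Ioo a b, LocIsoAt d c₁ s) →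
    (∀ s ∈ Ioo a b, LocIsoAt d c₂ s) → t ∈ Ioo a b → c₁ =ᶠ[𝓝 t] c₂ → EqOn c₁ c₂ (Ioo a b)
  cross : ∀ (c₁ c₂ : ℝ → ℝ × ℝ) (t r : ℝ), (∀ s, LocIsoAt d c₁ s) → (∀ s, LocIsoAt d c₂ s) →
    c₁ t = c₂ r → (∃ σ : ℝ, (σ = 1 ∨ σ = -1) ∧ ∀ u, c₁ (t + u) = c₂ (r + σ * u)) ∨
    ∃ δ > 0, ∃ ρ > 0, ∀ η : ℝ → ℝ × ℝ, ContinuousOn η (Icc (r - ρ) (r + ρ)) →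
      (∀ u ∈ Icc (r - ρ) (r + ρ), ‖η u - c₂ u‖ < δ) → ∃ u, ∃ s ∈ Icc (r - ρ) (r + ρ), c₁ u = η s

lemma LocIsoAt.comp_affine {d : ℝ × ℝ → ℝ × ℝ → ℝ} {c : ℝ → ℝ × ℝ} {t σ r : ℝ} (hσ : |σ| = 1)
    (h : LocIsoAt d c (r + σ * t)) : LocIsoAt d (fun u => c (r + σ * u)) t := by
  obtain ⟨ε, hε, h⟩ := h
  have key : ∀ s ∈ Icc (t - ε) (t + ε),
      r + σ * s ∈ Icc (r + σ * t - ε) (r + σ * t + ε) := fun s hs => by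
    have : |σ * s - σ * t| ≤ ε := by
      rw [← mul_sub, abs_mul, hσ, one_mul]
      exact abs_le.2 ⟨by linarith [hs.1], by linarith [hs.2]⟩
    exact ⟨by linarith [(abs_le.1 this).1], by linarith [(abs_le.1 this).2]⟩
  refine ⟨ε, hε, fun s hs u hu => ?_⟩
  rw [h _ (key s hs) _ (key u hu), add_sub_add_left_eq_sub, ← mul_sub, abs_mul, hσ, one_mul]

namespace TorusMetric

variable (M : TorusMetric)

lemma dist_lat_eq (k : ℤ × ℤ) (x y : ℝ × ℝ) : M.dist (x + lat k) (y + lat k) = M.dist x y := by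
  refine le_antisymm (M.dist_lat k x y) ?_
  have h := M.dist_lat (-k) (x + lat k) (y + lat k)
  have e : ∀ z : ℝ × ℝ, z + lat k + lat (-k) = z := fun z => by
    rw [add_assoc, show lat k + lat (-k) = 0 by ext <;> simp [lat], add_zero]
  rwa [e, e] at h

lemma locIsoAt_cross (c₁ c₂ : ℝ → ℝ × ℝ) (t r : ℝ) (h1 : ∀ s, LocIsoAt M.dist c₁ s)
    (h2 : ∀ s, LocIsoAt M.dist c₂ s) (h : c₁ t = c₂ r) :
    (∃ σ : ℝ, (σ = 1 ∨ σ = -1) ∧ ∀ u, c₁ (t + u) = c₂ (r + σ * u)) ∨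
    ∃ δ > 0, ∃ ρ > 0, ∀ η : ℝ → ℝ × ℝ, ContinuousOn η (Icc (r - ρ) (r + ρ)) →
      (∀ u ∈ Icc (r - ρ) (r + ρ), ‖η u - c₂ u‖ < δ) →
      ∃ u, ∃ s ∈ Icc (r - ρ) (r + ρ), c₁ u = η s := by
  have hd1 := (h1 t).hasDerivAt
  have hd2 := (h2 r).hasDerivAt
  by_cases hD : (deriv c₁ t).1 * (deriv c₂ r).2 - (deriv c₁ t).2 * (deriv c₂ r).1 = 0
  · left
    have n1 := (h1 t).nd_deriv
    have n2 := (h2 r).nd_deriv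
    generalize deriv c₁ t = v at *
    generalize deriv c₂ r = w at *
    rw [h] at n1
    have hw : w ≠ 0 := fun hw => by rw [hw, nd_zero] at n2; exact zero_ne_one n2
    obtain ⟨σ, hσ⟩ : ∃ σ : ℝ, v = σ • w := by
      by_cases h0 : w.1 = 0
      · have h3 : w.2 ≠ 0 := fun h4 => hw (Prod.ext h0 h4)
        refine ⟨v.2 / w.2, Prod.ext ?_ ?_⟩
        · simp only [Prod.smul_fst, smul_eq_mul]
          rw [h0, mul_zero, sub_zero] at hD
          rw [h0, mul_zero]
          exact (mul_eq_zero.1 hD).resolve_right h3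
        · simp [h3]
      · refine ⟨v.1 / w.1, Prod.ext ?_ ?_⟩
        · simp [h0]
        · simp only [Prod.smul_snd, smul_eq_mul]
          field_simp
          linarith
    have hσ1 : |σ| = 1 := by rw [hσ, nd_smul, n2, mul_one] at n1; exact n1
    refine ⟨σ, eq_or_eq_neg_of_abs_eq hσ1, fun u => ?_⟩
    have k1 : ∀ s, LocIsoAt M.dist (fun u => c₁ (t + 1 * u)) s := fun s =>
      LocIsoAt.comp_affine abs_one (h1 _)
    have k2 : ∀ s, LocIsoAt M.dist (fun u => c₂ (r + σ * u)) s := fun s =>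
      LocIsoAt.comp_affine hσ1 (h2 _)
    have d1 : deriv (fun u => c₁ (t + 1 * u)) 0 = v := by
      have e : HasDerivAt (fun u : ℝ => t + 1 * u) 1 0 := by
        simpa using ((hasDerivAt_id (0 : ℝ)).const_mul 1).const_add t
      have := HasDerivAt.scomp_of_eq (h := fun u : ℝ => t + 1 * u) (0 : ℝ) hd1 e (by simp)
      rw [one_smul] at this
      exact this.deriv
    have d2 : deriv (fun u => c₂ (r + σ * u)) 0 = σ • w := by
      have e : HasDerivAt (fun u : ℝ => r + σ * u) σ 0 := by
        simpa using ((hasDerivAt_id (0 : ℝ)).const_mul σ).const_add r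
      exact (HasDerivAt.scomp_of_eq (h := fun u : ℝ => r + σ * u) (0 : ℝ) hd2 e (by simp)).deriv
    have key := M.eventuallyEq_of_deriv_eq (k1 0) (k2 0) (by simpa using h) (by rw [d1, d2, hσ])
    have := M.eqOn_of_eventuallyEq (a := -(|u| + 1)) (b := |u| + 1) (fun s _ => k1 s)
      (fun s _ => k2 s) (by constructor <;> linarith [abs_nonneg u]) key
      (x := u) ⟨by linarith [neg_abs_le u], by linarith [le_abs_self u]⟩
    simpa using this
  · right
    exact transversal_cross (continuous_iff_continuousAt.2 fun s => (h1 s).hasDerivAt.continuousAt)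
      h hd1 hd2 hD

/-- The universal covering of a Riemannian torus in linear coordinates respecting the lattice. -/
def geoPlane (A : (ℝ × ℝ) ≃L[ℝ] ℝ × ℝ) (hA : ∀ k, ∃ k', A (lat k) = lat k') : GeoPlane where
  d x y := M.dist (A x) (A y)
  symm x y := M.dist_comm' _ _
  tri x y z := M.dist_triangle' _ _ _
  m := M.cm / (‖(A.symm : (ℝ × ℝ) →L[ℝ] ℝ × ℝ)‖ + 1)
  C := M.cC * (‖(A : (ℝ × ℝ) →L[ℝ] ℝ × ℝ)‖ + 1)
  m_pos := div_pos M.cm_pos (by positivity)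
  C_pos := mul_pos M.cC_pos (by positivity)
  low x y := by
    rw [div_mul_eq_mul_div, div_le_iff₀ (by positivity)]
    have h1 := M.norm_sub_le_dist (A x) (A y)
    have h2 := (A.symm : (ℝ × ℝ) →L[ℝ] ℝ × ℝ).le_opNorm (A x - A y)
    rw [ContinuousLinearEquiv.coe_coe, map_sub, A.symm_apply_apply, A.symm_apply_apply] at h2
    have h3 := M.cm_pos
    calc M.cm * ‖x - y‖ ≤ M.cm * ((‖(A.symm : (ℝ × ℝ) →L[ℝ] ℝ × ℝ)‖ + 1) * ‖A x - A y‖) := by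
          refine mul_le_mul_of_nonneg_left (h2.trans ?_) h3.le
          exact mul_le_mul_of_nonneg_right (by linarith) (norm_nonneg _)
      _ = (M.cm * ‖A x - A y‖) * (‖(A.symm : (ℝ × ℝ) →L[ℝ] ℝ × ℝ)‖ + 1) := by ring
      _ ≤ _ := mul_le_mul_of_nonneg_right h1 (by positivity)
  up x y := by
    have h1 := M.dist_le_norm_sub (A x) (A y)
    have h2 := (A : (ℝ × ℝ) →L[ℝ] ℝ × ℝ).le_opNorm (x - y)
    rw [ContinuousLinearEquiv.coe_coe, map_sub] at h2
    rw [mul_assoc]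
    refine h1.trans (mul_le_mul_of_nonneg_left (h2.trans ?_) M.cC_pos.le)
    exact mul_le_mul_of_nonneg_right (by linarith) (norm_nonneg _)
  per k x y := by
    obtain ⟨k', hk⟩ := hA k
    rw [map_add, map_add, hk, dist_lat_eq]
  seg x y := by
    obtain ⟨γ, h1, h2, h3⟩ := M.exists_segment (A x) (A y)
    refine ⟨fun t => A.symm (γ t), by simp [h1], by simp [h2], fun s hs t ht => ?_⟩
    simp only [A.apply_symm_apply]
    exact h3 s hs t ht
  uniq c₁ c₂ a b t h1 h2 ht h := fun s hs => A.injective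
    (M.eqOn_of_eventuallyEq (c₁ := fun s => A (c₁ s)) (c₂ := fun s => A (c₂ s)) h1 h2 ht
      (h.mono fun u hu => congrArg A hu) hs)
  cross c₁ c₂ t r h1 h2 h := by
    rcases M.locIsoAt_cross (fun s => A (c₁ s)) (fun s => A (c₂ s)) t r h1 h2
      (congrArg A h) with ⟨σ, hσ, h3⟩ | ⟨δ, hδ, ρ, hρ, h3⟩
    · exact Or.inl ⟨σ, hσ, fun u => A.injective (h3 u)⟩
    · refine Or.inr ⟨δ / (‖(A : (ℝ × ℝ) →L[ℝ] ℝ × ℝ)‖ + 1), by positivity, ρ, hρ,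
        fun η hη hc => ?_⟩
      obtain ⟨u, s, hs, h4⟩ := h3 (fun s => A (η s)) (A.continuous.comp_continuousOn hη)
        fun u hu => by
          have h5 := hc u hu
          rw [lt_div_iff₀ (by positivity)] at h5
          have h6 := (A : (ℝ × ℝ) →L[ℝ] ℝ × ℝ).le_opNorm (η u - c₂ u)
          rw [ContinuousLinearEquiv.coe_coe, map_sub] at h6
          nlinarith [norm_nonneg (η u - c₂ u)]
      exact ⟨u, s, hs, A.injective h4⟩

end TorusMetric

lemma lat_add (k l : ℤ × ℤ) : lat (k + l) = lat k + lat l := by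
  ext <;> simp [lat]

lemma lat_zero : lat 0 = 0 := by
  ext <;> simp [lat]

lemma lat_neg (k : ℤ × ℤ) : lat (-k) = -lat k := by
  ext <;> simp [lat]

lemma add_lat_cancel {x y : ℝ × ℝ} {k : ℤ × ℤ} : x + lat k = y + lat k ↔ x = y :=
  add_left_inj _

/-- A strictly separated sequence of times cuts the line into cells. -/
lemma exists_cell {T : ℤ → ℝ} {δ : ℝ} (hδ : 0 < δ) (hT : ∀ n, δ ≤ T (n + 1) - T n) (t : ℝ) :
    ∃ n, T n ≤ t ∧ t < T (n + 1) := by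
  have grow : ∀ (k : ℕ) (n : ℤ), T n + k * δ ≤ T (n + k) := fun k => by
    induction k with
    | zero => intro n; simp
    | succ k ih =>
      intro n
      have h1 := ih n
      have h2 := hT (n + k)
      push_cast
      rw [← add_assoc]
      linarith
  obtain ⟨N, hN⟩ := exists_nat_gt (|t - T 0| / δ)
  rw [div_lt_iff₀ hδ, abs_lt] at hN
  obtain ⟨n, hn, hmax⟩ := Int.exists_greatest_of_bdd (P := fun n => T n ≤ t)
    ⟨N, fun z hz => by
      by_contra! hlt
      obtain ⟨k, hk⟩ := Int.eq_ofNat_of_zero_le (a := z - N) (by linarith)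
      have h1 := grow (N + k) 0
      rw [show (0 : ℤ) + ((N + k : ℕ) : ℤ) = z by push_cast; linarith] at h1
      push_cast at h1
      nlinarith [k.cast_nonneg (α := ℝ)]⟩
    ⟨-N, by
      have h1 := grow N (-N)
      rw [neg_add_cancel] at h1
      linarith⟩
  exact ⟨n, hn, by by_contra! h; linarith [hmax _ h]⟩

lemma strictMono_of_gaps {T : ℤ → ℝ} {δ : ℝ} (hδ : 0 < δ) (hT : ∀ n, δ ≤ T (n + 1) - T n) :
    StrictMono T := strictMono_int_of_lt_succ fun n => by linarith [hT n]

namespace GeoPlane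

variable (G : GeoPlane)

lemma self (x : ℝ × ℝ) : G.d x x = 0 := by
  have h1 := G.low x x
  have h2 := G.up x x
  rw [sub_self, norm_zero, mul_zero] at h1 h2
  exact le_antisymm h2 h1

lemma nonneg (x y : ℝ × ℝ) : 0 ≤ G.d x y :=
  (mul_nonneg G.m_pos.le (norm_nonneg _)).trans (G.low x y)

lemma eq_of_le_zero {x y : ℝ × ℝ} (h : G.d x y ≤ 0) : x = y := by
  have h1 := (G.low x y).trans h
  exact sub_eq_zero.1 (norm_le_zero_iff.1 (nonpos_of_mul_nonpos_right h1 G.m_pos))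

lemma norm_le (x y : ℝ × ℝ) : ‖x - y‖ ≤ G.d x y / G.m := by
  rw [le_div_iff₀ G.m_pos, mul_comm]
  exact G.low x y

lemma continuous_d : Continuous fun z : (ℝ × ℝ) × ℝ × ℝ => G.d z.1 z.2 := by
  have key : LipschitzWith (2 * ⟨G.C, G.C_pos.le⟩) fun z : (ℝ × ℝ) × ℝ × ℝ => G.d z.1 z.2 := by
    refine LipschitzWith.of_le_add_mul _ fun z w => ?_
    have h1 := G.tri z.1 w.1 z.2
    have h2 := G.tri w.1 w.2 z.2
    have h3 := (G.up z.1 w.1).trans (mul_le_mul_of_nonneg_left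
      (norm_fst_le (z - w)) G.C_pos.le)
    have h4 := (G.up w.2 z.2).trans (mul_le_mul_of_nonneg_left
      ((norm_sub_rev _ _).le.trans (norm_snd_le (z - w))) G.C_pos.le)
    rw [dist_eq_norm]
    change _ ≤ _ + 2 * G.C * _
    linarith
  exact key.continuous

lemma continuousOn_of_lip {c : ℝ → ℝ × ℝ} {S : Set ℝ}
    (h : ∀ s ∈ S, ∀ t ∈ S, G.d (c s) (c t) ≤ |s - t|) : ContinuousOn c S := by
  have key : LipschitzOnWith (Real.toNNReal G.m⁻¹) c S := by
    refine LipschitzOnWith.of_dist_le_mul fun s hs t ht => ?_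
    rw [Real.coe_toNNReal _ (inv_nonneg.2 G.m_pos.le), dist_eq_norm, Real.dist_eq,
      inv_mul_eq_div]
    exact (G.norm_le _ _).trans (div_le_div_of_nonneg_right (h s hs t ht) G.m_pos.le)
  exact key.continuousOn

lemma continuous_of_lip {c : ℝ → ℝ × ℝ} (h : ∀ s t, G.d (c s) (c t) ≤ |s - t|) :
    Continuous c :=
  continuousOn_univ.1 (G.continuousOn_of_lip fun s _ t _ => h s t)

lemma continuous_of_locIso {c : ℝ → ℝ × ℝ} (h : ∀ t, LocIsoAt G.d c t) : Continuous c := by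
  refine continuous_iff_continuousAt.2 fun t => ?_
  obtain ⟨ε, hε, h1⟩ := h t
  exact (G.continuousOn_of_lip fun s hs u hu => (h1 s hs u hu).le).continuousAt
    (Icc_mem_nhds (by linarith) (by linarith))

lemma per_sub (k : ℤ × ℤ) (x y : ℝ × ℝ) : G.d (x - lat k) (y - lat k) = G.d x y := by
  have h := G.per (-k) x y
  rwa [lat_neg, ← sub_eq_add_neg, ← sub_eq_add_neg] at h

/-- `γ` is a unit speed minimal segment on `[a, b]`. -/
def Iso (γ : ℝ → ℝ × ℝ) (a b : ℝ) : Prop :=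
  ∀ s ∈ Icc a b, ∀ t ∈ Icc a b, G.d (γ s) (γ t) = |s - t|

variable {G}

lemma Iso.continuousOn {γ : ℝ → ℝ × ℝ} {a b : ℝ} (h : G.Iso γ a b) : ContinuousOn γ (Icc a b) :=
  G.continuousOn_of_lip fun s hs t ht => (h s hs t ht).le

lemma Iso.locIsoAt {γ : ℝ → ℝ × ℝ} {a b t : ℝ} (h : G.Iso γ a b) (ht : t ∈ Ioo a b) :
    LocIsoAt G.d γ t := by
  have hs : Icc (t - min (t - a) (b - t)) (t + min (t - a) (b - t)) ⊆ Icc a b :=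
    Icc_subset_Icc (by linarith [min_le_left (t - a) (b - t)])
      (by linarith [min_le_right (t - a) (b - t)])
  exact ⟨_, lt_min (by linarith [ht.1]) (by linarith [ht.2]),
    fun s h1 u h2 => h s (hs h1) u (hs h2)⟩

/-- A curve that is 1-Lipschitz and whose ends are as far apart as possible is a segment. -/
lemma iso_of_lip {γ : ℝ → ℝ × ℝ} {a b : ℝ}
    (h : ∀ s ∈ Icc a b, ∀ t ∈ Icc a b, G.d (γ s) (γ t) ≤ |s - t|)
    (hab : b - a ≤ G.d (γ a) (γ b)) : G.Iso γ a b := by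
  have key : ∀ s ∈ Icc a b, ∀ t ∈ Icc a b, s ≤ t → G.d (γ s) (γ t) = |s - t| := by
    intro s hs t ht hst
    have hle : a ≤ b := hs.1.trans hs.2
    refine le_antisymm (h s hs t ht) ?_
    have h1 := G.tri (γ a) (γ s) (γ b)
    have h2 := G.tri (γ s) (γ t) (γ b)
    have h3 := h a (left_mem_Icc.2 hle) s hs
    have h4 := h t ht b (right_mem_Icc.2 hle)
    rw [abs_sub_comm, abs_of_nonneg (by linarith [hs.1])] at h3
    rw [abs_sub_comm, abs_of_nonneg (by linarith [ht.2])] at h4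
    rw [abs_sub_comm, abs_of_nonneg (by linarith)]
    linarith
  intro s hs t ht
  rcases le_total s t with hst | hst
  · exact key s hs t ht hst
  · rw [G.symm, abs_sub_comm]
    exact key t ht s hs hst

lemma Iso.mono {γ : ℝ → ℝ × ℝ} {a b a' b' : ℝ} (h : G.Iso γ a b) (ha : a ≤ a') (hb : b' ≤ b) :
    G.Iso γ a' b' := fun s hs t ht =>
  h s ⟨ha.trans hs.1, hs.2.trans hb⟩ t ⟨ha.trans ht.1, ht.2.trans hb⟩

variable (G)

lemma exists_equivariant_segments : ∃ sg : ℝ × ℝ → ℝ × ℝ → ℝ → ℝ × ℝ,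
    (∀ x y, sg x y 0 = x) ∧ (∀ x y, sg x y (G.d x y) = y) ∧ (∀ x y, G.Iso (sg x y) 0 (G.d x y)) ∧
    ∀ x y k t, sg (x + lat k) (y + lat k) t = sg x y t + lat k := by
  choose γ h0 h1 h2 using G.seg
  obtain ⟨f, hf⟩ : ∃ f : ℝ × ℝ → ℤ × ℤ, ∀ x k, f (x + lat k) = f x + k :=
    ⟨fun x => (⌊x.1⌋, ⌊x.2⌋), fun x k => by ext <;> simp [lat]⟩
  refine ⟨fun x y t => γ (x - lat (f x)) (y - lat (f x)) t + lat (f x),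
    fun x y => ?_, fun x y => ?_,
    fun x y s hs t ht => ?_, fun x y k t => ?_⟩
  · simp only [h0, sub_add_cancel]
  · have := h1 (x - lat (f x)) (y - lat (f x))
    rw [G.per_sub] at this
    simp only [this, sub_add_cancel]
  · rw [G.per]
    refine h2 _ _ s ?_ t ?_ <;> rwa [G.per_sub]
  · simp only [hf, lat_add]
    rw [add_sub_add_right_eq_sub, add_sub_add_right_eq_sub, add_assoc]

/-- Consecutive points are joined by minimal segments to a curve of speed at most one; the
construction commutes with lattice translations. -/
lemma glue {T : ℤ → ℝ} {P : ℤ → ℝ × ℝ} {δ : ℝ} (hδ : 0 < δ) (hT : ∀ n, δ ≤ T (n + 1) - T n)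
    (hP : ∀ n, G.d (P n) (P (n + 1)) = T (n + 1) - T n) :
    ∃ L : ℝ → ℝ × ℝ, (∀ n, L (T n) = P n) ∧ (∀ s t, G.d (L s) (L t) ≤ |s - t|) ∧
      ∀ (q : ℤ) (k : ℤ × ℤ) (p : ℝ), (∀ n, P (n + q) = P n + lat k) → (∀ n, T (n + q) = T n + p) →
        ∀ t, L (t + p) = L t + lat k := by
  obtain ⟨sg, s0, s1, s2, s3⟩ := G.exists_equivariant_segments
  choose N hN1 hN2 using exists_cell hδ hT
  have mono := strictMono_of_gaps hδ hT
  have hN : ∀ n t, T n ≤ t → t < T (n + 1) → N t = n := fun n t h1 h2 => by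
    have h3 := mono.lt_iff_lt.1 ((hN1 t).trans_lt h2)
    have h4 := mono.lt_iff_lt.1 (h1.trans_lt (hN2 t))
    omega
  obtain ⟨L, hL⟩ : ∃ L : ℝ → ℝ × ℝ, ∀ t, L t = sg (P (N t)) (P (N t + 1)) (t - T (N t)) :=
    ⟨_, fun _ => rfl⟩
  have hLT : ∀ n, L (T n) = P n := fun n => by
    rw [hL, hN n (T n) le_rfl (mono (by omega)), sub_self, s0]
  have hLc : ∀ n, ∀ t ∈ Icc (T n) (T (n + 1)), L t = sg (P n) (P (n + 1)) (t - T n) :=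
    fun n t ht => by
      rcases ht.2.eq_or_lt with rfl | h
      · rw [hLT, ← hP, s1]
      · rw [hL, hN n t ht.1 h]
  have hcell : ∀ n, G.Iso L (T n) (T (n + 1)) := fun n s hs t ht => by
    rw [hLc n s hs, hLc n t ht, s2 _ _ _ _ _ _, sub_sub_sub_cancel_right]
    · rw [hP]; exact ⟨by linarith [hs.1], by linarith [hs.2]⟩
    · rw [hP]; exact ⟨by linarith [ht.1], by linarith [ht.2]⟩
  have key : ∀ (j : ℕ) (i : ℤ) (s t : ℝ), s ∈ Icc (T i) (T (i + 1)) →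
      t ∈ Icc (T (i + j)) (T (i + j + 1)) → s ≤ t → G.d (L s) (L t) ≤ t - s := by
    intro j
    induction j with
    | zero =>
      intro i s t hs ht hst
      rw [Nat.cast_zero, add_zero] at ht
      rw [hcell i s hs t ht, abs_sub_comm, abs_of_nonneg (by linarith)]
    | succ j ih =>
      intro i s t hs ht hst
      rw [Nat.cast_succ, ← add_assoc] at ht
      have h1 := ih i s (T (i + j + 1)) hs ⟨(mono (by omega)).le, le_rfl⟩
        (hs.2.trans (mono.monotone (by omega)))
      have h2 := hcell (i + j + 1) _ ⟨le_rfl, (mono (by omega)).le⟩ t ht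
      rw [abs_sub_comm, abs_of_nonneg (by linarith [ht.1])] at h2
      linarith [G.tri (L s) (L (T (i + j + 1))) (L t)]
  have key' : ∀ s t, s ≤ t → G.d (L s) (L t) ≤ t - s := fun s t hst => by
    have h1 : N s ≤ N t := by
      have := mono.lt_iff_lt.1 (((hN1 s).trans hst).trans_lt (hN2 t))
      omega
    obtain ⟨j, hj⟩ := Int.eq_ofNat_of_zero_le (sub_nonneg.2 h1)
    have h2 : N s + (j : ℤ) = N t := by omega
    exact key j (N s) s t ⟨hN1 s, (hN2 s).le⟩ (by rw [h2]; exact ⟨hN1 t, (hN2 t).le⟩) hst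
  refine ⟨L, hLT, fun s t => ?_, fun q k p h1 h2 t => ?_⟩
  · rcases le_total s t with h | h
    · rw [abs_sub_comm, abs_of_nonneg (by linarith)]; exact key' s t h
    · rw [abs_of_nonneg (by linarith), G.symm]; exact key' t s h
  · have h3 : N (t + p) = N t + q := hN _ _ (by rw [h2]; linarith [hN1 t])
      (by rw [add_right_comm, h2]; linarith [hN2 t])
    rw [hL, hL, h3, h2, add_right_comm, h1, h1, s3, add_sub_add_right_eq_sub]

end GeoPlane

lemma joinedIn_image {γ : ℝ → ℝ × ℝ} {a b : ℝ} (h : ContinuousOn γ (uIcc a b)) :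
    JoinedIn (γ '' uIcc a b) (γ a) (γ b) := by
  have hp : IsPathConnected (uIcc a b) := (convex_uIcc a b).isPathConnected ⟨a, left_mem_uIcc⟩
  exact (hp.image' h).joinedIn _ (mem_image_of_mem _ left_mem_uIcc) _
    (mem_image_of_mem _ right_mem_uIcc)

lemma Convex.joinedIn {S : Set (ℝ × ℝ)} (h : Convex ℝ S) {x y : ℝ × ℝ} (hx : x ∈ S) (hy : y ∈ S) :
    JoinedIn S x y :=
  (h.isPathConnected ⟨x, hx⟩).joinedIn x hx y hy

lemma exists_lat_representative (x : ℝ × ℝ) :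
    ∃ y ∈ Icc (0 : ℝ × ℝ) 1, ∃ k, x = y + lat k := by
  refine ⟨(Int.fract x.1, Int.fract x.2), ⟨⟨Int.fract_nonneg _, Int.fract_nonneg _⟩,
    ⟨(Int.fract_lt_one _).le, (Int.fract_lt_one _).le⟩⟩, (⌊x.1⌋, ⌊x.2⌋), ?_⟩
  ext <;> simp [lat]

namespace GeoPlane

variable (G : GeoPlane)

lemma exists_min_displacement (k : ℤ × ℤ) : ∃ x, ∀ y, G.d x (x + lat k) ≤ G.d y (y + lat k) := by
  have hcont : Continuous fun x => G.d x (x + lat k) :=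
    G.continuous_d.comp (continuous_id.prodMk (continuous_id.add continuous_const))
  obtain ⟨x, -, hx⟩ := (isCompact_Icc (a := (0 : ℝ × ℝ)) (b := 1)).exists_isMinOn
    ⟨0, ⟨le_rfl, zero_le_one⟩⟩ hcont.continuousOn
  refine ⟨x, fun y => ?_⟩
  obtain ⟨z, hz, l, rfl⟩ := exists_lat_representative y
  have := isMinOn_iff.1 hx z hz
  rwa [add_right_comm, G.per]

lemma le_displacement {k : ℤ × ℤ} (x : ℝ × ℝ) : G.m * ‖lat k‖ ≤ G.d x (x + lat k) := by
  have := G.low x (x + lat k)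
  rwa [sub_add_cancel_left, norm_neg] at this

/-- A closed geodesic line translated by `(0, k)`, `k ≥ 2`, meets its translate by `(0, 1)`. -/
lemma exists_self_crossing {γ : ℝ → ℝ × ℝ} {D : ℝ} (hD : 0 < D) (hγ : Continuous γ) {k : ℤ}
    (hk : 2 ≤ k) (hper : ∀ t, γ (t + D) = γ t + lat (0, k)) :
    ∃ u v, u ≤ v ∧ v ≤ u + D ∧ γ u + lat (0, 1) = γ v := by
  have hX : Function.Periodic (fun t => (γ t).1) D := fun t => by simp [hper, lat]
  obtain ⟨t₁, -, ht₁⟩ := (isCompact_Icc (a := (0 : ℝ)) (b := D)).exists_isMinOn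
    ⟨0, ⟨le_rfl, hD.le⟩⟩ (continuous_fst.comp hγ).continuousOn
  have hmin : ∀ t, (γ t₁).1 ≤ (γ t).1 := fun t => by
    obtain ⟨s, hs, hs'⟩ := hX.exists_mem_Ico₀ hD t
    exact (isMinOn_iff.1 ht₁ s ⟨hs.1, hs.2.le⟩).trans_eq hs'.symm
  obtain ⟨t₀, ht₀, ht₀'⟩ := (isCompact_Icc (a := t₁) (b := t₁ + D)).exists_isMaxOn
    ⟨t₁, ⟨le_rfl, by linarith⟩⟩ (continuous_fst.comp hγ).continuousOn
  have hmax : ∀ t, (γ t).1 ≤ (γ t₀).1 := fun t => by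
    obtain ⟨s, hs, hs'⟩ := hX.exists_mem_Ico hD t t₁
    exact hs'.le.trans (isMaxOn_iff.1 ht₀' s ⟨hs.1, hs.2.le⟩)
  have hk2 : (2 : ℝ) ≤ k := by exact_mod_cast hk
  obtain ⟨R, hR⟩ : ∃ R, ∀ t ∈ Icc t₁ (t₁ + D), |(γ t).2| ≤ R := by
    obtain ⟨R, hR⟩ := (isCompact_Icc (a := t₁) (b := t₁ + D)).exists_bound_of_continuousOn
      (continuous_snd.comp hγ).continuousOn
    exact ⟨R, hR⟩
  have hq := hper t₁
  have mq1 : (γ (t₁ + D)).1 = (γ t₁).1 := hX t₁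
  have mq2 : (γ (t₁ + D)).2 = (γ t₁).2 + k := by rw [hq]; simp [lat]
  obtain ⟨e, he1, he2⟩ : ∃ e : ℝ × ℝ, e.1 = (γ t₀).1 + 1 ∧ e.2 = -(R + 2) := ⟨(_, _), rfl, rfl⟩
  obtain ⟨e', he1', he2'⟩ : ∃ e : ℝ × ℝ, e.1 = (γ t₁).1 - 1 ∧ e.2 = R + 3 + k :=
    ⟨(_, _), rfl, rfl⟩
  set A₁ := segment ℝ (γ t₀) e with hA₁
  set A₂ := γ '' uIcc t₀ (t₁ + D) with hA₂
  set A₃ := segment ℝ (γ (t₁ + D)) e' with hA₃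
  set B₁ : Set (ℝ × ℝ) := Iic (γ t₁).1 ×ˢ {(γ t₁).2 + 1} with hB₁
  set δ : ℝ → ℝ × ℝ := fun t => γ t + lat (0, 1) with hδ
  have hδ1 : ∀ t, (δ t).1 = (γ t).1 := fun t => by simp [hδ, lat]
  have hδ2 : ∀ t, (δ t).2 = (γ t).2 + 1 := fun t => by simp [hδ, lat]
  set B₂ := δ '' uIcc t₁ t₀ with hB₂
  set B₃ : Set (ℝ × ℝ) := Ici (γ t₀).1 ×ˢ {(γ t₀).2 + 1} with hB₃
  have hR0 := (abs_nonneg _).trans (hR t₁ ⟨le_rfl, by linarith⟩)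
  have b0 := abs_le.1 (hR t₀ ht₀)
  have b1 := abs_le.1 (hR t₁ ⟨le_rfl, by linarith⟩)
  have b2 := abs_le.1 (hR (t₁ + D) ⟨by linarith, le_rfl⟩)
  have u1 : uIcc t₀ (t₁ + D) = Icc t₀ (t₁ + D) := uIcc_of_le ht₀.2
  have u2 : uIcc t₁ t₀ = Icc t₁ t₀ := uIcc_of_le ht₀.1
  have jA : JoinedIn (A₁ ∪ A₂ ∪ A₃) e e' := by
    refine (JoinedIn.mono ?_ (subset_union_left.trans subset_union_left)).trans
      (y := γ t₀) ((JoinedIn.mono (joinedIn_image hγ.continuousOn)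
        (subset_union_right.trans subset_union_left)).trans (y := γ (t₁ + D))
          (JoinedIn.mono ?_ subset_union_right))
    · exact (convex_segment _ _).joinedIn (right_mem_segment _ _ _) (left_mem_segment _ _ _)
    · exact (convex_segment _ _).joinedIn (left_mem_segment _ _ _) (right_mem_segment _ _ _)
  have mA₁ : ∀ z ∈ A₁, ((γ t₀).1 ≤ z.1 ∧ z.1 ≤ (γ t₀).1 + 1 ∧ z.2 ≤ (γ t₀).2) ∧
      (z.1 ≤ (γ t₀).1 → z = γ t₀) := fun z hz => by
    rw [hA₁, segment_eq_image'] at hz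
    obtain ⟨θ, ⟨h0, h1⟩, rfl⟩ := hz
    simp only [Prod.fst_add, Prod.smul_fst, Prod.fst_sub, Prod.snd_add, Prod.smul_snd,
      Prod.snd_sub, he1, he2, smul_eq_mul]
    refine ⟨⟨by nlinarith, by nlinarith, by nlinarith⟩, fun h => ?_⟩
    rw [show θ = 0 by linarith, zero_smul, add_zero]
  have mA₃ : ∀ z ∈ A₃, ((γ t₁).1 - 1 ≤ z.1 ∧ z.1 ≤ (γ t₁).1 ∧ (γ t₁).2 + k ≤ z.2) ∧
      ((γ t₁).1 ≤ z.1 → z = γ (t₁ + D)) := fun z hz => by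
    rw [hA₃, segment_eq_image'] at hz
    obtain ⟨θ, ⟨h0, h1⟩, rfl⟩ := hz
    simp only [Prod.fst_add, Prod.smul_fst, Prod.fst_sub, Prod.snd_add, Prod.smul_snd,
      Prod.snd_sub, he1', he2', smul_eq_mul, mq1, mq2]
    refine ⟨⟨by nlinarith, by nlinarith, by nlinarith⟩, fun h => ?_⟩
    rw [show θ = 0 by linarith, zero_smul, add_zero]
  have jB : JoinedIn (B₁ ∪ B₂ ∪ B₃) ((γ t₁).1 - 2, (γ t₁).2 + 1) ((γ t₀).1 + 2, (γ t₀).2 + 1) := by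
    refine (JoinedIn.mono ?_ (subset_union_left.trans subset_union_left)).trans
      (y := δ t₁) ((JoinedIn.mono (joinedIn_image (hγ.add continuous_const).continuousOn)
        (subset_union_right.trans subset_union_left)).trans (y := δ t₀)
          (JoinedIn.mono ?_ subset_union_right))
    · refine ((convex_Iic _).prod (convex_singleton _)).joinedIn ?_ ?_
      · exact ⟨show (γ t₁).1 - 2 ≤ (γ t₁).1 by linarith, rfl⟩
      · exact ⟨(hδ1 _).le, hδ2 _⟩
    · refine ((convex_Ici _).prod (convex_singleton _)).joinedIn ?_ ?_
      · exact ⟨(hδ1 _).ge, hδ2 _⟩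
      · exact ⟨show (γ t₀).1 ≤ (γ t₀).1 + 2 by linarith, rfl⟩
  have h01 := hmax t₁
  have key : ((A₁ ∪ A₂ ∪ A₃) ∩ (B₁ ∪ B₂ ∪ B₃)).Nonempty := by
    refine joinedIn_cross jA jB ?_ ?_ ?_ ?_
    · rintro a ((h | ⟨s, -, rfl⟩) | h)
      · have := (mA₁ a h).1; linarith
      · have := hmin s; linarith
      · have := (mA₃ a h).1; linarith
    · rintro a ((h | ⟨s, -, rfl⟩) | h)
      · have := (mA₁ a h).1; linarith
      · have := hmax s; linarith
      · have := (mA₃ a h).1; linarith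
    · rintro b ((⟨-, h⟩ | ⟨s, hs, rfl⟩) | ⟨-, h⟩)
      · rw [mem_singleton_iff] at h; linarith
      · rw [u2] at hs
        have := abs_le.1 (hR s ⟨hs.1, hs.2.trans ht₀.2⟩)
        rw [hδ2]; linarith
      · rw [mem_singleton_iff] at h; linarith
    · rintro b ((⟨-, h⟩ | ⟨s, hs, rfl⟩) | ⟨-, h⟩)
      · rw [mem_singleton_iff] at h; linarith
      · rw [u2] at hs
        have := abs_le.1 (hR s ⟨hs.1, hs.2.trans ht₀.2⟩)
        rw [hδ2]; linarith
      · rw [mem_singleton_iff] at h; linarith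
  have fin : ∀ u ∈ Icc t₁ t₀, ∀ v ∈ Icc t₀ (t₁ + D), δ u = γ v →
      ∃ u v, u ≤ v ∧ v ≤ u + D ∧ γ u + lat (0, 1) = γ v := fun u hu v hv h =>
    ⟨u, v, hu.2.trans hv.1, by linarith [hu.1, hv.2], h⟩
  have m0 : t₀ ∈ Icc t₀ (t₁ + D) := ⟨le_rfl, ht₀.2⟩
  have m1 : t₁ + D ∈ Icc t₀ (t₁ + D) := ⟨ht₀.2, le_rfl⟩
  have m2 : t₀ ∈ Icc t₁ t₀ := ⟨ht₀.1, le_rfl⟩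
  have m3 : t₁ ∈ Icc t₁ t₀ := ⟨le_rfl, ht₀.1⟩
  obtain ⟨z, (hz | ⟨v, hv, rfl⟩) | hz, (⟨w1, w2⟩ | ⟨u, hu, hz'⟩) | ⟨w1, w2⟩⟩ := key
  all_goals try rw [u1] at hv
  all_goals try rw [u2] at hu
  all_goals try rw [mem_Iic] at w1
  all_goals try rw [mem_Ici] at w1
  all_goals try rw [mem_singleton_iff] at w2
  · have h := (mA₁ z hz).2 (by linarith)
    subst h
    exact fin _ m3 _ m0 (Prod.ext (by rw [hδ1]; linarith) (by rw [hδ2, w2]))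
  · have h := (mA₁ z hz).2 (by rw [← hz', hδ1]; exact hmax u)
    exact fin _ hu _ m0 (hz'.trans h)
  · linarith [(mA₁ z hz).1]
  · exact fin _ m3 _ hv (Prod.ext (by rw [hδ1]; linarith [hmin v]) (by rw [hδ2, w2]))
  · exact fin _ hu _ hv hz'
  · exact fin _ m2 _ hv (Prod.ext (by rw [hδ1]; linarith [hmax v]) (by rw [hδ2, w2]))
  · linarith [(mA₃ z hz).1]
  · have h := (mA₃ z hz).2 (by rw [← hz', hδ1]; exact hmin u)
    exact fin _ hu _ m1 (hz'.trans h)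
  · have h := (mA₃ z hz).2 (by linarith)
    subst h
    exact fin _ m2 _ m1 (Prod.ext (by rw [hδ1]; linarith) (by rw [hδ2, w2]))

lemma le_displacement_of_min {ℓ : ℝ} (hℓ : ∀ x, ℓ ≤ G.d x (x + lat (0, 1))) :
    ∀ (k : ℕ) x, k * ℓ ≤ G.d x (x + lat (0, k)) := by
  intro k
  induction k with
  | zero => intro x; simpa using G.nonneg _ _
  | succ k ih =>
    rcases Nat.eq_zero_or_pos k with rfl | hk
    · simpa using hℓ
    obtain ⟨x, hx⟩ := G.exists_min_displacement (0, ((k + 1 : ℕ) : ℤ))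
    intro y
    refine le_trans ?_ (hx y)
    obtain ⟨D, hD⟩ : ∃ D, D = G.d x (x + lat (0, ((k + 1 : ℕ) : ℤ))) := ⟨_, rfl⟩
    rw [← hD]
    have hD0 : 0 < D := by
      refine lt_of_lt_of_le (mul_pos G.m_pos (norm_pos_iff.2 fun h => ?_))
        ((G.le_displacement x).trans_eq hD.symm)
      have := congrArg Prod.snd h
      simp only [lat, Prod.snd_zero] at this
      norm_cast at this
    have hl : ∀ n : ℤ, lat (0, (n + 1) * ((k + 1 : ℕ) : ℤ)) =
        lat (0, n * ((k + 1 : ℕ) : ℤ)) + lat (0, ((k + 1 : ℕ) : ℤ)) := fun n => by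
      rw [← lat_add, Prod.mk_add_mk, add_zero, add_mul, one_mul]
    obtain ⟨γ, -, h2, h3⟩ := G.glue (T := fun n : ℤ => n * D)
      (P := fun n : ℤ => x + lat (0, n * ((k + 1 : ℕ) : ℤ))) hD0
      (fun n => by push_cast; linarith)
      (fun n => by
        rw [hl, add_comm (lat (0, n * _)), ← add_assoc, G.per, ← hD]
        push_cast; ring)
    have h4 := h3 1 (0, ((k + 1 : ℕ) : ℤ)) D (fun n => by rw [hl, add_assoc])
      (fun n => by push_cast; ring)
    obtain ⟨u, v, huv, hvu, h⟩ := exists_self_crossing hD0 (G.continuous_of_lip h2)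
      (by push_cast; omega) h4
    have h5 := hℓ (γ u)
    rw [h] at h5
    have h6 := h2 u v
    rw [abs_sub_comm, abs_of_nonneg (by linarith)] at h6
    have h7 := ih (γ v)
    have h9 : lat (0, 1) + lat (0, k) = lat (0, ((k + 1 : ℕ) : ℤ)) := by
      rw [← lat_add, Prod.mk_add_mk, add_zero]
      congr 2
      push_cast
      ring
    rw [← h, add_assoc, h9, ← h4, h] at h7
    have h8 := h2 v (u + D)
    rw [abs_sub_comm, abs_of_nonneg (by linarith)] at h8
    push_cast
    linarith

/-- A minimal line invariant under the translation by `(0, 1)`. -/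
structure Axis where
  S : ℝ → ℝ × ℝ
  ℓ : ℝ
  ℓ_pos : 0 < ℓ
  per : ∀ t, S (t + ℓ) = S t + lat (0, 1)
  iso : ∀ s t, G.d (S s) (S t) = |s - t|

lemma exists_axis : Nonempty G.Axis := by
  obtain ⟨x, hx⟩ := G.exists_min_displacement (0, 1)
  obtain ⟨ℓ, hℓ⟩ : ∃ ℓ, ℓ = G.d x (x + lat (0, 1)) := ⟨_, rfl⟩
  have hℓ0 : 0 < ℓ := by
    refine lt_of_lt_of_le (mul_pos G.m_pos (norm_pos_iff.2 fun h => ?_))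
      ((G.le_displacement x).trans_eq hℓ.symm)
    have := congrArg Prod.snd h
    simp [lat] at this
  have hl : ∀ n : ℤ, lat (0, n + 1) = lat (0, n) + lat (0, 1) := fun n => by
    rw [← lat_add, Prod.mk_add_mk, add_zero]
  obtain ⟨γ, -, h2, h3⟩ := G.glue (T := fun n : ℤ => n * ℓ)
    (P := fun n : ℤ => x + lat (0, n)) hℓ0 (fun n => by push_cast; linarith)
    (fun n => by
      rw [hl, add_comm (lat (0, n)), ← add_assoc, G.per, ← hℓ]
      push_cast; ring)
  have h4 := h3 1 (0, 1) ℓ (fun n => by rw [hl, add_assoc]) (fun n => by push_cast; ring)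
  have h5 : ∀ (k : ℕ) t, γ (t + k * ℓ) = γ t + lat (0, k) := fun k => by
    induction k with
    | zero => intro t; simp [← Prod.zero_eq_mk, lat_zero]
    | succ k ih =>
      intro t
      push_cast
      rw [add_mul, one_mul, ← add_assoc, h4, ih, hl, add_assoc]
  have h6 := G.le_displacement_of_min (ℓ := ℓ) fun y => hℓ.trans_le (hx y)
  have key : ∀ s t, s ≤ t → |s - t| ≤ G.d (γ s) (γ t) := fun s t hst => by
    obtain ⟨k, hk⟩ := exists_nat_gt ((t - s) / ℓ)
    rw [div_lt_iff₀ hℓ0] at hk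
    have e1 := h6 k (γ s)
    rw [← h5] at e1
    have e2 := h2 t (s + k * ℓ)
    rw [abs_sub_comm, abs_of_nonneg (by linarith)] at e2
    rw [abs_sub_comm, abs_of_nonneg (by linarith)]
    linarith [G.tri (γ s) (γ t) (γ (s + k * ℓ))]
  refine ⟨⟨γ, ℓ, hℓ0, h4, fun s t => le_antisymm (h2 s t) ?_⟩⟩
  rcases le_total s t with h | h
  · exact key s t h
  · rw [abs_sub_comm, G.symm]; exact key t s h

end GeoPlane

lemma lat_mk_add (a b c d : ℤ) : lat (a, b) + lat (c, d) = lat (a + c, b + d) := by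
  rw [← lat_add, Prod.mk_add_mk]

namespace GeoPlane

variable {G : GeoPlane}

/-- A minimal segment starting on a minimal line and meeting it again stays on it. -/
lemma iso_line_extend {S γ : ℝ → ℝ × ℝ} (hS : ∀ s t, G.d (S s) (S t) = |s - t|) {a b u w r : ℝ}
    (hγ : G.Iso γ a b) (hr : r ∈ Ioo a b) (h1 : γ a = S u) (h2 : γ r = S w) :
    ∃ e : ℝ, |e| = 1 ∧ w = u + e * (r - a) ∧ ∀ t ∈ Icc r b, γ t = S (u + e * (t - a)) := by
  have har : 0 < r - a := sub_pos.2 hr.1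
  have hab : a < b := hr.1.trans hr.2
  have hd := hγ a ⟨le_rfl, hab.le⟩ r ⟨hr.1.le, hr.2.le⟩
  rw [h1, h2, hS, abs_sub_comm, abs_sub_comm a, abs_of_pos har] at hd
  obtain ⟨e, he⟩ : ∃ e, e = (w - u) / (r - a) := ⟨_, rfl⟩
  have he1 : |e| = 1 := by rw [he, abs_div, hd, abs_of_pos har, div_self har.ne']
  have hw : w = u + e * (r - a) := by rw [he, div_mul_cancel₀ _ har.ne']; ring
  refine ⟨e, he1, hw, ?_⟩
  have hc1 : ∀ s t, G.d (S (u + e * (s - a))) (S (u + e * (t - a))) = |s - t| := fun s t => by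
    rw [hS, add_sub_add_left_eq_sub, ← mul_sub, sub_sub_sub_cancel_right, abs_mul, he1, one_mul]
  have hcr : S (u + e * (r - a)) = γ r := by rw [← hw, h2]
  obtain ⟨c, hc⟩ : ∃ c : ℝ → ℝ × ℝ, ∀ t, c t = if t ≤ r then S (u + e * (t - a)) else γ t :=
    ⟨_, fun _ => rfl⟩
  have hcl : ∀ t ≤ r, c t = S (u + e * (t - a)) := fun t ht => by rw [hc, if_pos ht]
  have hcg : ∀ t, r ≤ t → c t = γ t := fun t ht => by
    rcases ht.eq_or_lt with rfl | h
    · rw [hcl _ le_rfl, hcr]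
    · rw [hc, if_neg h.not_ge]
  have lip : ∀ s ∈ Icc a b, ∀ t ∈ Icc a b, s ≤ t → G.d (c s) (c t) ≤ |s - t| := by
    intro s hs t ht hst
    rcases le_total t r with htr | htr
    · rw [hcl s (hst.trans htr), hcl t htr, hc1]
    rcases le_total r s with hsr | hsr
    · rw [hcg s hsr, hcg t htr, hγ s hs t ht]
    · have e1 := hc1 s r
      have e2 := hγ r ⟨hr.1.le, hr.2.le⟩ t ht
      rw [abs_sub_comm, abs_of_nonneg (by linarith)] at e1 e2
      rw [hcl s hsr, hcg t htr, abs_sub_comm, abs_of_nonneg (by linarith)]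
      have := G.tri (S (u + e * (s - a))) (γ r) (γ t)
      rw [← hcr] at this e2
      linarith
  have hiso : G.Iso c a b := by
    refine iso_of_lip (fun s hs t ht => ?_) ?_
    · rcases le_total s t with h | h
      · exact lip s hs t ht h
      · rw [G.symm, abs_sub_comm]; exact lip t ht s hs h
    · rw [hcl a hr.1.le, sub_self, mul_zero, add_zero, hcg b hr.2.le, ← h1,
        hγ a ⟨le_rfl, hab.le⟩ b ⟨hab.le, le_rfl⟩, abs_sub_comm]
      exact le_abs_self _
  have heq : EqOn c (fun t => S (u + e * (t - a))) (Ioo a b) := by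
    refine G.uniq _ _ a b ((a + r) / 2) (fun s hs => hiso.locIsoAt hs)
      (fun s _ => ⟨1, one_pos, fun x _ y _ => hc1 x y⟩) ⟨by linarith, by linarith [hr.2]⟩ ?_
    filter_upwards [eventually_lt_nhds (show (a + r) / 2 < r by linarith)] with t ht
    exact hcl t ht.le
  refine EqOn.of_subset_closure (s := Ioo r b) (fun t ht => ?_)
    (hγ.mono hr.1.le le_rfl).continuousOn
    (G.continuousOn_of_lip fun s _ t _ => (hc1 s t).le) Ioo_subset_Icc_self
    (closure_Ioo hr.2.ne).ge
  rw [← hcg t ht.1.le]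
  exact heq ⟨hr.1.trans ht.1, ht.2⟩

lemma Iso.reverse {γ : ℝ → ℝ × ℝ} {a b : ℝ} (h : G.Iso γ a b) :
    G.Iso (fun t => γ (-t)) (-b) (-a) := fun s hs t ht => by
  rw [h _ ⟨by linarith [hs.2], by linarith [hs.1]⟩ _ ⟨by linarith [ht.2], by linarith [ht.1]⟩,
    neg_sub_neg, abs_sub_comm]

namespace Axis

variable (A : G.Axis)

/-- The translates of an axis. -/
def line (n : ℤ) : Set (ℝ × ℝ) := range fun t => A.S t + lat (n, 0)

lemma mem_line (t : ℝ) (n : ℤ) : A.S t + lat (n, 0) ∈ A.line n := mem_range_self t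

lemma mem_line_zero (t : ℝ) : A.S t ∈ A.line 0 := by
  have := A.mem_line t 0
  rwa [← Prod.zero_eq_mk, lat_zero, add_zero] at this

lemma continuous : Continuous A.S := G.continuous_of_lip fun s t => (A.iso s t).le

lemma per_nat (k : ℕ) (t : ℝ) : A.S (t + k * A.ℓ) = A.S t + lat (0, k) := by
  induction k generalizing t with
  | zero => simp [← Prod.zero_eq_mk, lat_zero]
  | succ k ih =>
    push_cast
    rw [add_mul, one_mul, ← add_assoc, A.per, ih, add_assoc, lat_mk_add, add_zero]

lemma per_int (k : ℤ) (t : ℝ) : A.S (t + k * A.ℓ) = A.S t + lat (0, k) := by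
  obtain ⟨n, rfl | rfl⟩ := k.eq_nat_or_neg
  · exact_mod_cast A.per_nat n t
  · have h := A.per_nat n (t + ((-(n : ℤ) : ℤ) : ℝ) * A.ℓ)
    rw [show t + ((-(n : ℤ) : ℤ) : ℝ) * A.ℓ + n * A.ℓ = t by push_cast; ring] at h
    rw [h, add_assoc, lat_mk_add, add_neg_cancel, add_zero, ← Prod.zero_eq_mk,
      lat_zero, add_zero]

lemma exists_bound : ∃ K, ∀ t, |(A.S t).1| ≤ K ∧ |(A.S t).2 - t / A.ℓ| ≤ K := by
  have hc : Continuous fun t => A.S t - (0, t / A.ℓ) :=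
    A.continuous.sub (continuous_const.prodMk (continuous_id.div_const _))
  obtain ⟨K, hK⟩ := (isCompact_Icc (a := (0 : ℝ)) (b := A.ℓ)).exists_bound_of_continuousOn
    hc.continuousOn
  have hp : Function.Periodic (fun t => A.S t - (0, t / A.ℓ)) A.ℓ := fun t => by
    have := A.ℓ_pos.ne'
    simp only [A.per]
    ext <;> simp [lat, add_div, this]
  refine ⟨K, fun t => ?_⟩
  obtain ⟨s, hs, h⟩ := hp.exists_mem_Ico₀ A.ℓ_pos t
  have h1 := hK s ⟨hs.1, hs.2.le⟩
  rw [← h] at h1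
  have h2 := (norm_fst_le _).trans h1
  have h3 := (norm_snd_le _).trans h1
  simpa using And.intro h2 h3

lemma exists_extrema : ∃ t₁ t₂, ∀ t, (A.S t₁).1 ≤ (A.S t).1 ∧ (A.S t).1 ≤ (A.S t₂).1 := by
  have hX : Function.Periodic (fun t => (A.S t).1) A.ℓ := fun t => by simp [A.per, lat]
  have ne : (Icc 0 A.ℓ).Nonempty := ⟨0, ⟨le_rfl, A.ℓ_pos.le⟩⟩
  have hc := (continuous_fst.comp A.continuous).continuousOn (s := Icc 0 A.ℓ)
  obtain ⟨t₁, -, h1⟩ := isCompact_Icc.exists_isMinOn ne hc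
  obtain ⟨t₂, -, h2⟩ := isCompact_Icc.exists_isMaxOn ne hc
  refine ⟨t₁, t₂, fun t => ?_⟩
  obtain ⟨s, hs, h⟩ := hX.exists_mem_Ico₀ A.ℓ_pos t
  rw [h]
  exact ⟨isMinOn_iff.1 h1 s ⟨hs.1, hs.2.le⟩, isMaxOn_iff.1 h2 s ⟨hs.1, hs.2.le⟩⟩

lemma injective {s t : ℝ} (h : A.S s = A.S t) : s = t := by
  have := A.iso s t
  rw [h, G.self] at this
  exact sub_eq_zero.1 (abs_eq_zero.1 this.symm)

lemma ne_translate {n : ℤ} (hn : n ≠ 0) (u w : ℝ) : A.S u ≠ A.S w + lat (n, 0) := by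
  intro h
  have hℓ := A.ℓ_pos
  have shift : ∀ t, A.ℓ ≤ t → A.S (w + t) + lat (n, 0) = A.S (u + t) := fun t ht => by
    obtain ⟨e, -, h2, h3⟩ := iso_line_extend (G := G) (γ := fun t => A.S (w + t) + lat (n, 0))
      (a := 0) (b := t + 1) (u := u) (w := u + A.ℓ) (r := A.ℓ) A.iso
      (fun s _ t _ => by rw [G.per, A.iso, add_sub_add_left_eq_sub])
      ⟨hℓ, by linarith⟩ (by rw [add_zero, h]) (by rw [A.per, A.per, h, add_right_comm])
    rw [sub_zero] at h2
    have he : e = 1 := by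
      have : (e - 1) * A.ℓ = 0 := by linarith
      linarith [(mul_eq_zero.1 this).resolve_right hℓ.ne']
    have := h3 t ⟨ht, by linarith⟩
    rwa [he, one_mul, sub_zero] at this
  obtain ⟨s, hs⟩ : ∃ s, s = u - w := ⟨_, rfl⟩
  have shift' : ∀ t, A.S (t + s) = A.S t + lat (n, 0) := fun t => by
    obtain ⟨k, hk⟩ := exists_nat_gt ((w + A.ℓ - t) / A.ℓ)
    rw [div_lt_iff₀ hℓ] at hk
    have h1 := shift (t - w + k * A.ℓ) (by linarith)
    rw [show w + (t - w + k * A.ℓ) = t + k * A.ℓ by ring,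
      show u + (t - w + k * A.ℓ) = t + s + k * A.ℓ by rw [hs]; ring, A.per_nat, A.per_nat,
      add_right_comm] at h1
    exact (add_lat_cancel.1 h1).symm
  have iter : ∀ j : ℕ, A.S (j * s) = A.S 0 + lat (j * n, 0) := fun j => by
    induction j with
    | zero => simp [← Prod.zero_eq_mk, lat_zero]
    | succ j ih =>
      push_cast
      rw [add_mul, one_mul, shift', ih, add_assoc, lat_mk_add, add_zero, add_mul,
        one_mul]
  obtain ⟨j, hj⟩ := exists_nat_gt (A.ℓ / G.m)
  rw [div_lt_iff₀ G.m_pos] at hj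
  have h1 := A.iso (j * s + (-⌊j * s / A.ℓ⌋ : ℤ) * A.ℓ) 0
  rw [A.per_int, iter, add_assoc, ← lat_add, G.symm, sub_zero] at h1
  have h2 := G.le_displacement (k := (j * n, 0) + (0, -⌊j * s / A.ℓ⌋)) (A.S 0)
  have h3 : (j : ℝ) ≤ ‖lat (((j : ℤ) * n, 0) + (0, -⌊j * s / A.ℓ⌋))‖ := by
    refine le_trans ?_ (norm_fst_le _)
    simp only [lat, Prod.mk_add_mk, add_zero, Real.norm_eq_abs]
    push_cast
    rw [abs_mul, Nat.abs_cast]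
    have : (1 : ℝ) ≤ |(n : ℝ)| := by exact_mod_cast Int.one_le_abs hn
    nlinarith [j.cast_nonneg (α := ℝ)]
  have h4 : |j * s + (-⌊j * s / A.ℓ⌋ : ℤ) * A.ℓ| ≤ A.ℓ := by
    have e1 := Int.floor_le (j * s / A.ℓ)
    have e2 := Int.lt_floor_add_one (j * s / A.ℓ)
    rw [le_div_iff₀ hℓ] at e1
    rw [div_lt_iff₀ hℓ] at e2
    push_cast
    exact abs_le.2 ⟨by linarith, by linarith⟩
  nlinarith [G.m_pos]

lemma line_disjoint {n k : ℤ} (h : n ≠ k) {z : ℝ × ℝ} (hn : z ∈ A.line n) (hk : z ∈ A.line k) :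
    False := by
  obtain ⟨u, rfl⟩ := hn
  obtain ⟨w, hw⟩ := hk
  refine A.ne_translate (sub_ne_zero.2 h) w u ?_
  have : lat (k, 0) + lat (n - k, 0) = lat (n, 0) := by
    rw [lat_mk_add, add_zero, add_sub_cancel]
  rw [← add_lat_cancel (k := (k, 0)), add_assoc, add_comm (lat _), this]
  exact hw

/-- A translate of the axis separates the translates on its two sides. -/
lemma exists_mem_line {K : Set (ℝ × ℝ)} {p q : ℝ × ℝ} (hK : JoinedIn K p q) {i n j : ℤ}
    (hi : i < n) (hj : n < j) (hp : p ∈ A.line i) (hq : q ∈ A.line j) : ∃ z ∈ K, z ∈ A.line n := by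
  obtain ⟨u, rfl⟩ := hp
  obtain ⟨w, rfl⟩ := hq
  obtain ⟨t₁, t₂, ht⟩ := A.exists_extrema
  obtain ⟨B₀, hB₀, hB₀K, jB₀⟩ : ∃ B₀, IsCompact B₀ ∧ B₀ ⊆ K ∧
      JoinedIn B₀ (A.S u + lat (i, 0)) (A.S w + lat (j, 0)) :=
    ⟨range hK.somePath, isCompact_range hK.somePath.continuous,
      range_subset_iff.2 hK.somePath_mem, ⟨hK.somePath, fun t => mem_range_self t⟩⟩
  have hc : ∀ n, Continuous fun t => A.S t + lat (n, 0) := fun n =>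
    A.continuous.add continuous_const
  set B₁ := (fun t => A.S t + lat (i, 0)) '' uIcc t₁ u with hB₁
  set B₂ := (fun t => A.S t + lat (j, 0)) '' uIcc w t₂ with hB₂
  have jB : JoinedIn (B₁ ∪ B₀ ∪ B₂) (A.S t₁ + lat (i, 0)) (A.S t₂ + lat (j, 0)) :=
    ((joinedIn_image (hc i).continuousOn).mono (subset_union_left.trans subset_union_left)).trans
      ((jB₀.mono (subset_union_right.trans subset_union_left)).trans
        ((joinedIn_image (hc j).continuousOn).mono subset_union_right))
  have hB : IsCompact (B₁ ∪ B₀ ∪ B₂) :=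
    ((isCompact_uIcc.image (hc i)).union hB₀).union (isCompact_uIcc.image (hc j))
  obtain ⟨R, hR⟩ := hB.exists_bound_of_continuousOn continuous_snd.continuousOn
  obtain ⟨C, hC⟩ := A.exists_bound
  have hℓ := A.ℓ_pos
  obtain ⟨M, hM⟩ : ∃ M, M / A.ℓ = R + C + 1 := ⟨(R + C + 1) * A.ℓ, by field_simp⟩
  have jA := joinedIn_image (a := -M) (b := M) (hc n).continuousOn
  have key := joinedIn_cross jA jB ?_ ?_ ?_ ?_
  · obtain ⟨z, ⟨t, -, rfl⟩, (⟨s, -, hs⟩ | h) | ⟨s, -, hs⟩⟩ := key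
    · exact (A.line_disjoint hi.ne ⟨s, hs⟩ (A.mem_line t n)).elim
    · exact ⟨_, hB₀K h, A.mem_line t n⟩
    · exact (A.line_disjoint hj.ne' ⟨s, hs⟩ (A.mem_line t n)).elim
  · rintro _ ⟨s, -, rfl⟩
    have : (i : ℝ) < n := by exact_mod_cast hi
    simp only [lat, Prod.fst_add]
    linarith [(ht s).1]
  · rintro _ ⟨s, -, rfl⟩
    have : (n : ℝ) < j := by exact_mod_cast hj
    simp only [lat, Prod.fst_add]
    linarith [(ht s).2]
  · intro b hb
    have h1 := abs_le.1 (hR b hb)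
    have h2 := abs_le.1 (hC (-M)).2
    rw [neg_div, hM] at h2
    simp only [lat, Prod.snd_add, Int.cast_zero]
    linarith
  · intro b hb
    have h1 := abs_le.1 (hR b hb)
    have h2 := abs_le.1 (hC M).2
    rw [hM] at h2
    simp only [lat, Prod.snd_add, Int.cast_zero]
    linarith

end Axis

end GeoPlane

namespace GeoPlane

variable {G : GeoPlane}

namespace Axis

variable (A : G.Axis)

lemma isom_line (n : ℤ) (s t : ℝ) : G.d (A.S s + lat (n, 0)) (A.S t + lat (n, 0)) = |s - t| := by
  rw [G.per, A.iso]

lemma continuous_line (n : ℤ) : Continuous fun t => A.S t + lat (n, 0) :=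
  A.continuous.add continuous_const

/-- A minimal segment between consecutive translates meets no translate in its interior. -/
lemma segment_notMem_line {γ : ℝ → ℝ × ℝ} {a b t : ℝ} (hγ : G.Iso γ a b) {n : ℤ}
    (ha : γ a ∈ A.line n) (hb : γ b ∈ A.line (n + 1)) (ht : t ∈ Ioo a b) (k : ℤ) :
    γ t ∉ A.line k := by
  have case0 : ∀ t ∈ Ioo a b, γ t ∉ A.line n := fun t ht h => by
    obtain ⟨u, hu⟩ := id ha
    obtain ⟨w, hw⟩ := h
    obtain ⟨e, -, -, h⟩ := iso_line_extend (A.isom_line n) hγ ht hu.symm hw.symm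
    exact A.line_disjoint (lt_add_one n).ne ⟨_, (h b ⟨ht.2.le, le_rfl⟩).symm⟩ hb
  have case1 : ∀ t ∈ Ioo a b, γ t ∉ A.line (n + 1) := fun t ht h => by
    obtain ⟨u, hu⟩ := id hb
    obtain ⟨w, hw⟩ := h
    obtain ⟨e, -, -, h⟩ := iso_line_extend (A.isom_line (n + 1)) hγ.reverse (r := -t)
      (u := u) (w := w) ⟨by linarith [ht.2], by linarith [ht.1]⟩ (by simpa using hu.symm)
      (by simpa using hw.symm)
    have := h (-a) ⟨by linarith [ht.1], le_rfl⟩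
    rw [neg_neg] at this
    exact A.line_disjoint (lt_add_one n).ne' ⟨_, this.symm⟩ ha
  intro hk
  rcases lt_trichotomy k n with h | rfl | h
  · obtain ⟨z, ⟨s, hs, rfl⟩, hz⟩ := A.exists_mem_line (joinedIn_image (a := t) (b := b)
      ((hγ.mono ht.1.le le_rfl).continuousOn.mono (uIcc_of_le ht.2.le).le)) h (lt_add_one n) hk hb
    rw [uIcc_of_le ht.2.le] at hs
    rcases hs.2.eq_or_lt with rfl | h'
    · exact A.line_disjoint (lt_add_one n).ne hz hb
    · exact case0 s ⟨ht.1.trans_le hs.1, h'⟩ hz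
  · exact case0 t ht hk
  · rcases (Int.add_one_le_iff.2 h).eq_or_lt with rfl | h'
    · exact case1 t ht hk
    obtain ⟨z, ⟨s, hs, rfl⟩, hz⟩ := A.exists_mem_line (joinedIn_image (a := a) (b := t)
      ((hγ.mono le_rfl ht.2.le).continuousOn.mono (uIcc_of_le ht.1.le).le)) (lt_add_one n) h' ha hk
    rw [uIcc_of_le ht.1.le] at hs
    rcases hs.1.eq_or_lt with rfl | h'
    · exact A.line_disjoint (lt_add_one n).ne ha hz
    · exact case1 s ⟨h', hs.2.trans_lt ht.2⟩ hz

/-- The distance from a point of the axis to a point of its first translate. -/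
def h (x y : ℝ) : ℝ := G.d (A.S x) (A.S y + lat (1, 0))

lemma h_eq (n : ℤ) (x y : ℝ) : G.d (A.S x + lat (n, 0)) (A.S y + lat (n + 1, 0)) = A.h x y := by
  rw [h, ← G.per (n, 0) (A.S x), add_assoc, lat_mk_add, add_zero, add_comm 1 n]

lemma h_le_left (x x' y : ℝ) : A.h x y ≤ A.h x' y + |x - x'| := by
  have := G.tri (A.S x) (A.S x') (A.S y + lat (1, 0))
  rw [A.iso] at this
  rw [h, h]; linarith

lemma h_le_right (x y y' : ℝ) : A.h x y ≤ A.h x y' + |y - y'| := by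
  have := G.tri (A.S x) (A.S y' + lat (1, 0)) (A.S y + lat (1, 0))
  rw [A.isom_line, abs_sub_comm] at this
  rw [h, h]; linarith

lemma h_per (x y : ℝ) : A.h (x + A.ℓ) (y + A.ℓ) = A.h x y := by
  rw [h, A.per, A.per, add_right_comm, G.per, ← h]

lemma continuous_h : Continuous fun z : ℝ × ℝ => A.h z.1 z.2 :=
  G.continuous_d.comp ((A.continuous.comp continuous_fst).prodMk
    ((A.continuous_line 1).comp continuous_snd))

lemma h_self_le (x : ℝ) : A.h x x ≤ G.C := by
  refine (G.up _ _).trans ?_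
  have : ‖A.S x - (A.S x + lat (1, 0))‖ = 1 := by
    rw [sub_add_cancel_left, norm_neg]; simp [lat, Prod.norm_def]
  rw [this, mul_one]

lemma exists_h_pos : ∃ δ > 0, ∀ x y, δ ≤ A.h x y := by
  have hc : IsCompact (Icc 0 A.ℓ ×ˢ Icc (-G.C - 1) (A.ℓ + G.C + 1)) :=
    isCompact_Icc.prod isCompact_Icc
  have hℓ := A.ℓ_pos
  have hC := G.C_pos
  obtain ⟨z, -, hz⟩ := hc.exists_isMinOn ⟨(0, 0), ⟨le_rfl, hℓ.le⟩, by simp only; linarith,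
    by simp only; linarith⟩ A.continuous_h.continuousOn
  have hpos : 0 < A.h z.1 z.2 := by
    by_contra h
    exact A.ne_translate one_ne_zero z.1 z.2 (G.eq_of_le_zero (not_lt.1 h))
  refine ⟨min 1 (A.h z.1 z.2), lt_min one_pos hpos, fun x y => ?_⟩
  have per : ∀ k : ℤ, A.h (x + k * A.ℓ) (y + k * A.ℓ) = A.h x y := fun k => by
    rw [h, A.per_int, A.per_int, add_right_comm, G.per, ← h]
  rcases le_total (G.C + 1) |x - y| with h1 | h1
  · refine (min_le_left _ _).trans ?_
    have h2 := G.tri (A.S x) (A.S y + lat (1, 0)) (A.S y)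
    rw [A.iso, ← h, G.symm _ (A.S y), ← h] at h2
    linarith [A.h_self_le y]
  · refine (min_le_right _ _).trans ?_
    rw [← per (-⌊x / A.ℓ⌋)]
    have e1 := Int.floor_le (x / A.ℓ)
    have e2 := Int.lt_floor_add_one (x / A.ℓ)
    rw [le_div_iff₀ hℓ] at e1
    rw [div_lt_iff₀ hℓ] at e2
    have e3 := abs_le.1 h1
    refine isMinOn_iff.1 hz (_, _) ⟨⟨?_, ?_⟩, ⟨?_, ?_⟩⟩ <;> push_cast <;> linarith

/-- Two minimal segments with interchanged endpoints meet. -/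
lemma segments_meet {a b : ℝ → ℝ × ℝ} {D E x y x' y' : ℝ} (hD : 0 ≤ D) (hE : 0 ≤ E)
    (ha : G.Iso a 0 D) (hb : G.Iso b 0 E) (ha0 : a 0 = A.S x) (ha1 : a D = A.S x' + lat (1, 0))
    (hb0 : b 0 = A.S y) (hb1 : b E = A.S y' + lat (1, 0)) (hxy : x < y) (hyx : y' < x') :
    ∃ s ∈ Icc 0 D, ∃ t ∈ Icc 0 E, a s = b t := by
  have hℓ := A.ℓ_pos
  have A0 := A.mem_line_zero
  have A1 := fun t => A.mem_line t 1
  have seg : ∀ {γ : ℝ → ℝ × ℝ} {F : ℝ}, G.Iso γ 0 F → γ 0 ∈ A.line 0 → γ F ∈ A.line 1 →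
      ∀ s ∈ Icc 0 F,
      ∀ n, γ s ∈ A.line n → s = 0 ∨ s = F := fun {γ F} hγ h0 h1 s hs n hn => by
    rcases hs.1.eq_or_lt with rfl | h
    · exact Or.inl rfl
    rcases hs.2.eq_or_lt with rfl | h'
    · exact Or.inr rfl
    exact (A.segment_notMem_line hγ h0 h1 ⟨h, h'⟩ n hn).elim
  have sa := seg ha (ha0 ▸ A0 x) (ha1 ▸ A1 x')
  have sb := seg hb (hb0 ▸ A0 y) (hb1 ▸ A1 y')
  have d01 : ∀ {z}, z ∈ A.line 0 → z ∈ A.line 1 → False := A.line_disjoint zero_ne_one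
  obtain ⟨K, hK⟩ := A.exists_bound
  obtain ⟨t₁, t₂, ht⟩ := A.exists_extrema
  obtain ⟨Ra, hRa⟩ := isCompact_Icc.exists_bound_of_continuousOn ha.continuousOn
  obtain ⟨Rb, hRb⟩ := isCompact_Icc.exists_bound_of_continuousOn hb.continuousOn
  have ya : ∀ s ∈ Icc 0 D, |(a s).2| ≤ Ra := fun s hs => (norm_snd_le _).trans (hRa s hs)
  have xa : ∀ s ∈ Icc 0 D, |(a s).1| ≤ Ra := fun s hs => (norm_fst_le _).trans (hRa s hs)
  have yb : ∀ s ∈ Icc 0 E, |(b s).2| ≤ Rb := fun s hs => (norm_snd_le _).trans (hRb s hs)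
  have hlow : ∀ s t, s ≤ t → (A.S s).2 ≤ t / A.ℓ + K := fun s t hst => by
    have h1 := (abs_le.1 (hK s).2).2
    have h2 := div_le_div_of_nonneg_right hst hℓ.le
    linarith
  have hhigh : ∀ s t, s ≤ t → s / A.ℓ - K ≤ (A.S t).2 := fun s t hst => by
    have h1 := (abs_le.1 (hK t).2).1
    have h2 := div_le_div_of_nonneg_right hst hℓ.le
    linarith
  obtain ⟨p, hp⟩ : ∃ p, (∀ t, (A.S p).1 ≤ (A.S t).1) ∧ y ≤ p ∧ x / A.ℓ + K < (A.S p).2 ∧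
      Ra < (A.S p).2 := by
    obtain ⟨N, hN⟩ := exists_nat_gt (max ((y - t₁) / A.ℓ) (max (x / A.ℓ + K - (A.S t₁).2)
      (Ra - (A.S t₁).2)))
    simp only [max_lt_iff, div_lt_iff₀ hℓ] at hN
    refine ⟨t₁ + N * A.ℓ, ?_⟩
    rw [A.per_nat]
    simp only [lat, Prod.fst_add, Prod.snd_add, Int.cast_zero, add_zero, Int.cast_natCast]
    exact ⟨fun t => (ht t).1, by linarith, by linarith, by linarith⟩
  obtain ⟨q, hq⟩ : ∃ q, (∀ t, (A.S t).1 ≤ (A.S q).1) ∧ q ≤ y' ∧ (A.S q).2 < x' / A.ℓ - K ∧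
      (A.S q).2 < -Ra := by
    obtain ⟨N, hN⟩ := exists_nat_gt (max ((t₂ - y') / A.ℓ) (max (-(x' / A.ℓ - K) + (A.S t₂).2)
      (Ra + (A.S t₂).2)))
    simp only [max_lt_iff, div_lt_iff₀ hℓ] at hN
    refine ⟨t₂ + (-N : ℤ) * A.ℓ, ?_⟩
    rw [A.per_int]
    simp only [lat, Prod.fst_add, Prod.snd_add, Int.cast_zero, add_zero, Int.cast_natCast,
      Int.cast_neg]
    exact ⟨fun t => (ht t).2, by linarith, by linarith, by linarith⟩
  obtain ⟨R, hRK, hRa'⟩ : ∃ R, K + 1 < R ∧ Ra < R :=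
    ⟨max (K + 1) Ra + 1, by linarith [le_max_left (K + 1) Ra],
      by linarith [le_max_right (K + 1) Ra]⟩
  obtain ⟨M, hM⟩ : ∃ M, M = |x| + |x'| +
      (|p / A.ℓ| + |q / A.ℓ| + |y / A.ℓ| + |y' / A.ℓ| + 2 * |K| + Rb + 1) * A.ℓ :=
    ⟨_, rfl⟩
  have hRb0 : 0 ≤ Rb := (abs_nonneg _).trans (yb 0 ⟨le_rfl, hE⟩)
  have hKn : 0 ≤ K := (abs_nonneg _).trans (hK 0).1
  have hMx : |x| ≤ M ∧ |x'| ≤ M := by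
    have : 0 ≤ (|p / A.ℓ| + |q / A.ℓ| + |y / A.ℓ| + |y' / A.ℓ| + 2 * |K| + Rb + 1) * A.ℓ := by
      positivity
    constructor <;> linarith [abs_nonneg x, abs_nonneg x']
  have hMℓ : |p / A.ℓ| + |q / A.ℓ| + |y / A.ℓ| + |y' / A.ℓ| + 2 * K + Rb + 1 ≤ M / A.ℓ := by
    rw [le_div_iff₀ hℓ, hM, abs_of_nonneg hKn]
    linarith [abs_nonneg x, abs_nonneg x']
  have p3 := abs_le.1 (le_refl |p / A.ℓ|)
  have q3 := abs_le.1 (le_refl |q / A.ℓ|)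
  have y3 := abs_le.1 (le_refl |y / A.ℓ|)
  have y3' := abs_le.1 (le_refl |y' / A.ℓ|)
  have jA : JoinedIn (A.S '' uIcc (-M) x ∪ a '' uIcc 0 D ∪
      (fun t => A.S t + lat (1, 0)) '' uIcc x' M)
      (A.S (-M)) (A.S M + lat (1, 0)) := by
    refine ((joinedIn_image A.continuous.continuousOn).mono
      (subset_union_left.trans subset_union_left)).trans ((JoinedIn.mono ?_
      (subset_union_right.trans subset_union_left)).trans
      ((joinedIn_image (A.continuous_line 1).continuousOn).mono subset_union_right))
    rw [← ha0, ← ha1]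
    exact joinedIn_image (by rw [uIcc_of_le hD]; exact ha.continuousOn)
  have jB : JoinedIn ({z : ℝ × ℝ | z.1 ≤ (A.S p).1 ∧ z.2 = (A.S p).2} ∪ (A.S '' uIcc p y ∪
      b '' uIcc 0 E ∪ (fun t => A.S t + lat (1, 0)) '' uIcc y' q) ∪
      {z : ℝ × ℝ | (A.S q).1 + 1 ≤ z.1 ∧ z.2 = (A.S q).2}) (-R, (A.S p).2) (R + 1, (A.S q).2) := by
    refine (JoinedIn.mono (y := A.S p) ?_ (subset_union_left.trans subset_union_left)).trans
      ((JoinedIn.mono (y := A.S q + lat (1, 0)) ?_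
      (subset_union_right.trans subset_union_left)).trans (JoinedIn.mono ?_ subset_union_right))
    · refine Convex.joinedIn ?_ ⟨by have := (abs_le.1 (hK p).1).1; simp only; linarith, rfl⟩
        ⟨le_rfl, rfl⟩
      exact (convex_halfSpace_le (f := Prod.fst) ⟨fun _ _ => rfl, fun _ _ => rfl⟩ _).inter
        (convex_hyperplane (f := Prod.snd) ⟨fun _ _ => rfl, fun _ _ => rfl⟩ _)
    · refine ((joinedIn_image A.continuous.continuousOn).mono
        (subset_union_left.trans subset_union_left)).trans ((JoinedIn.mono ?_
        (subset_union_right.trans subset_union_left)).trans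
        ((joinedIn_image (A.continuous_line 1).continuousOn).mono subset_union_right))
      rw [← hb0, ← hb1]
      exact joinedIn_image (by rw [uIcc_of_le hE]; exact hb.continuousOn)
    · refine Convex.joinedIn ?_ ⟨by simp [lat], by simp [lat]⟩
        ⟨by have := (abs_le.1 (hK q).1).2; simp only; linarith, rfl⟩
      exact (convex_halfSpace_ge (f := Prod.fst) ⟨fun _ _ => rfl, fun _ _ => rfl⟩ _).inter
        (convex_hyperplane (f := Prod.snd) ⟨fun _ _ => rfl, fun _ _ => rfl⟩ _)
  rw [uIcc_of_le (by linarith [neg_abs_le x, hMx.1]), uIcc_of_le hD,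
    uIcc_of_le (by linarith [le_abs_self x', hMx.2])] at jA
  rw [uIcc_of_ge hp.2.1, uIcc_of_le hE, uIcc_of_ge hq.2.1] at jB
  have key := joinedIn_cross jA jB ?_ ?_ ?_ ?_
  · obtain ⟨z, (⟨s, hs, rfl⟩ | ⟨s, hs, rfl⟩) | ⟨s, hs, rfl⟩, (h | ((⟨t, ht', h⟩ | ⟨t, ht', h⟩) |
      ⟨t, ht', h⟩)) | h⟩ := key
    · linarith [h.2, hlow s x hs.2]
    · linarith [A.injective h, hs.2, ht'.1]
    · rcases sb t ht' 0 (h ▸ A0 s) with rfl | rfl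
      · linarith [A.injective (hb0.symm.trans h), hs.2]
      · exact (d01 (h ▸ A0 s) (hb1 ▸ A1 y')).elim
    · exact (d01 (A0 s) (h ▸ A1 t)).elim
    · linarith [h.1, hq.1 s]
    · linarith [h.2, (abs_le.1 (ya s hs)).2]
    · rcases sa s hs 0 (h ▸ A0 t) with rfl | rfl
      · linarith [A.injective (ha0.symm.trans h.symm), ht'.1]
      · exact (d01 (h ▸ A0 t) (ha1 ▸ A1 x')).elim
    · exact ⟨s, hs, t, ht', h.symm⟩
    · rcases sa s hs 1 (h ▸ A1 t) with rfl | rfl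
      · exact (d01 (ha0 ▸ A0 x) (h ▸ A1 t)).elim
      · linarith [A.injective (add_lat_cancel.1 (ha1.symm.trans h.symm)), ht'.2]
    · linarith [h.2, (abs_le.1 (ya s hs)).1]
    · have := h.1
      simp only [lat, Prod.fst_add, Int.cast_one] at this
      linarith [hp.1 s]
    · exact (d01 (A0 t) (h ▸ A1 s)).elim
    · rcases sb t ht' 1 (h ▸ A1 s) with rfl | rfl
      · exact (d01 (hb0 ▸ A0 y) (h ▸ A1 s)).elim
      · linarith [A.injective (add_lat_cancel.1 (hb1.symm.trans h)), hs.1]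
    · linarith [A.injective (add_lat_cancel.1 h), hs.1, ht'.2]
    · have := h.2
      simp only [lat, Prod.snd_add, Int.cast_zero, add_zero] at this
      linarith [hhigh x' s hs.1]
  · rintro _ ((⟨s, hs, rfl⟩ | ⟨s, hs, rfl⟩) | ⟨s, hs, rfl⟩)
    · simp only; linarith [(abs_le.1 (hK s).1).1]
    · simp only; linarith [(abs_le.1 (xa s hs)).1]
    · simp only [lat, Prod.fst_add, Int.cast_one]; linarith [(abs_le.1 (hK s).1).1]
  · rintro _ ((⟨s, hs, rfl⟩ | ⟨s, hs, rfl⟩) | ⟨s, hs, rfl⟩)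
    · simp only; linarith [(abs_le.1 (hK s).1).2]
    · simp only; linarith [(abs_le.1 (xa s hs)).2]
    · simp only [lat, Prod.fst_add, Int.cast_one]; linarith [(abs_le.1 (hK s).1).2]
  · have e0 := hlow (-M) (-M) le_rfl
    have e1 := hhigh p p le_rfl
    have e2 := hhigh q q le_rfl
    have e3 := hhigh y y le_rfl
    rw [neg_div] at e0
    rintro _ ((⟨-, h⟩ | ((⟨t, ht', rfl⟩ | ⟨t, ht', rfl⟩) | ⟨t, ht', rfl⟩)) | ⟨-, h⟩)
    · rw [h]; linarith
    · linarith [hhigh y t ht'.1]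
    · linarith [abs_le.1 (yb t ht')]
    · simp only [lat, Prod.snd_add, Int.cast_zero]
      linarith [hhigh q t ht'.1]
    · rw [h]; linarith
  · have e0 := hhigh M M le_rfl
    have e1 := hlow p p le_rfl
    have e2 := hlow q q le_rfl
    simp only [lat, Prod.snd_add, Int.cast_zero]
    rintro _ ((⟨-, h⟩ | ((⟨t, ht', rfl⟩ | ⟨t, ht', rfl⟩) | ⟨t, ht', rfl⟩)) | ⟨-, h⟩)
    · rw [h]; linarith
    · linarith [hlow t p ht'.2]
    · linarith [abs_le.1 (yb t ht')]
    · simp only [Prod.snd_add]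
      linarith [hlow t y' ht'.2]
    · rw [h]; linarith

end Axis

end GeoPlane

namespace GeoPlane

variable {G : GeoPlane}

namespace Axis

variable (A : G.Axis)

lemma monge {x y x' y' : ℝ} (hxy : x ≤ y) (hyx : y' ≤ x') :
    A.h x y' + A.h y x' ≤ A.h x x' + A.h y y' := by
  rcases hxy.eq_or_lt with rfl | hxy
  · exact (add_comm _ _).le
  rcases hyx.eq_or_lt with rfl | hyx
  · exact le_rfl
  obtain ⟨a, ha0, ha1, ha⟩ := G.seg (A.S x) (A.S x' + lat (1, 0))
  obtain ⟨b, hb0, hb1, hb⟩ := G.seg (A.S y) (A.S y' + lat (1, 0))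
  rw [← h] at ha1 ha
  rw [← h] at hb1 hb
  have hD : 0 ≤ A.h x x' := G.nonneg _ _
  have hE : 0 ≤ A.h y y' := G.nonneg _ _
  obtain ⟨s, hs, t, ht, hst⟩ := A.segments_meet hD hE ha hb ha0 ha1 hb0 hb1 hxy hyx
  have a1 := ha 0 ⟨le_rfl, hD⟩ s hs
  have a2 := ha s hs _ ⟨hD, le_rfl⟩
  have b1 := hb 0 ⟨le_rfl, hE⟩ t ht
  have b2 := hb t ht _ ⟨hE, le_rfl⟩
  rw [abs_sub_comm, abs_of_nonneg (by linarith [hs.1, hs.2, ht.1, ht.2])] at a1 a2 b1 b2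
  rw [ha0] at a1
  rw [ha1] at a2
  rw [hb0] at b1
  rw [hb1] at b2
  have t1 := G.tri (A.S x) (a s) (A.S y' + lat (1, 0))
  have t2 := G.tri (A.S y) (b t) (A.S x' + lat (1, 0))
  rw [← h] at t1 t2
  rw [hst] at t1 a1
  rw [← hst] at t2 b1
  rw [hst] at t2 b1 a2
  linarith

/-- Two minimal segments meeting on a translate of the axis at a local minimum of the sum of
their lengths form a geodesic. -/
lemma locIsoAt_vertex {c : ℝ → ℝ × ℝ} {t D E x a b : ℝ} {n : ℤ} (hD : 0 < D) (hE : 0 < E)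
    (h1 : G.Iso c (t - D) t) (h2 : G.Iso c t (t + E))
    (hc : ∀ r s, G.d (c r) (c s) ≤ |r - s|) (c0 : c t = A.S x + lat (n, 0))
    (c1 : c (t - D) = A.S a + lat (n - 1, 0)) (c2 : c (t + E) = A.S b + lat (n + 1, 0))
    (hmin : ∀ᶠ w in 𝓝 x, D + E ≤ A.h a w + A.h w b) : LocIsoAt G.d c t := by
  obtain ⟨ρ, hρ, hmin⟩ := Metric.eventually_nhds_iff.1 hmin
  obtain ⟨ε, hε, hεD, hεE, hερ⟩ : ∃ ε > 0, ε < D ∧ ε < E ∧ 3 * ε < ρ :=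
    ⟨min (min D E) ρ / 4, by positivity,
      by linarith [min_le_left (min D E) ρ, min_le_left D E],
      by linarith [min_le_left (min D E) ρ, min_le_right D E],
      by linarith [min_le_right (min D E) ρ]⟩
  suffices h : 2 * ε ≤ G.d (c (t - ε)) (c (t + ε)) by
    exact ⟨ε, hε, iso_of_lip (fun s _ u _ => hc s u) (by linarith)⟩
  by_contra! hlt
  obtain ⟨κ, k0, k1, hκ⟩ := G.seg (c (t - ε)) (c (t + ε))
  obtain ⟨F, hF⟩ : ∃ F, F = G.d (c (t - ε)) (c (t + ε)) := ⟨_, rfl⟩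
  rw [← hF] at k1 hκ hlt
  have hF0 : 0 ≤ F := hF ▸ G.nonneg _ _
  have j : JoinedIn (c '' uIcc (t - D) (t - ε) ∪ κ '' uIcc 0 F ∪ c '' uIcc (t + ε) (t + E))
      (c (t - D)) (c (t + E)) := by
    have hcc := (G.continuous_of_lip hc).continuousOn (s := univ)
    refine ((joinedIn_image (hcc.mono (subset_univ _))).mono
      (subset_union_left.trans subset_union_left)).trans ((JoinedIn.mono ?_
      (subset_union_right.trans subset_union_left)).trans
      ((joinedIn_image (hcc.mono (subset_univ _))).mono subset_union_right))
    rw [← k0, ← k1]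
    exact joinedIn_image (by
      rw [uIcc_of_le hF0]
      exact G.continuousOn_of_lip fun s hs t ht => (hκ s hs t ht).le)
  obtain ⟨z, hz, w, hw⟩ := A.exists_mem_line j (i := n - 1) (n := n) (j := n + 1) (by linarith)
    (by linarith) ⟨a, c1.symm⟩ ⟨b, c2.symm⟩
  rw [uIcc_of_le (by linarith), uIcc_of_le hF0, uIcc_of_le (by linarith)] at hz
  have hn : n - 1 + 1 = n := by ring
  rcases hz with (⟨s, hs, rfl⟩ | ⟨s, hs, rfl⟩) | ⟨s, hs, rfl⟩
  · rcases hs.1.eq_or_lt with rfl | hs1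
    · exact A.line_disjoint (show n - 1 ≠ n by linarith) ⟨a, c1.symm⟩ ⟨w, hw⟩
    · exact A.segment_notMem_line h1 (n := n - 1) ⟨a, c1.symm⟩ (by rw [hn]; exact ⟨x, c0.symm⟩)
        ⟨hs1, by linarith [hs.2]⟩ n ⟨w, hw⟩
  · have e1 := hκ 0 ⟨le_rfl, hF0⟩ s hs
    have e2 := hκ s hs F ⟨hF0, le_rfl⟩
    rw [abs_sub_comm, abs_of_nonneg (by linarith [hs.1, hs.2])] at e1 e2
    simp only at hw
    rw [k0] at e1
    rw [k1] at e2
    have f1 := hc (t - D) (t - ε)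
    have f2 := hc (t + ε) (t + E)
    have f3 := hc t (t - ε)
    rw [abs_sub_comm, abs_of_nonneg (by linarith)] at f1 f2
    rw [abs_of_nonneg (by linarith)] at f3
    have g1 := G.tri (c (t - D)) (c (t - ε)) (κ s)
    have g2 := G.tri (κ s) (c (t + ε)) (c (t + E))
    have g3 := G.tri (c t) (c (t - ε)) (κ s)
    rw [← hw] at g1 g2 g3 e1 e2
    have i1 := A.h_eq (n - 1) a w
    rw [hn] at i1
    rw [c1, i1] at g1
    rw [c2, A.h_eq] at g2
    rw [c0, A.isom_line] at g3
    rw [c1] at f1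
    rw [c2] at f2
    rw [c0] at f3
    have := hmin (y := w) (by rw [Real.dist_eq, abs_sub_comm]; linarith [hs.2])
    linarith
  · rcases hs.2.eq_or_lt with rfl | hs2
    · exact A.line_disjoint (show n + 1 ≠ n by linarith) ⟨b, c2.symm⟩ ⟨w, hw⟩
    · exact A.segment_notMem_line h2 (n := n) ⟨x, c0.symm⟩ ⟨b, c2.symm⟩
        ⟨by linarith [hs.1], hs2⟩ n ⟨w, hw⟩

variable {A}

lemma iso_concatenation {ξ T : ℤ → ℝ} {L : ℝ → ℝ × ℝ}
    (hT : ∀ n, T (n + 1) - T n = A.h (ξ n) (ξ (n + 1)))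
    (hL : ∀ s t, G.d (L s) (L t) ≤ |s - t|) (hP : ∀ n, L (T n) = A.S (ξ n) + lat (n, 0))
    (n : ℤ) : G.Iso L (T n) (T (n + 1)) := by
  refine iso_of_lip (fun s _ t _ => hL s t) ?_
  rw [hP, hP, A.h_eq, hT]

/-- A concatenation of minimal segments between consecutive translates of an axis is a geodesic if
its vertices locally minimise length. -/
lemma locIsoAt_concatenation {ξ T : ℤ → ℝ} {L : ℝ → ℝ × ℝ}
    (hT : ∀ n, T (n + 1) - T n = A.h (ξ n) (ξ (n + 1)))
    (hL : ∀ s t, G.d (L s) (L t) ≤ |s - t|) (hP : ∀ n, L (T n) = A.S (ξ n) + lat (n, 0))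
    (hmin : ∀ n, ∀ᶠ w in 𝓝 (ξ n), A.h (ξ (n - 1)) (ξ n) +
    A.h (ξ n) (ξ (n + 1)) ≤ A.h (ξ (n - 1)) w + A.h w (ξ (n + 1))) (t : ℝ) :
    LocIsoAt G.d L t := by
  obtain ⟨δ, hδ, hh⟩ := A.exists_h_pos
  obtain ⟨n, hn⟩ := exists_cell hδ (fun n => (hT n).symm ▸ hh _ _) t
  rcases hn.1.eq_or_lt with rfl | h
  · have e := hT (n - 1)
    have i := iso_concatenation hT hL hP (n - 1)
    rw [sub_add_cancel] at e i
    have e1 : T (n - 1) = T n - A.h (ξ (n - 1)) (ξ n) := by linarith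
    have e2 : T (n + 1) = T n + A.h (ξ n) (ξ (n + 1)) := by linarith [hT n]
    refine A.locIsoAt_vertex (hδ.trans_le (hh _ _)) (hδ.trans_le (hh _ _)) ?_ ?_ hL (hP n)
      (e1 ▸ hP (n - 1)) (e2 ▸ hP (n + 1)) (hmin n)
    · rw [← e1]; exact i
    · rw [← e2]; exact iso_concatenation hT hL hP n
  · exact (iso_concatenation hT hL hP n).locIsoAt ⟨h, hn.2⟩

lemma eq_of_mem_line {ξ T : ℤ → ℝ} {L : ℝ → ℝ × ℝ}
    (hT : ∀ n, T (n + 1) - T n = A.h (ξ n) (ξ (n + 1)))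
    (hL : ∀ s t, G.d (L s) (L t) ≤ |s - t|) (hP : ∀ n, L (T n) = A.S (ξ n) + lat (n, 0))
    {t : ℝ} {n : ℤ} (ht : L t ∈ A.line n) : t = T n := by
  obtain ⟨δ, hδ, hh⟩ := A.exists_h_pos
  obtain ⟨k, hk⟩ := exists_cell hδ (fun n => (hT n).symm ▸ hh _ _) t
  rcases hk.1.eq_or_lt with rfl | h
  · by_contra hne
    rw [hP] at ht
    exact A.line_disjoint (show k ≠ n by rintro rfl; exact hne rfl) (A.mem_line _ _) ht
  · exact (A.segment_notMem_line (iso_concatenation hT hL hP k) ⟨_, (hP k).symm⟩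
      ⟨_, (hP (k + 1)).symm⟩ ⟨h, hk.2⟩ n ht).elim

end Axis

end GeoPlane

/-- A periodic cost on pairs of reals with the Monge property and minimal diagonal value zero. -/
structure MongeCost where
  f : ℝ → ℝ → ℝ
  ℓ : ℝ
  ℓ_pos : 0 < ℓ
  lip_left : ∀ x x' y, f x y ≤ f x' y + |x - x'|
  lip_right : ∀ x y y', f x y ≤ f x y' + |y - y'|
  per : ∀ x y, f (x + ℓ) (y + ℓ) = f x y
  monge : ∀ x y x' y', x ≤ y → y' ≤ x' → f x y' + f y x' ≤ f x x' + f y y'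
  diag : ∀ x, 0 ≤ f x x
  exists_zero : ∃ z, f z z = 0

namespace MongeCost

/-- Finite chains with steps related by `R`, with their total cost. -/
inductive Chain (G : MongeCost) (R : ℝ → ℝ → Prop) : ℝ → ℝ → ℝ → Prop
  | one {x y : ℝ} : R x y → Chain G R x y (G.f x y)
  | cons {x y z c : ℝ} : R x y → Chain G R y z c → Chain G R x z (G.f x y + c)

variable (G : MongeCost)

/-- The reflected cost. -/
def neg : MongeCost where
  f x y := G.f (-x) (-y)
  ℓ := G.ℓ
  ℓ_pos := G.ℓ_pos
  lip_left x x' y := by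
    have := G.lip_left (-x) (-x') (-y)
    rwa [neg_sub_neg, abs_sub_comm] at this
  lip_right x y y' := by
    have := G.lip_right (-x) (-y) (-y')
    rwa [neg_sub_neg, abs_sub_comm] at this
  per x y := by
    have := G.per (-(x + G.ℓ)) (-(y + G.ℓ))
    rw [← this]
    ring_nf
  monge x y x' y' h h' := by
    have := G.monge (-y) (-x) (-y') (-x') (neg_le_neg h) (neg_le_neg h')
    linarith
  diag x := G.diag _
  exists_zero := by
    obtain ⟨z, hz⟩ := G.exists_zero
    exact ⟨-z, by rwa [neg_neg]⟩

/-- The transposed cost. -/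
def flip : MongeCost where
  f x y := G.f y x
  ℓ := G.ℓ
  ℓ_pos := G.ℓ_pos
  lip_left x x' y := G.lip_right y x x'
  lip_right x y y' := G.lip_left y y' x
  per x y := G.per y x
  monge x y x' y' h h' := by
    have := G.monge y' x' y x h' h
    linarith
  diag x := G.diag x
  exists_zero := G.exists_zero

variable {G} {R : ℝ → ℝ → Prop} {x y z c : ℝ}

lemma Chain.append (h : G.Chain R x y c) {e : ℝ} (h' : G.Chain R y z e) :
    G.Chain R x z (c + e) := by
  induction h with
  | one h => exact .cons h h'
  | cons h _ ih => rw [add_assoc]; exact .cons h (ih h')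

lemma Chain.imp {R' : ℝ → ℝ → Prop} (h : G.Chain R x y c) (hR : ∀ x y, R x y → R' x y) :
    G.Chain R' x y c := by
  induction h with
  | one h => exact .one (hR _ _ h)
  | cons h _ ih => exact .cons (hR _ _ h) ih

lemma Chain.neg (h : G.Chain R x y c) : G.neg.Chain (fun x y => R (-x) (-y)) (-x) (-y) c := by
  have e : ∀ x y, G.neg.f (-x) (-y) = G.f x y := fun x y => by simp [MongeCost.neg]
  induction h with
  | one h => rw [← e]; exact .one (by simpa using h)
  | cons h _ ih => rw [← e]; exact .cons (by simpa using h) ih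

lemma Chain.flip (h : G.Chain R x y c) : G.flip.Chain (fun x y => R y x) y x c := by
  induction h with
  | one h => exact Chain.one (G := G.flip) h
  | cons h _ ih =>
    rw [add_comm]
    exact ih.append (Chain.one (G := G.flip) h)

lemma Chain.le (h : G.Chain (· ≤ ·) x y c) : x ≤ y := by
  induction h with
  | one h => exact h
  | cons h _ ih => exact h.trans ih

lemma Chain.ge (h : G.Chain (· ≥ ·) x y c) : y ≤ x := by
  induction h with
  | one h => exact h
  | cons h _ ih => exact ih.trans h

/-- Local minima may be removed. -/
lemma f_le_of_le (h : y ≤ x) (h' : y ≤ z) : G.f x z ≤ G.f x y + G.f y z := by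
  have := G.monge y x z y h h'
  linarith [G.diag y]

/-- Local maxima may be removed. -/
lemma f_le_of_ge (h : x ≤ y) (h' : z ≤ y) : G.f x z ≤ G.f x y + G.f y z := by
  have := G.monge x y y z h h'
  linarith [G.diag y]

lemma Chain.shortcut_le (h : G.Chain (· ≤ ·) y z c) (hyx : y ≤ x) (hxz : x ≤ z) :
    ∃ c' ≤ G.f x y + c, G.Chain (· ≤ ·) x z c' := by
  induction h with
  | one h => exact ⟨_, f_le_of_le hyx h, .one hxz⟩
  | @cons y y₁ z c h hc ih =>
    have h1 := f_le_of_le (G := G) hyx h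
    rcases le_total y₁ x with h2 | h2
    · obtain ⟨c', hc', h⟩ := ih h2 hxz
      exact ⟨c', by linarith, h⟩
    · exact ⟨_, by linarith, .cons h2 hc⟩

lemma Chain.shortcut_ge (h : G.Chain (· ≥ ·) y z c) (hxz : x ≤ z) :
    ∃ c' ≤ G.f x y + c, G.Chain (· ≤ ·) x z c' := by
  induction h with
  | one h => exact ⟨_, f_le_of_ge (hxz.trans h) h, .one hxz⟩
  | @cons y y₁ z c h hc ih =>
    have h1 := f_le_of_ge (G := G) (hxz.trans (hc.ge.trans h)) h
    obtain ⟨c', hc', h⟩ := ih hxz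
    exact ⟨c', by linarith, h⟩

lemma Chain.neg_of_ge (h : G.Chain (· ≥ ·) x y c) : G.neg.Chain (· ≤ ·) (-x) (-y) c :=
  h.neg.imp fun _ _ h => neg_le_neg_iff.1 h

lemma Chain.neg_of_le (h : G.Chain (· ≤ ·) x y c) : G.neg.Chain (· ≥ ·) (-x) (-y) c :=
  h.neg.imp fun _ _ h => neg_le_neg_iff.1 h

lemma neg_neg_eq : G.neg.neg = G := by
  cases G
  simp [MongeCost.neg]

lemma Chain.of_neg_le (h : G.neg.Chain (· ≤ ·) (-x) (-y) c) : G.Chain (· ≥ ·) x y c := by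
  simpa [neg_neg_eq] using h.neg_of_le

lemma Chain.mono_or (h : G.Chain (fun _ _ => True) x z c) :
    (x ≤ z → ∃ c' ≤ c, G.Chain (· ≤ ·) x z c') ∧ (z ≤ x → ∃ c' ≤ c, G.Chain (· ≥ ·) x z c') := by
  induction h with
  | one h => exact ⟨fun h => ⟨_, le_rfl, .one h⟩, fun h => ⟨_, le_rfl, .one h⟩⟩
  | @cons x y z c h hc ih =>
    have e : G.neg.f (-x) (-y) = G.f x y := by simp [MongeCost.neg]
    constructor <;> intro hxz
    · rcases le_total y z with h1 | h1
      · obtain ⟨c', hc', h2⟩ := ih.1 h1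
        rcases le_total x y with h3 | h3
        · exact ⟨_, by linarith, .cons h3 h2⟩
        · obtain ⟨c'', h4, h5⟩ := h2.shortcut_le h3 hxz
          exact ⟨c'', by linarith, h5⟩
      · obtain ⟨c', hc', h2⟩ := ih.2 h1
        obtain ⟨c'', h4, h5⟩ := h2.shortcut_ge hxz
        exact ⟨c'', by linarith, h5⟩
    · rcases le_total z y with h1 | h1
      · obtain ⟨c', hc', h2⟩ := ih.2 h1
        rcases le_total y x with h3 | h3
        · exact ⟨_, by linarith, .cons h3 h2⟩
        · obtain ⟨c'', h4, h5⟩ := h2.neg_of_ge.shortcut_le (neg_le_neg h3) (neg_le_neg hxz)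
          exact ⟨c'', by linarith, h5.of_neg_le⟩
      · obtain ⟨c', hc', h2⟩ := ih.1 h1
        obtain ⟨c'', h4, h5⟩ := h2.neg_of_le.shortcut_ge (neg_le_neg hxz)
        exact ⟨c'', by linarith, h5.of_neg_le⟩

lemma Chain.nonneg (h : G.Chain (fun _ _ => True) x x c) : 0 ≤ c := by
  obtain ⟨c', hc', h⟩ := h.mono_or.1 le_rfl
  refine le_trans ?_ hc'
  have key : ∀ {x z c}, G.Chain (· ≤ ·) x z c → z ≤ x → 0 ≤ c := fun {x z c} h => by
    induction h with
    | one h => intro h'; rw [le_antisymm h h']; exact G.diag _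
    | @cons x y z c h hc ih =>
      intro h'
      have : x = y := le_antisymm h (hc.le.trans h')
      subst this
      linarith [ih h', G.diag x]
  exact key h le_rfl

variable (G)

/-- The infimal cost of chains joining two points. -/
def potential (x y : ℝ) : ℝ := sInf {c | G.Chain (fun _ _ => True) x y c}

variable {G}

lemma potential_le_of_chain (h : G.Chain R x y c) : G.potential x y ≤ c :=
  csInf_le ⟨-G.f y x, fun e he => by
    have := (he.append (.one (y := x) trivial)).nonneg
    linarith⟩ (h.imp fun _ _ _ => trivial)

variable (G)

lemma exists_chain (x y : ℝ) {ε : ℝ} (hε : 0 < ε) :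
    ∃ c < G.potential x y + ε, G.Chain (fun _ _ => True) x y c := by
  obtain ⟨c, h, hc⟩ := exists_lt_of_csInf_lt (s := {c | G.Chain (fun _ _ => True) x y c})
    ⟨_, .one trivial⟩ (lt_add_of_pos_right (G.potential x y) hε)
  exact ⟨c, hc, h⟩

lemma exists_chain_le (hxy : x ≤ y) {ε : ℝ} (hε : 0 < ε) :
    ∃ c < G.potential x y + ε, G.Chain (· ≤ ·) x y c := by
  obtain ⟨c, hc, h⟩ := G.exists_chain x y hε
  obtain ⟨c', hc', h'⟩ := h.mono_or.1 hxy
  exact ⟨c', hc'.trans_lt hc, h'⟩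

lemma potential_le (x y : ℝ) : G.potential x y ≤ G.f x y :=
  potential_le_of_chain (.one (R := fun _ _ => True) trivial)

lemma potential_tri (x y z : ℝ) : G.potential x z ≤ G.potential x y + G.potential y z := by
  refine le_of_forall_pos_lt_add fun ε hε => ?_
  obtain ⟨c, hc, h⟩ := G.exists_chain x y (half_pos hε)
  obtain ⟨e, he, h'⟩ := G.exists_chain y z (half_pos hε)
  linarith [potential_le_of_chain (h.append h')]

lemma potential_self_nonneg (x : ℝ) : 0 ≤ G.potential x x := by
  refine le_of_forall_pos_lt_add fun ε hε => ?_
  obtain ⟨c, hc, h⟩ := G.exists_chain x x hε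
  linarith [h.nonneg]

lemma potential_self (h : G.f x x = 0) : G.potential x x = 0 :=
  le_antisymm ((G.potential_le x x).trans h.le) (G.potential_self_nonneg x)

lemma potential_neg (x y : ℝ) : G.neg.potential (-x) (-y) = G.potential x y := by
  unfold potential
  congr 1
  ext c
  exact ⟨fun h => by simpa [neg_neg_eq] using h.neg, fun h => h.neg⟩

lemma potential_flip (x y : ℝ) : G.flip.potential x y = G.potential y x := by
  unfold potential
  congr 1
  ext c
  exact ⟨fun h => h.flip, fun h => h.flip⟩

lemma potential_lip_left (x x' y : ℝ) : G.potential x y ≤ G.potential x' y + |x - x'| := by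
  refine le_of_forall_pos_lt_add fun ε hε => ?_
  obtain ⟨c, hc, h⟩ := G.exists_chain x' y hε
  suffices G.potential x y ≤ c + |x - x'| by linarith
  cases h with
  | one _ => exact (G.potential_le x y).trans (G.lip_left x x' y)
  | @cons _ w _ e _ h =>
    have := potential_le_of_chain (h.cons (x := x) trivial)
    linarith [G.lip_left x x' w]

lemma potential_lip_right (x y y' : ℝ) : G.potential x y ≤ G.potential x y' + |y - y'| := by
  rw [← G.potential_flip, ← G.potential_flip]
  exact G.flip.potential_lip_left y y' x

lemma continuous_f : Continuous fun z : ℝ × ℝ => G.f z.1 z.2 := by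
  refine LipschitzWith.continuous (K := 2) (LipschitzWith.of_le_add_mul _ fun z w => ?_)
  have h1 := G.lip_left z.1 w.1 z.2
  have h2 := G.lip_right w.1 z.2 w.2
  have h3 : |z.1 - w.1| ≤ dist z w := by rw [← Real.dist_eq]; exact le_max_left _ _
  have h4 : |z.2 - w.2| ≤ dist z w := by rw [← Real.dist_eq]; exact le_max_right _ _
  push_cast
  linarith

/-- The identity minimises the total cost among permutations. -/
lemma sum_diag_le {ι : Type*} [Fintype ι] [DecidableEq ι] (ξ : ι → ℝ) (π : Equiv.Perm ι) :
    ∑ i, G.f (ξ i) (ξ i) ≤ ∑ i, G.f (ξ i) (ξ (π i)) := by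
  induction hn : π.support.card using Nat.strong_induction_on generalizing π with
  | _ n ih =>
    rcases π.support.eq_empty_or_nonempty with h0 | hne
    · rw [Equiv.Perm.support_eq_empty_iff.1 h0]
      simp
    obtain ⟨i, hi, hmax⟩ := π.support.exists_max_image ξ hne
    have hi' : π i ≠ i := Equiv.Perm.mem_support.1 hi
    refine (ih _ ?_ (Equiv.swap i (π i) * π) rfl).trans ?_
    · rw [← hn]
      exact Equiv.Perm.card_support_swap_mul hi'
    obtain ⟨k, hk⟩ : ∃ k, π k = i := π.surjective i
    have hki : k ≠ i := by rintro rfl; exact hi' hk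
    have hks : k ∈ π.support := Equiv.Perm.mem_support.2 (by rw [hk]; exact hki.symm)
    have hm := G.monge (ξ k) (ξ i) (ξ i) (ξ (π i)) (hmax k hks)
      (hmax _ (Equiv.Perm.apply_mem_support.2 hi))
    have split : ∀ g : ι → ℝ, ∑ j, g j = g i + (g k + ∑ j ∈ (Finset.univ.erase i).erase k, g j) :=
      fun g => by
        rw [Finset.add_sum_erase _ _ (Finset.mem_erase.2 ⟨hki, Finset.mem_univ k⟩),
          Finset.add_sum_erase _ _ (Finset.mem_univ i)]
    rw [split, split fun j => G.f (ξ j) (ξ (π j))]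
    have hrest : ∑ j ∈ (Finset.univ.erase i).erase k, G.f (ξ j) (ξ ((Equiv.swap i (π i) * π) j)) =
        ∑ j ∈ (Finset.univ.erase i).erase k, G.f (ξ j) (ξ (π j)) := by
      refine Finset.sum_congr rfl fun j hj => ?_
      simp only [Finset.mem_erase, Finset.mem_univ, and_true] at hj
      rw [Equiv.Perm.mul_apply, Equiv.swap_apply_of_ne_of_ne]
      · rw [← hk]; exact fun h => hj.1 (π.injective h)
      · exact fun h => hj.2 (π.injective h)
    rw [hrest]
    simp only [Equiv.Perm.mul_apply, hk, Equiv.swap_apply_left, Equiv.swap_apply_right]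
    linarith

end MongeCost

lemma exists_int_sum (g : ℤ → ℝ) : ∃ T : ℤ → ℝ, ∀ n, T (n + 1) - T n = g n := by
  refine ⟨fun n => ∑ i ∈ Finset.range n.toNat, g i - ∑ i ∈ Finset.range (-n).toNat, g (-i - 1),
    fun n => ?_⟩
  beta_reduce
  rcases le_or_gt 0 n with h | h
  · lift n to ℕ using h
    rw [show ((n : ℤ) + 1).toNat = n + 1 by omega, show (-((n : ℤ) + 1)).toNat = 0 by omega,
      show (n : ℤ).toNat = n by omega, show (-(n : ℤ)).toNat = 0 by omega, Finset.sum_range_succ]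
    simp
  · obtain ⟨k, rfl⟩ : ∃ k : ℕ, n = -(k : ℤ) - 1 := ⟨(-n - 1).toNat, by omega⟩
    rw [show (-(k : ℤ) - 1 + 1).toNat = 0 by omega, show (-(-(k : ℤ) - 1 + 1)).toNat = k by omega,
      show (-(k : ℤ) - 1).toNat = 0 by omega, show (-(-(k : ℤ) - 1)).toNat = k + 1 by omega,
      Finset.sum_range_succ]
    simp

lemma ZMod.sum_eq_range {n : ℕ} [NeZero n] (g : ZMod n → ℝ) :
    ∑ i, g i = ∑ i ∈ Finset.range n, g i := by
  obtain ⟨k, rfl⟩ := Nat.exists_eq_succ_of_ne_zero (NeZero.ne n)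
  rw [Finset.sum_range]
  refine Fintype.sum_congr _ _ fun i => ?_
  congr 1
  exact (Fin.cast_val_eq_self i).symm

namespace MongeCost

variable (G : MongeCost)

/-- `(a, b)` is a complementary interval of the zero set of the diagonal cost. -/
def IsGap (a b : ℝ) : Prop :=
  a < b ∧ G.f a a = 0 ∧ G.f b b = 0 ∧ ∀ x ∈ Ioo a b, 0 < G.f x x

variable {G}

lemma Chain.exists_seq {x y c : ℝ} (h : G.Chain (· ≤ ·) x y c) (hy : G.f y y = 0) :
    ∃ (n : ℕ) (u : ℕ → ℝ), u 0 = x ∧ (∀ i ≥ n, u i = y) ∧ Monotone u ∧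
      ∀ M ≥ n, ∑ i ∈ Finset.range M, G.f (u i) (u (i + 1)) = c := by
  induction h with
  | @one x y h =>
    refine ⟨1, fun i => if i = 0 then x else y, rfl, fun i hi => if_neg (by omega),
      monotone_nat_of_le_succ fun i => ?_, fun M hM => ?_⟩
    · rcases i with _ | i <;> simp [h]
    · obtain ⟨M, rfl⟩ : ∃ k, M = k + 1 := ⟨M - 1, by omega⟩
      rw [Finset.sum_range_succ']
      simp [hy]
  | @cons x z y c h hc ih =>
    obtain ⟨n, u, h0, h1, h2, h3⟩ := ih hy
    refine ⟨n + 1, fun i => if i = 0 then x else u (i - 1), rfl, fun i hi => ?_,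
      monotone_nat_of_le_succ fun i => ?_, fun M hM => ?_⟩
    · simp only [show i ≠ 0 by omega, if_false]; exact h1 _ (by omega)
    · rcases i with _ | i
      · simpa [h0] using h
      · simpa using h2 (Nat.le_succ i)
    · obtain ⟨M, rfl⟩ : ∃ k, M = k + 1 := ⟨M - 1, by omega⟩
      rw [Finset.sum_range_succ', add_comm]
      simp [h0, h3 M (by omega)]

/-- Nearly optimal heteroclinic paths can be made to cross a given level at a given index. -/
lemma exists_positioned {a b x : ℝ} (ha : G.f a a = 0) (hb : G.f b b = 0) (hax : a < x)
    (hxb : x < b) {ε : ℝ} (hε : 0 < ε) : ∃ n₀, ∀ N ≥ n₀, ∃ u : ℕ → ℝ, u 0 = a ∧ u (2 * N) = b ∧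
      (∀ i < N, u i ∈ Icc a x) ∧ (∀ i ≥ N, u i ∈ Icc x b) ∧
      ∑ i ∈ Finset.range (2 * N), G.f (u i) (u (i + 1)) ≤ G.potential a b + ε := by
  obtain ⟨c, hc, h⟩ := G.exists_chain_le (hax.trans hxb).le hε
  obtain ⟨n, u, h0, h1, h2, h3⟩ := h.exists_seq hb
  have hex : ∃ p, x ≤ u p := ⟨n, by rw [h1 n le_rfl]; exact hxb.le⟩
  classical
  obtain ⟨p, hp⟩ : ∃ p, p = Nat.find hex := ⟨_, rfl⟩
  have hpx : x ≤ u p := hp ▸ Nat.find_spec hex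
  have hpm : ∀ i < p, u i < x := fun i hi => not_le.1 (Nat.find_min hex (hp ▸ hi))
  have hpn : p ≤ n := by rw [hp]; exact Nat.find_min' hex (by rw [h1 n le_rfl]; exact hxb.le)
  have hp0 : p ≠ 0 := by rintro rfl; linarith
  have hua : ∀ i, a ≤ u i := fun i => h0 ▸ h2 (Nat.zero_le i)
  have hub : ∀ i, u i ≤ b := fun i => (h2 (le_max_left i n)).trans_eq (h1 _ (le_max_right i n))
  refine ⟨n, fun N hN => ⟨fun i => u (i + p - N), ?_, h1 _ (by omega), fun i hi => ⟨hua _,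
    (hpm _ (by omega)).le⟩, fun i hi => ⟨hpx.trans (h2 (by omega)), hub _⟩, ?_⟩⟩
  · simp only [show 0 + p - N = 0 by omega, h0]
  · rw [show 2 * N = (N - p) + (N + p) by omega, Finset.sum_range_add, Finset.sum_eq_zero, zero_add]
    · rw [← h3 (N + p) (by omega)] at hc
      refine le_trans (le_of_eq (Finset.sum_congr rfl fun i _ => ?_)) hc.le
      beta_reduce
      rw [show N - p + i + p - N = i by omega, show N - p + i + 1 + p - N = i + 1 by omega]
    · intro i hi
      rw [Finset.mem_range] at hi
      beta_reduce
      rw [show i + p - N = 0 by omega, show i + 1 + p - N = 0 by omega, h0, ha]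

lemma potential_le_sub {η T : ℤ → ℝ} (hT : ∀ n, T (n + 1) - T n = G.f (η n) (η (n + 1))) {s t : ℤ}
    (hst : s < t) : G.potential (η s) (η t) ≤ T t - T s := by
  induction t, (Int.add_one_le_iff.2 hst) using Int.leInduction with
  | base => rw [hT]; exact G.potential_le _ _
  | succ t ht ih =>
    have := G.potential_tri (η s) (η t) (η (t + 1))
    linarith [ih (by omega), hT t, G.potential_le (η t) (η (t + 1))]

lemma exists_minimizer (G : MongeCost) {n : ℕ} [NeZero n] (hn : 2 ≤ n) {lo hi : ZMod n → ℝ}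
    (h : lo ≤ hi) : ∃ ξ ∈ Icc lo hi, (∀ ζ ∈ Icc lo hi, ∑ i, G.f (ξ i) (ξ (i + 1)) ≤
      ∑ i, G.f (ζ i) (ζ (i + 1))) ∧ ∀ i, ∀ w ∈ Icc (lo i) (hi i),
      G.f (ξ (i - 1)) (ξ i) + G.f (ξ i) (ξ (i + 1)) ≤
        G.f (ξ (i - 1)) w + G.f w (ξ (i + 1)) := by
  have hc : Continuous fun ζ : ZMod n → ℝ => ∑ i, G.f (ζ i) (ζ (i + 1)) :=
    continuous_finsetSum _ fun i _ =>
      G.continuous_f.comp (f := fun ζ : ZMod n → ℝ => (ζ i, ζ (i + 1))) (by fun_prop)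
  obtain ⟨ξ, hξ, hmin⟩ := isCompact_Icc.exists_isMinOn (nonempty_Icc.2 h) hc.continuousOn
  rw [isMinOn_iff] at hmin
  refine ⟨ξ, hξ, hmin, fun i w hw => ?_⟩
  have h1 : i - 1 ≠ i := by
    have : (1 : ZMod n) ≠ 0 := by
      have : Fact (1 < n) := ⟨hn⟩
      exact one_ne_zero
    simpa using this
  have h2 : i + 1 ≠ i := fun h => h1 (by rw [sub_eq_iff_eq_add]; exact h.symm)
  have key := hmin (Function.update ξ i w) ⟨fun j => ?_, fun j => ?_⟩
  · have split : ∀ g : ZMod n → ℝ, ∑ j, g j =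
        g i + (g (i - 1) + ∑ j ∈ (Finset.univ.erase i).erase (i - 1), g j) := fun g => by
      rw [Finset.add_sum_erase _ _ (Finset.mem_erase.2 ⟨h1, Finset.mem_univ _⟩),
        Finset.add_sum_erase _ _ (Finset.mem_univ i)]
    rw [split, split fun j => G.f (Function.update ξ i w j) (Function.update ξ i w (j + 1))] at key
    have hrest : ∑ j ∈ (Finset.univ.erase i).erase (i - 1),
        G.f (Function.update ξ i w j) (Function.update ξ i w (j + 1)) =
        ∑ j ∈ (Finset.univ.erase i).erase (i - 1), G.f (ξ j) (ξ (j + 1)) := by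
      refine Finset.sum_congr rfl fun j hj => ?_
      simp only [Finset.mem_erase, Finset.mem_univ, and_true] at hj
      rw [Function.update_of_ne hj.2, Function.update_of_ne]
      exact fun h => hj.1 (eq_sub_of_add_eq h)
    rw [hrest] at key
    simp only [sub_add_cancel, Function.update_self, Function.update_of_ne h1,
      Function.update_of_ne h2] at key
    linarith
  · rcases eq_or_ne j i with rfl | hj
    · simpa using hw.1
    · simpa [hj] using hξ.1 j
  · rcases eq_or_ne j i with rfl | hj
    · simpa using hw.2
    · simpa [hj] using hξ.2 j

lemma exists_diag_small {K : Set ℝ} (hK : IsCompact K) {p δ : ℝ} (hδ : 0 < δ)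
    (hp : ∀ w ∈ K, w ≠ p → 0 < G.f w w) : ∃ η > 0, ∀ w ∈ K, G.f w w < η → |w - p| < δ := by
  have hc : Continuous fun w => G.f w w := G.continuous_f.comp (continuous_id.prodMk continuous_id)
  have hK' : IsCompact (K ∩ {w | δ ≤ |w - p|}) :=
    hK.inter_right (isClosed_le continuous_const (by fun_prop))
  rcases (K ∩ {w | δ ≤ |w - p|}).eq_empty_or_nonempty with h | h
  · refine ⟨1, one_pos, fun w hw _ => ?_⟩
    by_contra hlt
    exact h.subset ⟨hw, not_lt.1 hlt⟩
  · obtain ⟨z, hz, hmin⟩ := hK'.exists_isMinOn h hc.continuousOn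
    refine ⟨_, hp z hz.1 ?_, fun w hw hlt => ?_⟩
    · rintro rfl
      have h2 : δ ≤ |z - z| := hz.2
      rw [sub_self, abs_zero] at h2
      linarith
    · by_contra h2
      exact absurd (isMinOn_iff.1 hmin w ⟨hw, not_lt.1 h2⟩) (not_le.2 hlt)

/-- Vertices may be truncated to an interval whose ends have zero diagonal cost. -/
lemma truncate {a b p q : ℝ} (hab : a ≤ b) (ha : G.f a a = 0) (hb : G.f b b = 0) (hp : p ∈ Icc a b)
    (hq : q ∈ Icc a b) (w : ℝ) :
    G.f p (max a (min w b)) + G.f (max a (min w b)) q ≤ G.f p w + G.f w q := by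
  rcases lt_or_ge w a with h | h
  · rw [min_eq_left (h.le.trans hab), max_eq_left h.le]
    have h1 := G.monge a p a w hp.1 h.le
    have h2 := G.monge w a q a h.le hq.1
    have h3 := f_le_of_le (G := G) h.le h.le
    linarith
  rcases lt_or_ge b w with h' | h'
  · rw [min_eq_right h'.le, max_eq_right hab]
    have h1 := G.monge p b w b hp.2 h'.le
    have h2 := G.monge b w b q h'.le hq.2
    have h3 := f_le_of_ge (G := G) h'.le h'.le
    linarith
  · rw [min_eq_left h', max_eq_right h]

end MongeCost

namespace MongeCost

variable {G : MongeCost}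

/-- Closed chains of small cost passing through the four quarters of a gap. -/
lemma exists_loop {a b x y : ℝ} (ha : G.f a a = 0) (hb : G.f b b = 0) (hx : x ∈ Ioo a b)
    (hy : y ∈ Ioo a b) {ε : ℝ} (hε : 0 < ε) : ∃ n₀, ∀ N ≥ n₀, ∃ z : ℕ → ℝ, z (4 * N) = z 0 ∧
      (∀ i < N, z i ∈ Icc a x) ∧ (∀ i, N ≤ i → i < 2 * N → z i ∈ Icc x b) ∧
      (∀ i, 2 * N ≤ i → i < 3 * N → z i ∈ Icc y b) ∧
      (∀ i, 3 * N ≤ i → i < 4 * N → z i ∈ Icc a y) ∧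
      ∑ i ∈ Finset.range (4 * N), G.f (z i) (z (i + 1)) ≤
        G.potential a b + G.potential b a + 2 * ε := by
  obtain ⟨n₁, h1⟩ := exists_positioned ha hb hx.1 hx.2 hε
  have hf : ∀ x y, G.neg.f x y = G.f (-x) (-y) := fun _ _ => rfl
  obtain ⟨n₂, h2⟩ := exists_positioned (G := G.neg) (a := -b) (b := -a) (x := -y)
    (by rw [hf, neg_neg, hb]) (by rw [hf, neg_neg, ha]) (neg_lt_neg hy.2) (neg_lt_neg hy.1) hε
  rw [potential_neg] at h2
  simp only [hf] at h2
  refine ⟨max n₁ n₂, fun N hN => ?_⟩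
  obtain ⟨u, u0, u1, u2, u3, u4⟩ := h1 N (le_of_max_le_left hN)
  obtain ⟨v, v0, v1, v2, v3, v4⟩ := h2 N (le_of_max_le_right hN)
  obtain ⟨z, hz⟩ : ∃ z : ℕ → ℝ, ∀ i, z i = if i < 2 * N then u i else -v (i - 2 * N) :=
    ⟨_, fun _ => rfl⟩
  have hzu : ∀ i ≤ 2 * N, z i = u i := fun i hi => by
    rcases hi.eq_or_lt with rfl | h
    · rw [hz, if_neg (lt_irrefl _), Nat.sub_self, v0, u1, neg_neg]
    · rw [hz, if_pos h]
  have hzv : ∀ i, z (2 * N + i) = -v i := fun i => by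
    rw [hz, if_neg (by omega), Nat.add_sub_cancel_left]
  refine ⟨z, ?_, fun i hi => ?_, fun i hi hi' => ?_, fun i hi hi' => ?_, fun i hi hi' => ?_, ?_⟩
  · rw [show 4 * N = 2 * N + 2 * N by omega, hzv, v1, hzu 0 (by omega), u0, neg_neg]
  · rw [hzu i (by omega)]; exact u2 i hi
  · rw [hzu i hi'.le]; exact u3 i hi
  · obtain ⟨j, rfl⟩ := Nat.exists_eq_add_of_le hi
    have := v2 j (by omega)
    rw [hzv]
    exact ⟨by linarith [this.2], by linarith [this.1]⟩
  · obtain ⟨j, rfl⟩ := Nat.exists_eq_add_of_le (show 2 * N ≤ i by omega)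
    have := v3 j (by omega)
    rw [hzv]
    exact ⟨by linarith [this.2], by linarith [this.1]⟩
  · rw [show 4 * N = 2 * N + 2 * N by omega, Finset.sum_range_add]
    have e1 : ∑ i ∈ Finset.range (2 * N), G.f (z i) (z (i + 1)) =
        ∑ i ∈ Finset.range (2 * N), G.f (u i) (u (i + 1)) := Finset.sum_congr rfl fun i hi => by
      rw [Finset.mem_range] at hi
      rw [hzu i hi.le, hzu (i + 1) hi]
    have e2 : ∑ i ∈ Finset.range (2 * N), G.f (z (2 * N + i)) (z (2 * N + i + 1)) =
        ∑ i ∈ Finset.range (2 * N), G.f (-v i) (-v (i + 1)) := Finset.sum_congr rfl fun i _ => by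
      rw [add_assoc, hzv, hzv]
    rw [e1, e2]
    linarith

/-- If neither heteroclinic potential is additive through a gap then there is a periodic
configuration of local minimisers oscillating across the gap. -/
lemma exists_oscillating {a b x y : ℝ} (hg : G.IsGap a b) (hx : x ∈ Ioo a b) (hy : y ∈ Ioo a b)
    (hup : G.potential a b < G.potential a x + G.potential x b)
    (hdn : G.potential b a < G.potential b y + G.potential y a) :
    ∃ n₀ : ℕ, ∀ N ≥ n₀, ∃ η : ℤ → ℝ, (∀ i, η (i + 4 * N) = η i) ∧
      (∀ i, ∀ᶠ w in 𝓝 (η i), G.f (η (i - 1)) (η i) + G.f (η i) (η (i + 1)) ≤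
        G.f (η (i - 1)) w + G.f w (η (i + 1))) ∧ η 0 < η N := by
  obtain ⟨hab, ha, hb, hpos⟩ := hg
  obtain ⟨D, hD, hDx, hDy⟩ : ∃ D > 0, G.potential a b + D ≤ G.potential a x + G.potential x b ∧
      G.potential b a + D ≤ G.potential b y + G.potential y a := by
    obtain ⟨D, hD, h⟩ := exists_between (lt_min (sub_pos.2 hup) (sub_pos.2 hdn))
    obtain ⟨h1, h2⟩ := lt_min_iff.1 h
    exact ⟨D, hD, by linarith, by linarith⟩
  have hδ : 0 < D / 16 := by positivity
  have pos_a : ∀ c ∈ Ioo a b, ∀ w ∈ Icc a c, w ≠ a → 0 < G.f w w := fun c hc w hw hne =>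
    hpos w ⟨lt_of_le_of_ne hw.1 hne.symm, hw.2.trans_lt hc.2⟩
  have pos_b : ∀ c ∈ Ioo a b, ∀ w ∈ Icc c b, w ≠ b → 0 < G.f w w := fun c hc w hw hne =>
    hpos w ⟨hc.1.trans_le hw.1, lt_of_le_of_ne hw.2 hne⟩
  obtain ⟨η₁, hη₁, near₁⟩ := exists_diag_small isCompact_Icc hδ (pos_a x hx)
  obtain ⟨η₂, hη₂, near₂⟩ := exists_diag_small isCompact_Icc hδ (pos_b x hx)
  obtain ⟨η₃, hη₃, near₃⟩ := exists_diag_small isCompact_Icc hδ (pos_b y hy)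
  obtain ⟨η₄, hη₄, near₄⟩ := exists_diag_small isCompact_Icc hδ (pos_a y hy)
  obtain ⟨κ, hκ, k1, k2, k3, k4⟩ : ∃ κ > 0, κ ≤ η₁ ∧ κ ≤ η₂ ∧ κ ≤ η₃ ∧ κ ≤ η₄ :=
    ⟨min (min η₁ η₂) (min η₃ η₄), by positivity, (min_le_left _ _).trans (min_le_left _ _),
      (min_le_left _ _).trans (min_le_right _ _), (min_le_right _ _).trans (min_le_left _ _),
      (min_le_right _ _).trans (min_le_right _ _)⟩
  obtain ⟨n₁, hloop⟩ := exists_loop ha hb hx hy (ε := D / 8) (by positivity)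
  obtain ⟨B, hB⟩ : ∃ B, B = G.potential a b + G.potential b a + 2 * (D / 8) := ⟨_, rfl⟩
  rw [← hB] at hloop
  obtain ⟨n₂, hn₂⟩ := exists_nat_gt (B / κ)
  rw [div_lt_iff₀ hκ] at hn₂
  refine ⟨max (max n₁ n₂) 1, fun N hN => ?_⟩
  have hN1 : 1 ≤ N := le_of_max_le_right hN
  have hBN : B < N * κ := hn₂.trans_le (mul_le_mul_of_nonneg_right
    (by exact_mod_cast le_of_max_le_right (le_of_max_le_left hN)) hκ.le)
  obtain ⟨z, z0, z1, z2, z3, z4, zsum⟩ := hloop N (le_of_max_le_left (le_of_max_le_left hN))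
  have : NeZero (4 * N) := ⟨by omega⟩
  have hval : ∀ v < 4 * N, ((v : ℕ) : ZMod (4 * N)).val = v := fun v hv =>
    ZMod.val_natCast_of_lt hv
  obtain ⟨lo, hlo⟩ : ∃ lo : ℕ → ℝ, ∀ i, lo i = if i < N then a else if i < 2 * N then x else
    if i < 3 * N then y else a := ⟨_, fun _ => rfl⟩
  obtain ⟨hi, hhi⟩ : ∃ hi : ℕ → ℝ, ∀ i, hi i = if i < N then x else if i < 3 * N then b else y :=
    ⟨_, fun _ => rfl⟩
  have zbox : ∀ i < 4 * N, lo i ≤ z i ∧ z i ≤ hi i := fun i hi => by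
    rw [hlo, hhi]
    rcases lt_or_ge i N with h1 | h1
    · rw [if_pos h1, if_pos h1]
      exact z1 i h1
    rw [if_neg h1.not_gt, if_neg h1.not_gt]
    rcases lt_or_ge i (2 * N) with h2 | h2
    · rw [if_pos h2, if_pos (by omega)]
      exact z2 i h1 h2
    rw [if_neg h2.not_gt]
    rcases lt_or_ge i (3 * N) with h3 | h3
    · rw [if_pos h3, if_pos h3]
      exact z3 i h2 h3
    · rw [if_neg h3.not_gt, if_neg h3.not_gt]
      exact z4 i h3 hi
  have hvlt : ∀ i : ZMod (4 * N), i.val < 4 * N := fun i => ZMod.val_lt i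
  obtain ⟨ξ, ξbox, ξmin, ξloc⟩ := G.exists_minimizer (n := 4 * N) (by omega)
    (lo := fun i => lo i.val) (hi := fun i => hi i.val)
    fun i => (zbox _ (hvlt i)).1.trans (zbox _ (hvlt i)).2
  have hξB : ∑ i, G.f (ξ i) (ξ (i + 1)) ≤ B := by
    refine (ξmin (fun i => z i.val) ⟨fun i => (zbox _ (hvlt i)).1,
      fun i => (zbox _ (hvlt i)).2⟩).trans (le_trans (le_of_eq ?_) zsum)
    rw [ZMod.sum_eq_range]
    refine Finset.sum_congr rfl fun i hi => ?_
    rw [Finset.mem_range] at hi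
    rw [hval i hi]
    congr 1
    rcases (Nat.succ_le_of_lt hi).eq_or_lt with h | h
    · rw [← Nat.cast_succ, h, ZMod.natCast_self, ZMod.val_zero, ← z0]
      exact (congrArg z h).symm
    · rw [← Nat.cast_succ, hval _ h]
  obtain ⟨η, hη⟩ : ∃ η : ℤ → ℝ, ∀ i, η i = ξ i := ⟨fun i => ξ i, fun _ => rfl⟩
  have ηval : ∀ i : ℤ, ∃ v : ℕ, v < 4 * N ∧ ∀ s, η (i + s) = η (v + s) := fun i =>
    ⟨(i : ZMod (4 * N)).val, hvlt _, fun s => by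
      rw [hη, hη, Int.cast_add, Int.cast_add, Int.cast_natCast, ZMod.natCast_zmod_val]⟩
  have ηper : ∀ i, η (i + 4 * N) = η i := fun i => by
    rw [hη, hη]
    congr 1
    have : ((4 * N : ℕ) : ZMod (4 * N)) = 0 := ZMod.natCast_self _
    push_cast at this ⊢
    rw [this, add_zero]
  have ηbox : ∀ v : ℕ, v < 4 * N → lo v ≤ η v ∧ η v ≤ hi v := fun v hv => by
    have h1 := ξbox.1 v
    have h2 := ξbox.2 v
    simp only [hval v hv] at h1 h2
    rw [hη, Int.cast_natCast]
    exact ⟨h1, h2⟩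
  have ηloc : ∀ v : ℕ, v < 4 * N → ∀ w ∈ Icc (lo v) (hi v), G.f (η (v - 1)) (η v) +
      G.f (η v) (η (v + 1)) ≤ G.f (η (v - 1)) w + G.f w (η (v + 1)) := fun v hv w hw => by
    have := ξloc v w (by rwa [hval v hv])
    simpa [hη] using this
  obtain ⟨T, hT⟩ := exists_int_sum fun n => G.f (η n) (η (n + 1))
  have Tsum : ∀ M : ℕ, T M - T 0 = ∑ i ∈ Finset.range M, G.f (ξ i) (ξ (i + 1)) := fun M => by
    induction M with
    | zero => simp
    | succ M ih =>
      rw [Finset.sum_range_succ, ← ih]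
      have := hT M
      simp only [hη, Int.cast_natCast, Int.cast_add, Int.cast_one] at this
      push_cast
      linarith
  have Tper : ∀ s : ℤ, T (s + 4 * N) - T s ≤ B := by
    have step : ∀ s, T (s + 1 + 4 * N) - T (s + 1) = T (s + 4 * N) - T s := fun s => by
      have h1 := hT s
      have h2 := hT (s + 4 * N)
      rw [add_right_comm, ηper, ηper] at h2
      linarith
    have base : T (0 + 4 * N) - T 0 ≤ B := by
      have := Tsum (4 * N)
      rw [← ZMod.sum_eq_range fun i => G.f (ξ i) (ξ (i + 1))] at this
      push_cast at this
      rw [zero_add, this]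
      exact hξB
    intro s
    induction s using Int.induction_on with
    | zero => exact base
    | succ i ih => rw [step]; exact ih
    | pred i ih =>
      rw [← step, sub_add_cancel]
      exact ih
  have hdiag : ∑ v ∈ Finset.range (4 * N), G.f (η v) (η v) ≤ B := by
    have := (G.sum_diag_le ξ (Equiv.addRight 1)).trans hξB
    rw [ZMod.sum_eq_range] at this
    simpa [hη] using this
  have near : ∀ c < 4, ∃ v, c * N ≤ v ∧ v < (c + 1) * N ∧ G.f (η v) (η v) < κ := fun c hc => by
    by_contra! hcon
    have h1 : ∑ v ∈ Finset.Ico (c * N) ((c + 1) * N), G.f (η v) (η v) ≤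
        ∑ v ∈ Finset.range (4 * N), G.f (η v) (η v) := by
      refine Finset.sum_le_sum_of_subset_of_nonneg (fun v hv => ?_) fun v _ _ => G.diag _
      rw [Finset.mem_Ico] at hv
      rw [Finset.mem_range]
      exact hv.2.trans_le (Nat.mul_le_mul_right N hc)
    have h2 : (Finset.Ico (c * N) ((c + 1) * N)).card • κ ≤
        ∑ v ∈ Finset.Ico (c * N) ((c + 1) * N), G.f (η v) (η v) :=
      Finset.card_nsmul_le_sum _ _ _ fun v hv => by
        rw [Finset.mem_Ico] at hv
        exact hcon v hv.1 hv.2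
    rw [Nat.card_Ico, ← Nat.sub_mul, Nat.add_sub_cancel_left, one_mul, nsmul_eq_mul] at h2
    linarith
  have box1 : ∀ v : ℕ, v < N → η v ∈ Icc a x := fun v hv => by
    have := ηbox v (by omega)
    rwa [hlo, hhi, if_pos hv, if_pos hv] at this
  have box2 : ∀ v : ℕ, N ≤ v → v < 2 * N → η v ∈ Icc x b := fun v hv hv' => by
    have := ηbox v (by omega)
    rwa [hlo, hhi, if_neg (by omega), if_pos hv', if_neg (by omega), if_pos (by omega)] at this
  have box3 : ∀ v : ℕ, 2 * N ≤ v → v < 3 * N → η v ∈ Icc y b := fun v hv hv' => by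
    have := ηbox v (by omega)
    rwa [hlo, hhi, if_neg (by omega), if_neg (by omega), if_pos hv', if_neg (by omega),
      if_pos hv'] at this
  have box4 : ∀ v : ℕ, 3 * N ≤ v → v < 4 * N → η v ∈ Icc a y := fun v hv hv' => by
    have := ηbox v (by omega)
    rwa [hlo, hhi, if_neg (by omega), if_neg (by omega), if_neg (by omega), if_neg (by omega),
      if_neg (by omega)] at this
  obtain ⟨t₁, t1, t1', d1⟩ := near 0 (by omega)
  obtain ⟨t₂, t2, t2', d2⟩ := near 1 (by omega)
  obtain ⟨t₃, t3, t3', d3⟩ := near 2 (by omega)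
  obtain ⟨t₄, t4, t4', d4⟩ := near 3 (by omega)
  replace d1 := near₁ _ (box1 t₁ (by omega)) (d1.trans_le k1)
  replace d2 := near₂ _ (box2 t₂ (by omega) (by omega)) (d2.trans_le k2)
  replace d3 := near₃ _ (box3 t₃ (by omega) (by omega)) (d3.trans_le k3)
  replace d4 := near₄ _ (box4 t₄ (by omega) (by omega)) (d4.trans_le k4)
  have ne_x : ∀ j : ℕ, j < 2 * N → η j ≠ x := fun j hj hjx => by
    have e1 := potential_le_sub hT (s := t₄ - 4 * N) (t := j) (by omega)
    have e2 := potential_le_sub hT (s := j) (t := t₃) (by omega)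
    have e3 := potential_le_sub hT (s := t₃) (t := t₄) (by omega)
    have e4 := Tper (t₄ - 4 * N)
    have e5 := ηper (t₄ - 4 * N)
    rw [sub_add_cancel] at e4 e5
    rw [← e5, hjx] at e1
    rw [hjx] at e2
    have f1 := G.potential_lip_left a (η t₄) x
    have f2 := G.potential_lip_right x b (η t₃)
    have f3 := G.potential_lip_left b (η t₃) a
    have f4 := G.potential_lip_right (η t₃) a (η t₄)
    rw [abs_sub_comm] at f1 f2 f3 f4
    linarith
  have ne_y : ∀ j : ℕ, 2 * N ≤ j → j < 4 * N → η j ≠ y := fun j hj hj' hjy => by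
    have e1 := potential_le_sub hT (s := t₂) (t := j) (by omega)
    have e2 := potential_le_sub hT (s := j) (t := t₁ + 4 * N) (by omega)
    have e3 := potential_le_sub hT (s := t₁ + 4 * N) (t := t₂ + 4 * N) (by omega)
    have e4 := Tper t₂
    rw [ηper, ηper] at e3
    rw [ηper, hjy] at e2
    rw [hjy] at e1
    have f1 := G.potential_lip_left b (η t₂) y
    have f2 := G.potential_lip_right y a (η t₁)
    have f3 := G.potential_lip_left a (η t₁) b
    have f4 := G.potential_lip_right (η t₁) b (η t₂)
    rw [abs_sub_comm] at f1 f2 f3 f4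
    linarith
  have box : ∀ i, η i ∈ Icc a b := fun i => by
    obtain ⟨v, hv, h⟩ := ηval i
    have h0 := h 0
    rw [add_zero, add_zero] at h0
    rw [h0]
    rcases lt_or_ge v N with h1 | h1
    · exact Icc_subset_Icc_right hx.2.le (box1 v h1)
    rcases lt_or_ge v (2 * N) with h2 | h2
    · exact Icc_subset_Icc_left hx.1.le (box2 v h1 h2)
    rcases lt_or_ge v (3 * N) with h3 | h3
    · exact Icc_subset_Icc_left hy.1.le (box3 v h2 h3)
    · exact Icc_subset_Icc_right hy.2.le (box4 v h3 hv)
  refine ⟨η, ηper, fun i => ?_, ?_⟩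
  · obtain ⟨v, hv, h⟩ := ηval i
    have h0 := h 0
    have h1 := h 1
    have h2 := h (-1)
    rw [add_zero, add_zero] at h0
    rw [← sub_eq_add_neg, ← sub_eq_add_neg] at h2
    have hev : ∀ᶠ w in 𝓝 (η v), max a (min w b) ∈ Icc (lo v) (hi v) := by
      have below : ∀ {c}, c ∈ Ioo a b → η v < c → ∀ᶠ w in 𝓝 (η v), max a (min w b) ∈ Icc a c :=
        fun {c} hc hlt => by
          filter_upwards [eventually_lt_nhds hlt] with w hw
          exact ⟨le_max_left _ _, max_le hc.1.le ((min_le_left _ _).trans hw.le)⟩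
      have above : ∀ {c}, c ∈ Ioo a b → c < η v → ∀ᶠ w in 𝓝 (η v), max a (min w b) ∈ Icc c b :=
        fun {c} hc hlt => by
          filter_upwards [eventually_gt_nhds hlt] with w hw
          exact ⟨le_max_of_le_right (le_min hw.le hc.2.le), max_le hab.le (min_le_right _ _)⟩
      rw [hlo, hhi]
      rcases lt_or_ge v N with h1 | h1
      · rw [if_pos h1, if_pos h1]
        exact below hx (lt_of_le_of_ne (box1 v h1).2 (ne_x v (by omega)))
      rw [if_neg h1.not_gt, if_neg h1.not_gt]
      rcases lt_or_ge v (2 * N) with h2 | h2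
      · rw [if_pos h2, if_pos (by omega)]
        exact above hx (lt_of_le_of_ne (box2 v h1 h2).1 (ne_x v h2).symm)
      rw [if_neg h2.not_gt]
      rcases lt_or_ge v (3 * N) with h3 | h3
      · rw [if_pos h3, if_pos h3]
        exact above hy (lt_of_le_of_ne (box3 v h2 h3).1 (ne_y v h2 hv).symm)
      · rw [if_neg h3.not_gt, if_neg h3.not_gt]
        exact below hy (lt_of_le_of_ne (box4 v h3 hv).2 (ne_y v h2 hv))
    rw [h0, h1, h2]
    filter_upwards [hev] with w hw
    exact (ηloc v hv _ hw).trans (truncate hab.le ha hb (h2 ▸ box _) (h1 ▸ box _) w)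
  · have h1 := box1 0 (by omega)
    have h2 := ne_x 0 (by omega)
    exact (lt_of_le_of_ne h1.2 h2).trans_le (box2 N le_rfl (by omega)).1

end MongeCost

namespace GeoPlane

variable {G : GeoPlane}

namespace Axis

variable (A : G.Axis)

/-- The normalised transition cost of an axis. -/
lemma exists_cost : ∃ E : MongeCost, E.ℓ = A.ℓ ∧ ∃ e : ℝ, ∀ x y, A.h x y = E.f x y + e := by
  have hℓ := A.ℓ_pos
  have hc : Continuous fun x => A.h x x :=
    A.continuous_h.comp (continuous_id.prodMk continuous_id)
  obtain ⟨z, -, hz⟩ := (isCompact_Icc (a := (0 : ℝ)) (b := A.ℓ)).exists_isMinOn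
    (nonempty_Icc.2 hℓ.le) hc.continuousOn
  have hp : Function.Periodic (fun x => A.h x x) A.ℓ := fun x => A.h_per x x
  have hmin : ∀ x, A.h z z ≤ A.h x x := fun x => by
    obtain ⟨y, hy, hxy⟩ := hp.exists_mem_Ico₀ hℓ x
    have h1 := isMinOn_iff.1 hz y ⟨hy.1, hy.2.le⟩
    have h2 : A.h x x = A.h y y := hxy
    rw [h2]
    exact h1
  refine ⟨{ f := fun x y => A.h x y - A.h z z
            ℓ := A.ℓ
            ℓ_pos := hℓ
            lip_left := fun x x' y => by linarith [A.h_le_left x x' y]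
            lip_right := fun x y y' => by linarith [A.h_le_right x y y']
            per := fun x y => by rw [A.h_per]
            monge := fun x y x' y' h h' => by linarith [A.monge h h']
            diag := fun x => sub_nonneg.2 (hmin x)
            exists_zero := ⟨z, sub_self _⟩ }, rfl, A.h z z, fun x y => ?_⟩
  exact (sub_add_cancel _ _).symm

lemma _root_.sub_const_of_periodic {T g : ℤ → ℝ} (hT : ∀ n, T (n + 1) - T n = g n) {q : ℤ}
    (hg : ∀ n, g (n + q) = g n) (n : ℤ) : T (n + q) = T n + (T q - T 0) := by
  have step : ∀ s, T (s + 1 + q) - T (s + 1) = T (s + q) - T s := fun s => by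
    have h1 := hT s
    have h2 := hT (s + q)
    rw [add_right_comm, hg] at h2
    linarith
  have key : T (n + q) - T n = T q - T 0 := by
    induction n using Int.induction_on with
    | zero => rw [zero_add]
    | succ i ih => rw [step]; exact ih
    | pred i ih =>
      rw [← step, sub_add_cancel]
      exact ih
  linarith

/-- The piecewise minimal curve with prescribed vertices on the translates of an axis. -/
lemma exists_concatenation (ξ : ℤ → ℝ) (t₀ : ℝ) : ∃ (T : ℤ → ℝ) (L : ℝ → ℝ × ℝ), T 0 = t₀ ∧
    (∀ n, T (n + 1) - T n = A.h (ξ n) (ξ (n + 1))) ∧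
    (∀ s t, G.d (L s) (L t) ≤ |s - t|) ∧ (∀ n, L (T n) = A.S (ξ n) + lat (n, 0)) ∧
    ∀ q p, (∀ n, ξ (n + q) = ξ n) → (∀ n, T (n + q) = T n + p) →
      ∀ t, L (t + p) = L t + lat (q, 0) := by
  obtain ⟨T, hT⟩ := exists_int_sum fun n => A.h (ξ n) (ξ (n + 1))
  obtain ⟨δ, hδ, hh⟩ := A.exists_h_pos
  have hT' : ∀ n, T (n + 1) + (t₀ - T 0) - (T n + (t₀ - T 0)) = A.h (ξ n) (ξ (n + 1)) := fun n => by
    rw [← hT n]; ring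
  obtain ⟨L, h1, h2, h3⟩ := G.glue (T := fun n => T n + (t₀ - T 0))
    (P := fun n => A.S (ξ n) + lat (n, 0)) hδ
    (fun n => by rw [hT']; exact hh _ _)
    (fun n => by rw [hT', A.h_eq])
  refine ⟨fun n => T n + (t₀ - T 0), L, by ring, hT', h2, h1, fun q p hξ hp => ?_⟩
  refine h3 q (q, 0) p (fun n => ?_) hp
  rw [hξ, add_assoc, lat_mk_add, add_zero]

/-- Periodic locally minimal configurations oscillating across a gap give axes which are not
invariant under smaller translations. -/
lemma exists_axis_of_oscillating {m : ℕ} (hm : 1 ≤ m) {n₀ : ℕ}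
    (H : ∀ N ≥ n₀, ∃ η : ℤ → ℝ, (∀ i, η (i + 4 * N) = η i) ∧
      (∀ i, ∀ᶠ w in 𝓝 (η i), A.h (η (i - 1)) (η i) + A.h (η i) (η (i + 1)) ≤
        A.h (η (i - 1)) w + A.h w (η (i + 1))) ∧ η 0 < η N) :
    ∃ (k : ℤ) (α : ℝ → ℝ × ℝ) (p : ℝ), 2 ≤ k ∧ (∀ t, LocIsoAt G.d α t) ∧
      (∀ t, α (t + p) = α t + lat (k * m, 0)) ∧ range α ≠ range fun t => α t + lat (m, 0) := by
  obtain ⟨η, hper, hmin, hlt⟩ := H (m * (n₀ + 1)) (by nlinarith)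
  obtain ⟨T, L, -, hT, hL, hP, hLper⟩ := A.exists_concatenation η 0
  have hTp := sub_const_of_periodic hT (q := 4 * (m * (n₀ + 1) : ℕ)) fun n => by
    rw [hper, add_right_comm, hper]
  have hLp := hLper _ _ hper hTp
  refine ⟨4 * (n₀ + 1), L, T (4 * (m * (n₀ + 1) : ℕ)) - T 0, by omega,
    A.locIsoAt_concatenation hT hL hP hmin, fun t => ?_,
    fun hr => ?_⟩
  · rw [hLp]
    congr 3
    push_cast
    ring
  · have key : ∀ n, η (n + m) = η n := fun n => by
      have h1 : L (T n) + lat (m, 0) ∈ range L := by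
        rw [hr]
        exact mem_range_self (T n)
      obtain ⟨t, ht⟩ := h1
      rw [hP, add_assoc, lat_mk_add, add_zero] at ht
      have h2 := A.eq_of_mem_line hT hL hP (ht ▸ A.mem_line (η n) (n + m))
      rw [h2, hP] at ht
      exact A.injective (add_right_cancel ht)
    have h0 : ∀ j : ℕ, η ((m * j : ℕ) : ℤ) = η 0 := fun j => by
      induction j with
      | zero => simp
      | succ j ih =>
        rw [← ih, ← key ((m * j : ℕ) : ℤ)]
        congr 1
    exact hlt.ne' (h0 _)

end Axis

end GeoPlane

namespace MongeCost

variable {G : MongeCost}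

lemma continuous_potential_left (y : ℝ) : Continuous fun x => G.potential x y := by
  refine LipschitzWith.continuous (K := 1) (LipschitzWith.of_le_add fun x x' => ?_)
  rw [Real.dist_eq]
  exact G.potential_lip_left x x' y

lemma continuous_potential_right (x : ℝ) : Continuous fun y => G.potential x y := by
  refine LipschitzWith.continuous (K := 1) (LipschitzWith.of_le_add fun y y' => ?_)
  rw [Real.dist_eq]
  exact G.potential_lip_right x y y'

lemma exists_first_step {x b : ℝ} (hxb : x ≤ b) (hb : G.f b b = 0) :
    ∃ z ∈ Icc x b, G.f x z + G.potential z b = G.potential x b := by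
  have hc : Continuous fun z => G.f x z + G.potential z b :=
    (G.continuous_f.comp (continuous_const.prodMk continuous_id)).add
      (continuous_potential_left b)
  obtain ⟨z, hz, hmin⟩ := (isCompact_Icc (a := x) (b := b)).exists_isMinOn
    (nonempty_Icc.2 hxb) hc.continuousOn
  rw [isMinOn_iff] at hmin
  refine ⟨z, hz, le_antisymm (le_of_forall_pos_le_add fun ε hε => ?_) ?_⟩
  · obtain ⟨c, hc, h⟩ := G.exists_chain_le hxb hε
    have key : ∃ y ∈ Icc x b, G.f x y + G.potential y b ≤ c := by
      cases h with
      | one h => exact ⟨b, right_mem_Icc.2 hxb, by rw [G.potential_self hb, add_zero]⟩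
      | cons h h' => exact ⟨_, ⟨h, h'.le⟩, by gcongr; exact G.potential_le_of_chain h'⟩
    obtain ⟨y, hy, hyc⟩ := key
    exact (hmin y hy).trans (hyc.trans hc.le)
  · exact (G.potential_tri x z b).trans (add_le_add_left (G.potential_le x z) _)

lemma exists_last_step {a x : ℝ} (hax : a ≤ x) (ha : G.f a a = 0) :
    ∃ z ∈ Icc a x, G.potential a z + G.f z x = G.potential a x := by
  obtain ⟨z, hz, h⟩ := exists_first_step (G := G.neg.flip) (neg_le_neg hax)
    (by simpa [neg, flip] using ha)
  refine ⟨-z, ⟨by linarith [hz.2], by linarith [hz.1]⟩, ?_⟩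
  rw [potential_flip, potential_flip, potential_neg, ← neg_neg z, potential_neg] at h
  simp only [neg, flip, neg_neg] at h
  rw [add_comm]
  exact h

variable (G) in
/-- A continuous subsolution which is calibrated at every point of `[a, b]`. -/
def Calibrates (u : ℝ → ℝ) (a b : ℝ) : Prop :=
  Continuous u ∧ (∀ x y, u y - u x ≤ G.f x y) ∧ ∀ x ∈ Icc a b,
    (∃ y ∈ Icc a b, u y - u x = G.f x y) ∧ ∃ y ∈ Icc a b, u x - u y = G.f y x

lemma exists_calibrates_up {a b : ℝ} (ha : G.f a a = 0) (hb : G.f b b = 0)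
    (h : ∀ x ∈ Icc a b, G.potential a x + G.potential x b = G.potential a b) :
    ∃ u, G.Calibrates u a b := by
  refine ⟨G.potential a, continuous_potential_right a, fun x y => ?_, fun x hx => ⟨?_, ?_⟩⟩
  · linarith [G.potential_tri a x y, G.potential_le x y]
  · obtain ⟨z, hz, hzx⟩ := exists_first_step hx.2 hb
    have hz' : z ∈ Icc a b := ⟨hx.1.trans hz.1, hz.2⟩
    exact ⟨z, hz', by linarith [h x hx, h z hz']⟩
  · obtain ⟨z, hz, hzx⟩ := exists_last_step hx.1 ha
    exact ⟨z, ⟨hz.1, hz.2.trans hx.2⟩, by linarith⟩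

lemma exists_calibrates_down {a b : ℝ} (ha : G.f a a = 0) (hb : G.f b b = 0)
    (h : ∀ x ∈ Icc a b, G.potential b x + G.potential x a = G.potential b a) :
    ∃ u, G.Calibrates u a b := by
  obtain ⟨u, h1, h2, h3⟩ := exists_calibrates_up (G := G.neg) (a := -b) (b := -a)
    (by simpa [neg] using hb) (by simpa [neg] using ha) fun x hx => by
      rw [← neg_neg x, potential_neg, potential_neg, potential_neg]
      exact h _ ⟨by linarith [hx.2], by linarith [hx.1]⟩
  refine ⟨fun x => u (-x), h1.comp continuous_neg, fun x y => ?_, fun x hx => ?_⟩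
  · simpa [neg] using h2 (-x) (-y)
  · obtain ⟨⟨y, hy, e⟩, ⟨z, hz, e'⟩⟩ := h3 (-x) ⟨neg_le_neg hx.2, neg_le_neg hx.1⟩
    refine ⟨⟨-y, ⟨by linarith [hy.2], by linarith [hy.1]⟩, ?_⟩,
      ⟨-z, ⟨by linarith [hz.2], by linarith [hz.1]⟩, ?_⟩⟩
    · simpa [neg] using e
    · simpa [neg] using e'

variable (G) in
/-- Every vertex of the configuration minimises the cost given its neighbours. -/
def Stationary (ξ : ℤ → ℝ) : Prop :=
  ∀ n w, G.f (ξ (n - 1)) (ξ n) + G.f (ξ n) (ξ (n + 1)) ≤ G.f (ξ (n - 1)) w + G.f w (ξ (n + 1))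

/-- The configuration following `ξ` at negative times and `ζ` at nonnegative times. -/
def splice (ξ ζ : ℤ → ℝ) (n : ℤ) : ℝ := if n < 0 then ξ n else ζ n

variable (G) in
/-- Stationary configurations with a stationary splice coincide. -/
def Rigid : Prop :=
  ∀ ξ ζ : ℤ → ℝ, G.Stationary ξ → G.Stationary ζ → G.Stationary (splice ξ ζ) → ξ 0 = ζ 0 → ξ = ζ

lemma stationary_of_calibrated {u : ℝ → ℝ} (hu : ∀ x y, u y - u x ≤ G.f x y) {ξ : ℤ → ℝ}
    (h : ∀ n, u (ξ (n + 1)) - u (ξ n) = G.f (ξ n) (ξ (n + 1))) : G.Stationary ξ := fun n w => by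
  have h1 := h (n - 1)
  rw [sub_add_cancel] at h1
  linarith [h n, hu (ξ (n - 1)) w, hu w (ξ (n + 1))]

lemma exists_orbit {K : Set ℝ} {Q : ℝ → ℝ → Prop} (h : ∀ x ∈ K, ∃ y ∈ K, Q x y) {x : ℝ}
    (hx : x ∈ K) : ∃ o : ℕ → ℝ, o 0 = x ∧ ∀ n, Q (o n) (o (n + 1)) := by
  choose! s hs hQ using h
  have hmem : ∀ n, s^[n] x ∈ K := fun n => by
    induction n with
    | zero => exact hx
    | succ n ih => rw [Function.iterate_succ_apply']; exact hs _ ih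
  refine ⟨fun n => s^[n] x, rfl, fun n => ?_⟩
  beta_reduce
  rw [Function.iterate_succ_apply']
  exact hQ _ (hmem n)

lemma Calibrates.eq_of_step {u : ℝ → ℝ} {a b p x : ℝ} (h : G.Calibrates u a b) (hrig : G.Rigid)
    (hp : G.f p p = 0) (hx : x ∈ Icc a b)
    (hstep : u x - u p = G.f p x ∨ u p - u x = G.f x p) : x = p := by
  obtain ⟨-, hsub, hcal⟩ := h
  have hconst : G.Stationary fun _ => p :=
    stationary_of_calibrated hsub fun _ => by rw [sub_self, hp]
  rcases hstep with hstep | hstep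
  · obtain ⟨o, o0, ho⟩ := exists_orbit (fun x hx => (hcal x hx).1) hx
    obtain ⟨ξ, hξ⟩ : ∃ ξ : ℤ → ℝ, ∀ n, ξ n = if n ≤ 0 then p else o (n - 1).toNat :=
      ⟨_, fun _ => rfl⟩
    have hs : G.Stationary ξ := stationary_of_calibrated hsub fun n => by
      rcases lt_trichotomy n 0 with hn | rfl | hn
      · rw [hξ, hξ, if_pos (by omega), if_pos hn.le, sub_self, hp]
      · rw [hξ, hξ, if_neg (by omega), if_pos le_rfl]
        simpa [o0] using hstep
      · rw [hξ, hξ, if_neg (by omega), if_neg (by omega),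
          show (n + 1 - 1).toNat = (n - 1).toNat + 1 by omega]
        exact ho _
    have hspl : splice (fun _ => p) ξ = ξ := funext fun n => by
      rw [splice]
      split_ifs with hn
      · rw [hξ, if_pos hn.le]
      · rfl
    have := congrFun (hrig _ ξ hconst hs (by rwa [hspl]) (by rw [hξ, if_pos le_rfl])) 1
    rw [hξ, if_neg (by omega)] at this
    simpa [o0] using this.symm
  · obtain ⟨o, o0, ho⟩ := exists_orbit (fun x hx => (hcal x hx).2) hx
    obtain ⟨ξ, hξ⟩ : ∃ ξ : ℤ → ℝ, ∀ n, ξ n = if 0 ≤ n then p else o (-n - 1).toNat :=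
      ⟨_, fun _ => rfl⟩
    have hs : G.Stationary ξ := stationary_of_calibrated hsub fun n => by
      rcases lt_trichotomy n (-1) with hn | rfl | hn
      · rw [hξ, hξ, if_neg (by omega), if_neg (by omega),
          show (-n - 1).toNat = (-(n + 1) - 1).toNat + 1 by omega]
        exact ho _
      · rw [hξ, hξ, if_pos (by omega), if_neg (by omega)]
        simpa [o0] using hstep
      · rw [hξ, hξ, if_pos (by omega), if_pos (by omega), sub_self, hp]
    have hspl : splice ξ (fun _ => p) = ξ := funext fun n => by
      rw [splice]
      split_ifs with hn
      · rfl
      · rw [hξ, if_pos (by omega)]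
    have := congrFun (hrig ξ _ hs hconst (by rwa [hspl]) (by rw [hξ, if_pos le_rfl])) (-1)
    rw [hξ, if_neg (by omega)] at this
    simpa [o0] using this

lemma IsGap.sub_le {a b : ℝ} (h : G.IsGap a b) : b - a ≤ G.ℓ := by
  by_contra! hlt
  have := h.2.2.2 (a + G.ℓ) ⟨by linarith [G.ℓ_pos], by linarith⟩
  rw [G.per, h.2.1] at this
  exact lt_irrefl _ this

lemma IsGap.eq {a b a' b' w : ℝ} (h : G.IsGap a b) (h' : G.IsGap a' b') (hw : w ∈ Ioo a b)
    (hw' : w ∈ Ioo a' b') : a = a' ∧ b = b' := by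
  refine ⟨le_antisymm ?_ ?_, le_antisymm ?_ ?_⟩ <;> by_contra! hlt
  · exact (h'.2.2.2 a ⟨hlt, hw.1.trans hw'.2⟩).ne' h.2.1
  · exact (h.2.2.2 a' ⟨hlt, hw'.1.trans hw.2⟩).ne' h'.2.1
  · exact (h.2.2.2 b' ⟨hw.1.trans hw'.2, hlt⟩).ne' h'.2.2.1
  · exact (h'.2.2.2 b ⟨hw'.1.trans hw.2, hlt⟩).ne' h.2.2.1

lemma exists_gap {x : ℝ} (hx : 0 < G.f x x) : ∃ a b, G.IsGap a b ∧ x ∈ Ioo a b := by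
  have hc : Continuous fun w => G.f w w := G.continuous_f.comp (continuous_id.prodMk continuous_id)
  have hZ : IsClosed {w | G.f w w = 0} := isClosed_eq hc continuous_const
  have hp : Function.Periodic (fun w => G.f w w) G.ℓ := fun w => G.per w w
  obtain ⟨z, hz⟩ := G.exists_zero
  obtain ⟨y, hy, hzy⟩ := hp.exists_mem_Ico G.ℓ_pos z (x - G.ℓ)
  obtain ⟨y', hy', hzy'⟩ := hp.exists_mem_Ico G.ℓ_pos z x
  obtain ⟨a, ha, hamax⟩ :=
    ((isCompact_Icc (a := x - G.ℓ) (b := x)).inter_right hZ).exists_isGreatest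
    ⟨y, ⟨hy.1, by linarith [hy.2]⟩, hzy.symm.trans hz⟩
  obtain ⟨b, hb, hbmin⟩ := ((isCompact_Icc (a := x) (b := x + G.ℓ)).inter_right hZ).exists_isLeast
    ⟨y', ⟨hy'.1, hy'.2.le⟩, hzy'.symm.trans hz⟩
  have hax : a < x := lt_of_le_of_ne ha.1.2 fun h => hx.ne' (h ▸ ha.2)
  have hxb : x < b := lt_of_le_of_ne hb.1.1 fun h => hx.ne' (h ▸ hb.2)
  refine ⟨a, b, ⟨hax.trans hxb, ha.2, hb.2, fun w hw => lt_of_le_of_ne (G.diag w) fun h => ?_⟩,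
    hax, hxb⟩
  rcases le_total w x with hwx | hwx
  · exact hw.1.not_ge (hamax ⟨⟨ha.1.1.trans hw.1.le, hwx⟩, h.symm⟩)
  · exact hw.2.not_ge (hbmin ⟨⟨hwx, hw.2.le.trans hb.1.2⟩, h.symm⟩)

/-- If all gaps are calibrated then there is a closed relation all of whose orbits are
stationary. -/
lemma exists_relation (hrig : G.Rigid) (hcal : ∀ a b, G.IsGap a b → ∃ u, G.Calibrates u a b) :
    ∃ R : ℝ → ℝ → Prop, IsClosed {p : ℝ × ℝ | R p.1 p.2} ∧ (∀ x, ∃ y, R x y) ∧ (∀ y, ∃ x, R x y) ∧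
      (∀ x y z w, R x y → R y z → G.f x y + G.f y z ≤ G.f x w + G.f w z) ∧
      ∀ x y, R x y → |x - y| ≤ G.ℓ := by
  have hc : Continuous fun w => G.f w w := G.continuous_f.comp (continuous_id.prodMk continuous_id)
  choose u hu using hcal
  obtain ⟨R, hR⟩ : ∃ R : ℝ → ℝ → Prop, ∀ x y, R x y ↔ (x = y ∧ G.f x x = 0) ∨
      ∃ a b, ∃ h : G.IsGap a b, x ∈ Icc a b ∧ y ∈ Icc a b ∧ u a b h y - u a b h x = G.f x y :=
    ⟨_, fun _ _ => Iff.rfl⟩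
  have interior : ∀ {a b w}, G.IsGap a b → w ∈ Icc a b → 0 < G.f w w → w ∈ Ioo a b :=
    fun {a b w} h hw hpos => ⟨lt_of_le_of_ne hw.1 fun e => hpos.ne' (e ▸ h.2.1),
      lt_of_le_of_ne hw.2 fun e => hpos.ne' (e ▸ h.2.2.1)⟩
  have closed : ∀ a b (h : G.IsGap a b), IsClosed {p : ℝ × ℝ | p.1 ∈ Icc a b ∧ p.2 ∈ Icc a b ∧
      u a b h p.2 - u a b h p.1 = G.f p.1 p.2} := fun a b h =>
    (isClosed_Icc.preimage continuous_fst).inter ((isClosed_Icc.preimage continuous_snd).inter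
      (isClosed_eq (((hu a b h).1.comp continuous_snd).sub ((hu a b h).1.comp continuous_fst))
        G.continuous_f))
  have common : ∀ (p : ℝ × ℝ) (w : ℝ), (∀ᶠ q in 𝓝 p, R q.1 q.2 → ∃ a b, ∃ h : G.IsGap a b,
      w ∈ Ioo a b ∧ q.1 ∈ Icc a b ∧ q.2 ∈ Icc a b ∧ u a b h q.2 - u a b h q.1 = G.f q.1 q.2) →
      (∃ᶠ q in 𝓝 p, R q.1 q.2) → R p.1 p.2 := fun p w hw hf => by
    have hf' := hf.and_eventually hw
    obtain ⟨q₀, hq₀, hq₀'⟩ := hf'.exists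
    obtain ⟨a, b, h, hwab, -⟩ := hq₀' hq₀
    refine (hR _ _).2 (Or.inr ⟨a, b, h, isClosed_iff_frequently.1 (closed a b h) p
      (hf'.mono fun q hq => ?_)⟩)
    obtain ⟨a', b', h', hwab', hq⟩ := hq.2 hq.1
    obtain ⟨rfl, rfl⟩ := h.eq h' hwab hwab'
    exact hq
  have strict : ∀ {x y}, R x y → (x = y ∧ G.f x x = 0) ∨ ∃ a b, ∃ h : G.IsGap a b,
      x ∈ Ioo a b ∧ y ∈ Ioo a b ∧ u a b h y - u a b h x = G.f x y := fun {x y} h => by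
    rcases (hR x y).1 h with h | ⟨a, b, h, hx, hy, e⟩
    · exact Or.inl h
    · rcases (G.diag x).eq_or_lt' with hx0 | hx0
      · have := (hu a b h).eq_of_step hrig hx0 hy (Or.inl e)
        exact Or.inl ⟨this.symm, hx0⟩
      rcases (G.diag y).eq_or_lt' with hy0 | hy0
      · have := (hu a b h).eq_of_step hrig hy0 hx (Or.inr e)
        exact absurd (this ▸ hy0) hx0.ne'
      · exact Or.inr ⟨a, b, h, interior h hx hx0, interior h hy hy0, e⟩
  refine ⟨R, isClosed_iff_frequently.2 fun p hp => ?_, fun x => ?_, fun y => ?_,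
    fun x y z w hxy hyz => ?_, fun x y h => ?_⟩
  · rcases lt_trichotomy p.1 p.2 with hlt | heq | hlt
    · refine common p ((p.1 + p.2) / 2) ?_ hp
      filter_upwards [continuous_fst.continuousAt.eventually_lt_const
        (show p.1 < (p.1 + p.2) / 2 by linarith), continuous_snd.continuousAt.eventually_const_lt
        (show (p.1 + p.2) / 2 < p.2 by linarith)] with q h1 h2 hq
      rcases (hR _ _).1 hq with h | ⟨a, b, h, hx, hy, e⟩
      · linarith [h.1]
      · exact ⟨a, b, h, ⟨hx.1.trans_lt h1, h2.trans_le hy.2⟩, hx, hy, e⟩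
    · rcases (G.diag p.1).eq_or_lt' with h0 | h0
      · exact (hR _ _).2 (Or.inl ⟨heq, h0⟩)
      · obtain ⟨a, b, hab, hp1⟩ := exists_gap h0
        refine common p p.1 ?_ hp
        filter_upwards [continuous_fst.continuousAt (Ioo_mem_nhds hp1.1 hp1.2)] with q h1 hq
        rcases (hR _ _).1 hq with h | ⟨a', b', h, hx, hy, e⟩
        · exact absurd h.2 (hab.2.2.2 _ h1).ne'
        · obtain ⟨rfl, rfl⟩ := hab.eq h h1 (interior h hx (hab.2.2.2 _ h1))
          exact ⟨a, b, h, hp1, hx, hy, e⟩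
    · refine common p ((p.1 + p.2) / 2) ?_ hp
      filter_upwards [continuous_fst.continuousAt.eventually_const_lt
        (show (p.1 + p.2) / 2 < p.1 by linarith), continuous_snd.continuousAt.eventually_lt_const
        (show p.2 < (p.1 + p.2) / 2 by linarith)] with q h1 h2 hq
      rcases (hR _ _).1 hq with h | ⟨a, b, h, hx, hy, e⟩
      · linarith [h.1]
      · exact ⟨a, b, h, ⟨hy.1.trans_lt h2, h1.trans_le hx.2⟩, hx, hy, e⟩
  · rcases (G.diag x).eq_or_lt' with h0 | h0
    · exact ⟨x, (hR _ _).2 (Or.inl ⟨rfl, h0⟩)⟩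
    · obtain ⟨a, b, h, hx⟩ := exists_gap h0
      obtain ⟨⟨y, hy, e⟩, -⟩ := (hu a b h).2.2 x (Ioo_subset_Icc_self hx)
      exact ⟨y, (hR _ _).2 (Or.inr ⟨a, b, h, Ioo_subset_Icc_self hx, hy, e⟩)⟩
  · rcases (G.diag y).eq_or_lt' with h0 | h0
    · exact ⟨y, (hR _ _).2 (Or.inl ⟨rfl, h0⟩)⟩
    · obtain ⟨a, b, h, hy⟩ := exists_gap h0
      obtain ⟨-, x, hx, e⟩ := (hu a b h).2.2 y (Ioo_subset_Icc_self hy)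
      exact ⟨x, (hR _ _).2 (Or.inr ⟨a, b, h, hx, Ioo_subset_Icc_self hy, e⟩)⟩
  · rcases strict hxy with ⟨rfl, h0⟩ | ⟨a, b, h, hx, hy, e⟩ <;>
      rcases strict hyz with ⟨rfl, h0'⟩ | ⟨a', b', h', hy', hz, e'⟩
    · rw [h0, add_zero]
      refine (G.diag x).trans ?_
      rcases le_total x w with hw | hw
      · exact f_le_of_ge hw hw
      · exact f_le_of_le hw hw
    · exact absurd h0 (h'.2.2.2 _ hy').ne'
    · exact absurd h0' (h.2.2.2 _ hy).ne'
    · obtain ⟨rfl, rfl⟩ := h.eq h' hy hy'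
      linarith [(hu a b h).2.1 x w, (hu a b h).2.1 w z]
  · rcases (hR _ _).1 h with ⟨rfl, -⟩ | ⟨a, b, h, hx, hy, -⟩
    · rw [sub_self, abs_zero]; exact G.ℓ_pos.le
    · have := h.sub_le
      exact abs_le.2 ⟨by linarith [hx.1, hy.2], by linarith [hx.2, hy.1]⟩

end MongeCost

namespace GeoPlane

variable {G : GeoPlane}

namespace Axis

variable (A : G.Axis)

/-- `L` is the broken minimal curve with vertices `ξ` reached at times `T`. -/
structure IsPath (ξ T : ℤ → ℝ) (L : ℝ → ℝ × ℝ) : Prop where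
  zero : T 0 = 0
  step : ∀ n, T (n + 1) - T n = A.h (ξ n) (ξ (n + 1))
  lip : ∀ s t, G.d (L s) (L t) ≤ |s - t|
  vertex : ∀ n, L (T n) = A.S (ξ n) + lat (n, 0)

variable {A}

lemma IsPath.strictMono {ξ T : ℤ → ℝ} {L : ℝ → ℝ × ℝ} (h : A.IsPath ξ T L) : StrictMono T := by
  obtain ⟨δ, hδ, hh⟩ := A.exists_h_pos
  exact strictMono_of_gaps hδ fun n => (h.step n).symm ▸ hh _ _

lemma IsPath.start {ξ T : ℤ → ℝ} {L : ℝ → ℝ × ℝ} (h : A.IsPath ξ T L) : L 0 = A.S (ξ 0) := by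
  have := h.vertex 0
  rwa [h.zero, ← Prod.zero_eq_mk, lat_zero, add_zero] at this

lemma exists_isPath (A : G.Axis) (ξ : ℤ → ℝ) : ∃ T L, A.IsPath ξ T L := by
  obtain ⟨T, L, h0, h1, h2, h3, -⟩ := A.exists_concatenation ξ 0
  exact ⟨T, L, h0, h1, h2, h3⟩

lemma IsPath.splice {ξ ζ T T' : ℤ → ℝ} {L L' : ℝ → ℝ × ℝ} (h : A.IsPath ξ T L)
    (h' : A.IsPath ζ T' L') (h0 : ξ 0 = ζ 0) :
    A.IsPath (MongeCost.splice ξ ζ) (MongeCost.splice T T')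
      fun t => if t < 0 then L t else L' t := by
  have key : ∀ s t, s < 0 → 0 ≤ t → G.d (L s) (L' t) ≤ t - s := fun s t hs ht => by
    have h1 := h.lip s 0
    have h2 := h'.lip 0 t
    rw [sub_zero, abs_of_neg hs] at h1
    rw [zero_sub, abs_neg, abs_of_nonneg ht, h'.start, ← h0, ← h.start] at h2
    linarith [G.tri (L s) (L 0) (L' t)]
  refine ⟨?_, fun n => ?_, fun s t => ?_, fun n => ?_⟩
  · rw [MongeCost.splice, if_neg (lt_irrefl _), h'.zero]
  · simp only [MongeCost.splice]
    rcases lt_trichotomy n (-1) with hn | rfl | hn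
    · rw [if_pos (by omega), if_pos (by omega), if_pos (by omega), if_pos (by omega), h.step]
    · rw [if_neg (by omega), if_pos (by omega), if_pos (by omega), if_neg (by omega),
        neg_add_cancel, h'.zero, ← h.zero, ← h0]
      exact h.step (-1)
    · rw [if_neg (by omega), if_neg (by omega), if_neg (by omega), if_neg (by omega), h'.step]
  · split_ifs with hs ht ht
    · exact h.lip s t
    · exact (key s t hs (not_lt.1 ht)).trans ((le_abs_self _).trans_eq (abs_sub_comm _ _))
    · rw [G.symm]
      exact (key t s ht (not_lt.1 hs)).trans (le_abs_self _)
    · exact h'.lip s t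
  · simp only [MongeCost.splice]
    split_ifs with hn ht ht
    · exact h.vertex n
    · exact absurd ((h.strictMono hn).trans_eq h.zero) ht
    · exact absurd (h'.zero.ge.trans (h'.strictMono.monotone (not_lt.1 hn))) (not_le.2 ht)
    · exact h'.vertex n

lemma eq_of_eventuallyEq {c e : ℝ → ℝ × ℝ} (hc : ∀ t, LocIsoAt G.d c t)
    (he : ∀ t, LocIsoAt G.d e t) {t : ℝ} (h : c =ᶠ[𝓝 t] e) : c = e := funext fun s =>
  G.uniq c e (min s t - 1) (max s t + 1) t (fun r _ => hc r) (fun r _ => he r)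
    ⟨by linarith [min_le_right s t], by linarith [le_max_right s t]⟩ h
    ⟨by linarith [min_le_left s t], by linarith [le_max_left s t]⟩

variable {E : MongeCost} {e : ℝ}

lemma IsPath.locIsoAt (hE : ∀ x y, A.h x y = E.f x y + e) {ξ T : ℤ → ℝ}
    {L : ℝ → ℝ × ℝ} (h : A.IsPath ξ T L) (hs : E.Stationary ξ) (t : ℝ) : LocIsoAt G.d L t := by
  refine A.locIsoAt_concatenation h.step h.lip h.vertex
    (fun n => Eventually.of_forall fun w => ?_) t
  rw [hE, hE, hE, hE]
  linarith [hs n w]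

lemma IsPath.unique (hE : ∀ x y, A.h x y = E.f x y + e) {ξ ζ T T' : ℤ → ℝ}
    {L L' : ℝ → ℝ × ℝ} (h : A.IsPath ξ T L) (h' : A.IsPath ζ T' L')
    (hξ : E.Stationary ξ) (hζ : E.Stationary ζ)
    (hs : E.Stationary (MongeCost.splice ξ ζ)) (h0 : ξ 0 = ζ 0) : L = L' ∧ ξ = ζ := by
  have hspl := IsPath.locIsoAt hE (h.splice h' h0) hs
  have h1 : (fun t => if t < 0 then L t else L' t) = L :=
    eq_of_eventuallyEq hspl (IsPath.locIsoAt hE h hξ) (t := -1) <| by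
      filter_upwards [eventually_lt_nhds (show (-1 : ℝ) < 0 by norm_num)] with t ht
      exact if_pos ht
  have h2 : (fun t => if t < 0 then L t else L' t) = L' :=
    eq_of_eventuallyEq hspl (IsPath.locIsoAt hE h' hζ) (t := 1) <| by
      filter_upwards [eventually_gt_nhds (show (0 : ℝ) < 1 by norm_num)] with t ht
      exact if_neg ht.not_gt
  obtain rfl := h1.symm.trans h2
  refine ⟨rfl, funext fun n => ?_⟩
  have hmem : L (T' n) ∈ A.line n := h'.vertex n ▸ A.mem_line (ζ n) n
  have := h'.vertex n
  rw [A.eq_of_mem_line h.step h.lip h.vertex hmem, h.vertex] at this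
  exact A.injective (add_right_cancel this)

lemma rigid (hE : ∀ x y, A.h x y = E.f x y + e) : E.Rigid := fun ξ ζ hξ hζ hs h0 => by
  obtain ⟨T, L, h⟩ := A.exists_isPath ξ
  obtain ⟨T', L', h'⟩ := A.exists_isPath ζ
  exact (IsPath.unique hE h h' hξ hζ hs h0).2

end Axis

end GeoPlane

namespace GeoPlane

variable {G : GeoPlane}

namespace Axis

variable {A : G.Axis}

lemma _root_.abs_sub_le_of_step {g : ℤ → ℝ} {B : ℝ} (h : ∀ n, |g (n + 1) - g n| ≤ B) (n : ℤ) :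
    |g n - g 0| ≤ |(n : ℝ)| * B := by
  induction n using Int.induction_on with
  | zero => simp
  | succ i ih =>
    have h1 := abs_sub_le (g (i + 1)) (g i) (g 0)
    have h2 : |(((i : ℤ) + 1 : ℤ) : ℝ)| = |((i : ℤ) : ℝ)| + 1 := by
      push_cast
      rw [abs_of_nonneg (by positivity), abs_of_nonneg (by positivity)]
    rw [h2, add_mul, one_mul]
    linarith [h i]
  | pred i ih =>
    have h1 := abs_sub_le (g (-i - 1)) (g (-i)) (g 0)
    have h2 : |((-(i : ℤ) - 1 : ℤ) : ℝ)| = |((-i : ℤ) : ℝ)| + 1 := by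
      push_cast
      rw [show (-(i : ℝ) - 1) = -(i + 1) by ring, abs_neg, abs_neg, abs_of_nonneg (by positivity),
        abs_of_nonneg (by positivity)]
    have h3 := h (-i - 1)
    rw [sub_add_cancel, abs_sub_comm] at h3
    rw [h2, add_mul, one_mul]
    linarith

lemma _root_.Ultrafilter.exists_tendsto_of_bounded {X : Type*} {Y : Type*} [PseudoMetricSpace Y]
    [ProperSpace Y] {U : Ultrafilter X} {g : X → Y} (y : Y) (r : ℝ)
    (h : ∀ᶠ x in U, dist (g x) y ≤ r) : ∃ l, Tendsto g U (𝓝 l) := by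
  obtain ⟨l, -, hl⟩ := (isCompact_closedBall y r).ultrafilter_le_nhds (U.map g)
    (le_principal_iff.2 h)
  exact ⟨l, hl⟩

/-- Limits of broken minimal curves. -/
lemma exists_limit_path {B s : ℝ} {U : Ultrafilter ℝ} (hU : (U : Filter ℝ) ≤ 𝓝 s)
    {ξ T : ℝ → ℤ → ℝ} {F : ℝ → ℝ → ℝ × ℝ} (hF : ∀ x, A.IsPath (ξ x) (T x) (F x))
    (hξ : ∀ x n, |ξ x (n + 1) - ξ x n| ≤ B) (h0 : ∀ x, ξ x 0 = x) :
    ∃ ξ' T' L, A.IsPath ξ' T' L ∧ ξ' 0 = s ∧ (∀ n, Tendsto (fun x => ξ x n) U (𝓝 (ξ' n))) ∧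
      ∀ t, Tendsto (fun x => F x t) U (𝓝 (L t)) := by
  have hid : Tendsto (fun x : ℝ => x) U (𝓝 s) := hU
  have near : ∀ᶠ x in U, |x - s| ≤ 1 := by
    have := hid.eventually (Metric.closedBall_mem_nhds s one_pos)
    exact this
  have step : ∀ x n, |T x (n + 1) - T x n| ≤ G.C + B := fun x n => by
    rw [(hF x).step, abs_of_nonneg (show 0 ≤ A.h _ _ from G.nonneg _ _)]
    have h1 := A.h_le_right (ξ x n) (ξ x (n + 1)) (ξ x n)
    linarith [A.h_self_le (ξ x n), hξ x n]
  have e1 : ∀ n, ∃ l, Tendsto (fun x => ξ x n) U (𝓝 l) := fun n =>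
    Ultrafilter.exists_tendsto_of_bounded s (|(n : ℝ)| * B + 1) <| by
      filter_upwards [near] with x hx
      have h1 := abs_sub_le_of_step (hξ x) n
      have h2 := abs_sub_le (ξ x n) x s
      rw [h0] at h1
      rw [Real.dist_eq]
      linarith
  have e2 : ∀ n, ∃ l, Tendsto (fun x => T x n) U (𝓝 l) := fun n =>
    Ultrafilter.exists_tendsto_of_bounded 0 (|(n : ℝ)| * (G.C + B)) <| by
      refine Eventually.of_forall fun x => ?_
      have h1 := abs_sub_le_of_step (step x) n
      rwa [(hF x).zero] at h1
  have e3 : ∀ t, ∃ l, Tendsto (fun x => F x t) U (𝓝 l) := fun t =>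
    Ultrafilter.exists_tendsto_of_bounded (A.S s) ((|t| + 1) / G.m) <| by
      filter_upwards [near] with x hx
      rw [dist_eq_norm]
      refine (G.norm_le _ _).trans (div_le_div_of_nonneg_right ?_ G.m_pos.le)
      have h1 := G.tri (F x t) (F x 0) (A.S s)
      have h2 := (hF x).lip t 0
      rw [sub_zero] at h2
      rw [(hF x).start, h0] at h1 h2
      rw [A.iso] at h1
      linarith
  choose ξ' hξ' using e1
  choose T' hT' using e2
  choose L hL using e3
  have cd : ∀ {f g : ℝ → ℝ × ℝ} {p q}, Tendsto f U (𝓝 p) → Tendsto g U (𝓝 q) →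
      Tendsto (fun x => G.d (f x) (g x)) U (𝓝 (G.d p q)) := fun {f g p q} hf hg =>
    (G.continuous_d.tendsto (p, q)).comp (hf.prodMk_nhds hg)
  refine ⟨ξ', T', L, ⟨?_, fun n => ?_, fun r t => ?_, fun n => ?_⟩, ?_, hξ', hL⟩
  · refine tendsto_nhds_unique (hT' 0) ?_
    simp only [fun x => (hF x).zero]
    exact tendsto_const_nhds
  · refine tendsto_nhds_unique ((hT' (n + 1)).sub (hT' n)) ?_
    simp only [fun x => (hF x).step]
    exact (A.continuous_h.tendsto (ξ' n, ξ' (n + 1))).comp ((hξ' n).prodMk_nhds (hξ' (n + 1)))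
  · exact le_of_tendsto (cd (hL r) (hL t)) (Eventually.of_forall fun x => (hF x).lip r t)
  · refine G.eq_of_le_zero ?_
    have h1 : Tendsto (fun x => |T' n - T x n|) U (𝓝 |T' n - T' n|) :=
      (tendsto_const_nhds.sub (hT' n)).abs
    rw [sub_self, abs_zero] at h1
    refine le_of_tendsto_of_tendsto (cd (hL (T' n))
      (((A.continuous_line n).tendsto (ξ' n)).comp (hξ' n))) h1 (Eventually.of_forall fun x => ?_)
    have := (hF x).lip (T' n) (T x n)
    rwa [(hF x).vertex] at this
  · refine tendsto_nhds_unique (hξ' 0) ?_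
    simp only [h0]
    exact hid

/-- Broken minimal curves with bounded steps run linearly from left to right. -/
lemma exists_drift (A : G.Axis) (B : ℝ) : ∃ β > 0, ∃ K, ∀ ξ T L, A.IsPath ξ T L →
    (∀ n, |ξ (n + 1) - ξ n| ≤ B) → ∀ t, (0 ≤ t → β * t - K ≤ (L t).1) ∧
      (t ≤ 0 → (L t).1 ≤ β * t + K) := by
  obtain ⟨K, hK⟩ := A.exists_bound
  obtain ⟨δ, hδ, hh⟩ := A.exists_h_pos
  have hC := G.C_pos
  have hm := G.m_pos
  obtain ⟨Q, hQ⟩ : ∃ Q, Q = G.C + |B| := ⟨_, rfl⟩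
  have hQ0 : 0 < Q := hQ ▸ by positivity
  refine ⟨Q⁻¹, by positivity, K + Q / G.m + 1, fun ξ T L h hξ t => ?_⟩
  have step : ∀ n, |T (n + 1) - T n| ≤ Q := fun n => by
    rw [h.step, abs_of_nonneg (show 0 ≤ A.h _ _ from G.nonneg _ _)]
    have h1 := A.h_le_right (ξ n) (ξ (n + 1)) (ξ n)
    linarith [A.h_self_le (ξ n), hξ n, le_abs_self B]
  obtain ⟨n, hn, hn'⟩ := exists_cell hδ (fun n => (h.step n).symm ▸ hh _ _) t
  have near : |(L t).1 - n| ≤ K + Q / G.m := by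
    have h1 : ‖L t - L (T n)‖ ≤ Q / G.m := (G.norm_le _ _).trans <| by
      refine div_le_div_of_nonneg_right ((h.lip _ _).trans ?_) hm.le
      rw [abs_of_nonneg (by linarith)]
      linarith [le_abs_self (T (n + 1) - T n), step n]
    have h2 := (norm_fst_le (L t - L (T n))).trans h1
    rw [h.vertex, Real.norm_eq_abs] at h2
    simp only [Prod.fst_sub, Prod.fst_add, lat] at h2
    have h3 := (hK (ξ n)).1
    have h4 := abs_add_le ((L t).1 - ((A.S (ξ n)).1 + n)) (A.S (ξ n)).1
    rw [show (L t).1 - ((A.S (ξ n)).1 + n) + (A.S (ξ n)).1 = (L t).1 - n by ring] at h4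
    linarith
  obtain ⟨near1, near2⟩ := abs_le.1 near
  rw [inv_mul_eq_div]
  refine ⟨fun ht => ?_, fun ht => ?_⟩
  · have hn0 : 0 < n + 1 := h.strictMono.lt_iff_lt.1 (by rw [h.zero]; linarith)
    have h1 := abs_sub_le_of_step step (n + 1)
    rw [h.zero, sub_zero, abs_of_pos (a := ((n + 1 : ℤ) : ℝ)) (by exact_mod_cast hn0)] at h1
    have h2 : t / Q ≤ n + 1 := by
      rw [div_le_iff₀ hQ0]
      push_cast at h1
      linarith [le_abs_self (T (n + 1))]
    linarith
  · have hn0 : n ≤ 0 := h.strictMono.le_iff_le.1 (by rw [h.zero]; linarith)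
    have h1 := abs_sub_le_of_step step n
    rw [h.zero, sub_zero, abs_of_nonpos (a := (n : ℝ)) (by exact_mod_cast hn0)] at h1
    have h2 : n ≤ t / Q := by
      rw [le_div_iff₀ hQ0]
      linarith [neg_abs_le (T n)]
    linarith

/-- A geodesic foliation transverse to an axis. -/
lemma exists_foliation {E : MongeCost} {e : ℝ} (hE : ∀ x y, A.h x y = E.f x y + e)
    (hcal : ∀ a b, E.IsGap a b → ∃ u, E.Calibrates u a b) :
    ∃ F : ℝ → ℝ → ℝ × ℝ, Continuous (fun z : ℝ × ℝ => F z.1 z.2) ∧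
      (∀ s t, LocIsoAt G.d (F s) t) ∧ (∀ s, F s 0 = A.S s) ∧
      (∀ s t t', G.d (F s t) (F s t') ≤ |t - t'|) ∧
      ∃ β > 0, ∃ K, ∀ s t, (0 ≤ t → β * t - K ≤ (F s t).1) ∧ (t ≤ 0 → (F s t).1 ≤ β * t + K) := by
  obtain ⟨R, hcl, hsucc, hpred, hmin, hbd⟩ := E.exists_relation (rigid hE) hcal
  have hstat : ∀ ξ : ℤ → ℝ, (∀ n, R (ξ n) (ξ (n + 1))) → E.Stationary ξ := fun ξ hξ n w =>
    hmin _ _ _ w (by have := hξ (n - 1); rwa [sub_add_cancel] at this) (hξ n)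
  have horb : ∀ s, ∃ ξ : ℤ → ℝ, ξ 0 = s ∧ ∀ n, R (ξ n) (ξ (n + 1)) := fun s => by
    obtain ⟨o, o0, ho⟩ := MongeCost.exists_orbit (K := univ) (Q := R)
      (fun x _ => (hsucc x).imp fun _ h => ⟨mem_univ _, h⟩) (mem_univ s)
    obtain ⟨v, v0, hv⟩ := MongeCost.exists_orbit (K := univ) (Q := fun x y => R y x)
      (fun x _ => (hpred x).imp fun _ h => ⟨mem_univ _, h⟩) (mem_univ s)
    refine ⟨fun n => if 0 ≤ n then o n.toNat else v (-n).toNat, by simpa using o0, fun n => ?_⟩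
    beta_reduce
    rcases lt_trichotomy n (-1) with hn | rfl | hn
    · rw [if_neg (by omega), if_neg (by omega),
        show (-n).toNat = (-(n + 1)).toNat + 1 by omega]
      exact hv _
    · have := hv 0
      simpa [o0, v0] using this
    · rw [if_pos (by omega), if_pos (by omega), show (n + 1).toNat = n.toNat + 1 by omega]
      exact ho _
  choose ξ ξ0 hξ using horb
  choose T F hF using fun s => A.exists_isPath (ξ s)
  have hstep : ∀ s n, |ξ s (n + 1) - ξ s n| ≤ E.ℓ := fun s n => by
    rw [abs_sub_comm]
    exact hbd _ _ (hξ s n)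
  obtain ⟨β, hβ, K, hK⟩ := A.exists_drift E.ℓ
  have hlip : ∀ s, LipschitzWith (Real.toNNReal G.m⁻¹) (F s) := fun s =>
    LipschitzWith.of_dist_le_mul fun t t' => by
      rw [Real.coe_toNNReal _ (inv_nonneg.2 G.m_pos.le), dist_eq_norm, Real.dist_eq,
        inv_mul_eq_div]
      exact (G.norm_le _ _).trans (div_le_div_of_nonneg_right ((hF s).lip _ _) G.m_pos.le)
  refine ⟨F, continuous_prod_of_continuous_lipschitzWith' _ _ hlip fun t => ?_,
    fun s t => IsPath.locIsoAt hE (hF s) (hstat _ (hξ s)) t, fun s => by rw [(hF s).start, ξ0],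
    fun s => (hF s).lip, β, hβ, K, fun s t => hK _ _ _ (hF s) (hstep s) t⟩
  refine continuous_iff_ultrafilter.2 fun s U hU => ?_
  obtain ⟨ξ', T', L, hL, h0, hξ', hlim⟩ := exists_limit_path hU hF hstep ξ0
  have hR' : ∀ n, R (ξ' n) (ξ' (n + 1)) := fun n =>
    hcl.mem_of_tendsto ((hξ' n).prodMk_nhds (hξ' (n + 1)))
      (Eventually.of_forall fun x => hξ x n)
  have hs : E.Stationary (MongeCost.splice ξ' (ξ s)) := hstat _ fun n => by
    simp only [MongeCost.splice]
    rcases lt_trichotomy n (-1) with hn | rfl | hn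
    · rw [if_pos (by omega), if_pos (by omega)]
      exact hR' n
    · have := hR' (-1)
      simpa [h0, ξ0] using this
    · rw [if_neg (by omega), if_neg (by omega)]
      exact hξ s n
  have := (IsPath.unique hE hL (hF s) (hstat _ hR') (hstat _ (hξ s)) hs (by rw [h0, ξ0])).1
  rw [← this]
  exact hlim t

end Axis

end GeoPlane

namespace GeoPlane

variable {G : GeoPlane}

/-- A foliation by unbounded geodesics transverse to an axis excludes closed geodesics. -/
lemma Axis.not_periodic_of_foliation (A : G.Axis) {F : ℝ → ℝ → ℝ × ℝ}
    (hF : Continuous fun z : ℝ × ℝ => F z.1 z.2) (hiso : ∀ s t, LocIsoAt G.d (F s) t)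
    (h0 : ∀ s, F s 0 = A.S s) (hlip : ∀ s t t', G.d (F s t) (F s t') ≤ |t - t'|) {β K : ℝ}
    (hβ : 0 < β)
    (hK : ∀ s t, (0 ≤ t → β * t - K ≤ (F s t).1) ∧ (t ≤ 0 → (F s t).1 ≤ β * t + K))
    {c : ℝ → ℝ × ℝ} (hc : ∀ t, LocIsoAt G.d c t) {p : ℝ} (hp : 0 < p) :
    ¬ ∀ t, c (t + p) = c t := by
  intro hper
  have cc : Continuous c := G.continuous_of_locIso hc
  have hm := G.m_pos
  have hℓ := A.ℓ_pos
  obtain ⟨M, hM⟩ : ∃ M, ∀ t, ‖c t‖ ≤ M := by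
    obtain ⟨M, hM⟩ := (isCompact_Icc (a := (0 : ℝ)) (b := p)).exists_bound_of_continuousOn
      cc.continuousOn
    refine ⟨M, fun t => ?_⟩
    obtain ⟨s, hs, hs'⟩ := Function.Periodic.exists_mem_Ico₀ (f := c) hper hp t
    rw [hs']
    exact hM s ⟨hs.1, hs.2.le⟩
  have hM1 : ∀ t, |(c t).1| ≤ M := fun t => (norm_fst_le (c t)).trans (hM t)
  have hM2 : ∀ t, |(c t).2| ≤ M := fun t => (norm_snd_le (c t)).trans (hM t)
  have hM0 : 0 ≤ M := (norm_nonneg _).trans (hM 0)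
  have hK0 : 0 ≤ K := by
    have h1 := (hK 0 0).1 le_rfl
    have h2 := (hK 0 0).2 le_rfl
    linarith
  obtain ⟨K₂, hK₂⟩ := A.exists_bound
  have hK₂0 : 0 ≤ K₂ := (abs_nonneg _).trans (hK₂ 0).1
  obtain ⟨τ, hτ, hτ0⟩ : ∃ τ, β * τ = M + K + 1 ∧ 0 < τ :=
    ⟨(M + K + 1) / β, by field_simp, by positivity⟩
  have right : ∀ s t, τ ≤ t → M < (F s t).1 := fun s t ht => by
    have h1 := (hK s t).1 (hτ0.le.trans ht)
    have h2 := mul_le_mul_of_nonneg_left ht hβ.le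
    linarith
  have left : ∀ s t, t ≤ -τ → (F s t).1 < -M := fun s t ht => by
    have h1 := (hK s t).2 (by linarith)
    have h2 := mul_le_mul_of_nonneg_left ht hβ.le
    linarith
  have near : ∀ s t, |t| ≤ τ → |(F s t).2 - s / A.ℓ| ≤ τ / G.m + K₂ := fun s t ht => by
    have h1 : ‖F s t - F s 0‖ ≤ τ / G.m := (G.norm_le _ _).trans <|
      div_le_div_of_nonneg_right ((hlip s t 0).trans (by simpa using ht)) hm.le
    have h2 := (norm_snd_le (F s t - F s 0)).trans h1
    rw [h0, Real.norm_eq_abs, Prod.snd_sub] at h2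
    linarith [abs_sub_le (F s t).2 (A.S s).2 (s / A.ℓ), (hK₂ s).2]
  obtain ⟨b, hb, hb0⟩ : ∃ b, b / A.ℓ = M + (τ / G.m + K₂) + 1 ∧ 0 < b :=
    ⟨(M + (τ / G.m + K₂) + 1) * A.ℓ, by field_simp, by positivity⟩
  have meet : ∀ s t u, F s t = c u → t ∈ Icc (-τ) τ ∧ s ∈ Icc (-b) b := fun s t u h => by
    obtain ⟨h1, h2⟩ := abs_le.1 (hM1 u)
    rw [← h] at h1 h2
    have ht : t ∈ Icc (-τ) τ := by
      constructor
      · by_contra! h3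
        linarith [left s t h3.le]
      · by_contra! h3
        linarith [right s t h3.le]
    refine ⟨ht, ?_⟩
    obtain ⟨h3, h4⟩ := abs_le.1 (near s t (abs_le.2 ht))
    obtain ⟨h5, h6⟩ := abs_le.1 (hM2 u)
    rw [← h] at h5 h6
    have e : -b / A.ℓ = -(M + (τ / G.m + K₂) + 1) := by rw [neg_div, hb]
    exact ⟨(div_le_div_iff_of_pos_right hℓ).1 (by linarith),
      (div_le_div_iff_of_pos_right hℓ).1 (by linarith)⟩
  have nonempty : ∃ s t, F s t = c 0 := by
    have key := poincare_miranda
      (D := fun z => F (b * (2 * z.2 - 1)) (τ * (2 * z.1 - 1)) - c 0) ?_ ?_ ?_ ?_ ?_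
    · obtain ⟨x, -, y, -, h⟩ := key
      exact ⟨_, _, sub_eq_zero.1 h⟩
    · refine Continuous.continuousOn (Continuous.sub ?_ continuous_const)
      exact hF.comp (by fun_prop : Continuous fun z : ℝ × ℝ =>
        (b * (2 * z.2 - 1), τ * (2 * z.1 - 1)))
    · intro u _
      have h1 := left (b * (2 * u - 1)) (τ * (2 * 0 - 1)) (by linarith)
      have h2 := (abs_le.1 (hM1 0)).1
      simp only [Prod.fst_sub]
      linarith
    · intro u _
      have h1 := right (b * (2 * u - 1)) (τ * (2 * 1 - 1)) (by linarith)
      have h2 := (abs_le.1 (hM1 0)).2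
      simp only [Prod.fst_sub]
      linarith
    · intro u hu
      have h1 := near (b * (2 * 0 - 1)) (τ * (2 * u - 1))
        (abs_le.2 ⟨by nlinarith [hu.1], by nlinarith [hu.2]⟩)
      have e : b * (2 * 0 - 1) / A.ℓ = -(M + (τ / G.m + K₂) + 1) := by
        rw [← hb]; ring
      have h2 := (abs_le.1 (hM2 0)).1
      rw [e] at h1
      have h3 := (abs_le.1 h1).2
      refine sub_neg.2 (show (F (b * (2 * 0 - 1)) (τ * (2 * u - 1))).2 < (c 0).2 from ?_)
      generalize (F (b * (2 * 0 - 1)) (τ * (2 * u - 1))).2 = X at h3 ⊢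
      linarith
    · intro u hu
      have h1 := near (b * (2 * 1 - 1)) (τ * (2 * u - 1))
        (abs_le.2 ⟨by nlinarith [hu.1], by nlinarith [hu.2]⟩)
      have e : b * (2 * 1 - 1) / A.ℓ = M + (τ / G.m + K₂) + 1 := by
        rw [← hb]; ring
      have h2 := (abs_le.1 (hM2 0)).2
      rw [e] at h1
      have h3 := (abs_le.1 h1).1
      refine sub_pos.2 (show (c 0).2 < (F (b * (2 * 1 - 1)) (τ * (2 * u - 1))).2 from ?_)
      generalize (F (b * (2 * 1 - 1)) (τ * (2 * u - 1))).2 = X at h3 ⊢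
      linarith
  have red : ∀ u, ∃ v ∈ Icc 0 p, c u = c v := fun u => by
    obtain ⟨v, hv, h⟩ := Function.Periodic.exists_mem_Ico₀ (f := c) hper hp u
    exact ⟨v, ⟨hv.1, hv.2.le⟩, h⟩
  have hcomp : IsCompact ((Icc (-b) b ×ˢ Icc (-τ) τ ×ˢ Icc 0 p) ∩
      {z : ℝ × ℝ × ℝ | F z.1 z.2.1 = c z.2.2}) :=
    (isCompact_Icc.prod (isCompact_Icc.prod isCompact_Icc)).inter_right <| isClosed_eq
      (hF.comp (by fun_prop : Continuous fun z : ℝ × ℝ × ℝ => (z.1, z.2.1)))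
      (cc.comp (by fun_prop : Continuous fun z : ℝ × ℝ × ℝ => z.2.2))
  obtain ⟨⟨s, t, u⟩, ⟨-, hstu⟩, hmax⟩ := hcomp.exists_isMaxOn (by
    obtain ⟨s, t, h⟩ := nonempty
    exact ⟨(s, t, 0), ⟨(meet s t 0 h).2, (meet s t 0 h).1, le_rfl, hp.le⟩, h⟩)
    continuous_fst.continuousOn
  have top : ∀ s' t' u', F s' t' = c u' → s' ≤ s := fun s' t' u' h => by
    obtain ⟨v, hv, hv'⟩ := red u'
    have h1 := meet s' t' u' h
    exact isMaxOn_iff.1 hmax (s', t', v) ⟨⟨h1.2, h1.1, hv⟩, h.trans hv'⟩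
  rcases G.cross c (F s) u t hc (hiso s) (Eq.symm hstu) with ⟨σ, hσ, h⟩ | ⟨δ, hδ, ρ, hρ, h⟩
  · have h1 := h (σ * (τ - t))
    have e : t + σ * (σ * (τ - t)) = τ := by
      rcases hσ with rfl | rfl <;> ring
    rw [e] at h1
    have h2 := right s τ le_rfl
    rw [← h1] at h2
    linarith [(abs_le.1 (hM1 (u + σ * (τ - t)))).2]
  · have ev : ∀ᶠ s' in 𝓝 s, ∀ v ∈ Icc (t - ρ) (t + ρ), ‖F s' v - F s v‖ < δ := by
      refine isCompact_Icc.eventually_forall_of_forall_eventually fun v _ => ?_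
      have hcont : Continuous fun z : ℝ × ℝ => ‖F z.1 z.2 - F s z.2‖ :=
        (hF.sub (hF.comp (by fun_prop : Continuous fun z : ℝ × ℝ => (s, z.2)))).norm
      exact hcont.continuousAt.eventually (gt_mem_nhds (by simpa using hδ))
    obtain ⟨s', h1, h2⟩ := ((ev.filter_mono nhdsWithin_le_nhds).and
      (self_mem_nhdsWithin (a := s) (s := Ioi s))).exists
    obtain ⟨u', v, -, h3⟩ := h (F s')
      (hF.comp (by fun_prop : Continuous fun v : ℝ => (s', v))).continuousOn h1
    exact absurd (top s' v u' h3.symm) (not_le.2 h2)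

/-- A closed geodesic forces an axis of a proper multiple of a horizontal translation which is not
invariant under that translation. -/
lemma exists_nonprimitive_axis (G : GeoPlane) {c : ℝ → ℝ × ℝ} (hc : ∀ t, LocIsoAt G.d c t)
    {p : ℝ} (hp : 0 < p) (hper : ∀ t, c (t + p) = c t) {m : ℕ} (hm : 1 ≤ m) :
    ∃ (k : ℤ) (α : ℝ → ℝ × ℝ) (q : ℝ), 2 ≤ k ∧ (∀ t, LocIsoAt G.d α t) ∧
      (∀ t, α (t + q) = α t + lat (k * m, 0)) ∧ range α ≠ range fun t => α t + lat (m, 0) := by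
  obtain ⟨A⟩ := G.exists_axis
  obtain ⟨E, -, e, hE⟩ := A.exists_cost
  by_cases hcal : ∀ a b, E.IsGap a b → ∃ u, E.Calibrates u a b
  · obtain ⟨F, h1, h2, h3, h4, β, hβ, K, h5⟩ := Axis.exists_foliation hE hcal
    exact absurd hper (A.not_periodic_of_foliation h1 h2 h3 h4 hβ h5 hc hp)
  · push Not at hcal
    obtain ⟨a, b, hg, hno⟩ := hcal
    have ha := hg.2.1
    have hb := hg.2.2.1
    obtain ⟨x, hx, hup⟩ : ∃ x ∈ Ioo a b,
        E.potential a b < E.potential a x + E.potential x b := by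
      by_contra! H
      obtain ⟨u, hu⟩ := MongeCost.exists_calibrates_up ha hb fun x hx => by
        rcases eq_or_lt_of_le hx.1 with rfl | h1
        · rw [MongeCost.potential_self _ ha, zero_add]
        rcases eq_or_lt_of_le hx.2 with rfl | h2
        · rw [MongeCost.potential_self _ hb, add_zero]
        exact le_antisymm (H x ⟨h1, h2⟩) (E.potential_tri a x b)
      exact hno u hu
    obtain ⟨y, hy, hdn⟩ : ∃ y ∈ Ioo a b,
        E.potential b a < E.potential b y + E.potential y a := by
      by_contra! H
      obtain ⟨u, hu⟩ := MongeCost.exists_calibrates_down ha hb fun x hx => by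
        rcases eq_or_lt_of_le hx.1 with rfl | h1
        · rw [MongeCost.potential_self _ ha, add_zero]
        rcases eq_or_lt_of_le hx.2 with rfl | h2
        · rw [MongeCost.potential_self _ hb, zero_add]
        exact le_antisymm (H x ⟨h1, h2⟩) (E.potential_tri b x a)
      exact hno u hu
    obtain ⟨n₀, H⟩ := MongeCost.exists_oscillating hg hx hy hup hdn
    refine A.exists_axis_of_oscillating hm (n₀ := n₀) fun N hN => ?_
    obtain ⟨η, h1, h2, h3⟩ := H N hN
    refine ⟨η, h1, fun i => (h2 i).mono fun w hw => ?_, h3⟩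
    rw [hE, hE, hE, hE]
    linarith

end GeoPlane

/-- Every nonzero lattice vector is a positive multiple of a member of a lattice basis. -/
lemma exists_lattice_equiv {τ : ℤ × ℤ} (hτ : τ ≠ 0) : ∃ (m : ℕ) (A : (ℝ × ℝ) ≃L[ℝ] ℝ × ℝ),
    1 ≤ m ∧ (∀ k, ∃ k', A (lat k) = lat k') ∧ ∀ n : ℤ, A (lat (n * m, 0)) = lat (n • τ) := by
  obtain ⟨a, b⟩ := τ
  have hm : 0 < Int.gcd a b := Int.gcd_pos_iff.2 <| by
    by_contra! h
    exact hτ (Prod.ext h.1 h.2)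
  obtain ⟨a', b', -, ha, hb⟩ := Int.exists_gcd_one hm
  have hbez := Int.gcd_eq_gcd_ab a b
  obtain ⟨m, hmd⟩ : ∃ m, m = Int.gcd a b := ⟨_, rfl⟩
  obtain ⟨x, y, hxy⟩ : ∃ x y : ℤ, (m : ℤ) = a * x + b * y := ⟨_, _, hmd ▸ hbez⟩
  rw [← hmd] at ha hb hm
  have hdet : a' * x + b' * y = 1 := by
    have hm' : (m : ℤ) ≠ 0 := by exact_mod_cast hm.ne'
    refine mul_right_cancel₀ hm' ?_
    rw [one_mul]
    conv_rhs => rw [hxy, ha, hb]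
    ring
  have hdetR : (a' : ℝ) * x + b' * y = 1 := by exact_mod_cast hdet
  have haR : (a : ℝ) = a' * m := by exact_mod_cast ha
  have hbR : (b : ℝ) = b' * m := by exact_mod_cast hb
  let e : (ℝ × ℝ) ≃ₗ[ℝ] ℝ × ℝ :=
    { toFun := fun v => (a' * v.1 - y * v.2, b' * v.1 + x * v.2)
      invFun := fun v => (x * v.1 + y * v.2, -b' * v.1 + a' * v.2)
      map_add' := fun v w => by ext <;> simp <;> ring
      map_smul' := fun r v => by ext <;> simp <;> ring
      left_inv := fun v => by
        ext
        · simp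
          linear_combination v.1 * hdetR
        · simp
          linear_combination v.2 * hdetR
      right_inv := fun v => by
        ext
        · simp
          linear_combination v.1 * hdetR
        · simp
          linear_combination v.2 * hdetR }
  refine ⟨m, e.toContinuousLinearEquiv, hm, fun k => ⟨(a' * k.1 - y * k.2, b' * k.1 + x * k.2), ?_⟩,
    fun n => ?_⟩
  · simp [e, lat]
  · simp only [LinearEquiv.coe_toContinuousLinearEquiv', LinearEquiv.coe_mk, LinearMap.coe_mk,
      AddHom.coe_mk, e, lat, Prod.smul_mk, smul_eq_mul]
    push_cast
    rw [haR, hbR]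
    ext <;> simp <;> ring

/-- If there exists a contractible closed geodesic on `T²` (equivalently, a closed geodesic
on the universal covering `ℝ²`, since a closed geodesic on `T²` is contractible iff its
lift to `ℝ²` is closed), then for every nontrivial translation element `τ` there exist an
integer `k ≥ 2` and a non-primitive axis of `τ^k`, i.e. an axis `α` of `τ^k` with
`α(ℝ) ≠ τ α(ℝ)`. -/
theorem stmt8 (M : TorusMetric)
    (hex : ∃ (c : ℝ → ℝ × ℝ) (p : ℝ), M.IsGeodesic c ∧ 0 < p ∧ ∀ t, c (t + p) = c t) :
    ∀ τ : ℤ × ℤ, τ ≠ 0 → ∃ (k : ℤ) (α : ℝ → ℝ × ℝ), 2 ≤ k ∧ IsAxisOf M α (k • τ) ∧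
      Set.range α ≠ Set.range (transl τ α) := by
  intro τ hτ
  obtain ⟨c, p, hc, hp, hper⟩ := hex
  obtain ⟨m, A, hm, hA, hAτ⟩ := exists_lattice_equiv hτ
  obtain ⟨k, α, q, hk, hiso, hq, hne⟩ := (M.geoPlane A hA).exists_nonprimitive_axis
    (c := fun t => A.symm (c t)) (fun t => by
      have := hc.locIsoAt M t
      simpa [LocIsoAt, TorusMetric.geoPlane] using this) hp (fun t => by rw [hper]) hm
  refine ⟨k, fun t => A (α t), hk, ⟨LocIsoAt.isGeodesic M fun t => hiso t,
    smul_ne_zero (by omega) hτ, q, fun t => ?_⟩, fun h => hne ?_⟩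
  · beta_reduce
    rw [hq, map_add, hAτ]
  · have e1 : range (fun t => A (α t)) = A '' range α := range_comp A α
    have e2 : range (transl τ fun t => A (α t)) = A '' range fun t => α t + lat (m, 0) := by
      rw [← range_comp]
      congr 1
      funext t
      have := hAτ 1
      rw [one_mul, one_smul] at this
      simp only [transl, Function.comp_apply, map_add, this]
    rw [e1, e2] at h
    exact A.injective.image_injective h
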